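/- (Boundary pointwise C^{2,ᾱ} regularity.) There exist constants ᾱ ∈ (0,1) and C > 0 depending only on λ and Λ such that the following holds. Let u be continuous on B̄₁ ⊂ ℝ² and a viscosity solution of F(D²u) = 0 in B₁ with u = g on ∂B₁, let x₀ ∈ ∂B₁, and suppose F is uniformly elliptic with constants λ, Λ, F(0) = 0, and g ∈ C^{2,ᾱ}(x₀) (as a function on ∂B₁). Then there exists a quadratic polynomial P_{x₀} on ℝ² such that |u(x) − P_{x₀}(x)| ≤ C|x − x₀|^{2+ᾱ}(‖u‖_{L^∞(B₁)} + ‖g‖_{C^{2,ᾱ}(x₀)}) for all x ∈ B₁, F(D²P_{x₀}) = 0, and |DP_{x₀}(x₀)| + |D²P_{x₀}| ≤ C(‖u‖_{L^∞(B₁)} + ‖g‖_{C^{2,ᾱ}(x₀)}). -/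

import Mathlib

open Metric Set Real
open scoped Classical

noncomputable section

abbrev E2 : Type := EuclideanSpace ℝ (Fin 2)
abbrev Mat2 : Type := Matrix (Fin 2) (Fin 2) ℝ

/-- `‖A⁺‖`: the sum of the positive parts of the eigenvalues of a symmetric matrix `A`. -/
noncomputable def posNorm (A : Mat2) : ℝ :=
  if h : A.IsHermitian then ∑ i, max (h.eigenvalues i) 0 else 0

/-- `‖A⁻‖`: the sum of the negative parts of the eigenvalues of a symmetric matrix `A`. -/
noncomputable def negNorm (A : Mat2) : ℝ :=
  if h : A.IsHermitian then ∑ i, max (-(h.eigenvalues i)) 0 else 0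

/-- A norm on 2×2 matrices: sum of absolute values of entries. -/
noncomputable def matNorm (A : Mat2) : ℝ := ∑ i, ∑ j, |A i j|

/-- `F` is uniformly elliptic with constants `0 < lam ≤ Lam`:
`F M - F N ≤ Lam ‖(M-N)⁺‖ - lam ‖(M-N)⁻‖` for all symmetric `M, N`. -/
def UniformlyElliptic (lam Lam : ℝ) (F : Mat2 → ℝ) : Prop :=
  ∀ M N : Mat2, M.IsHermitian → N.IsHermitian →
    F M - F N ≤ Lam * posNorm (M - N) - lam * negNorm (M - N)

/-- The Hessian matrix `D²u(x)` of `u : ℝ² → ℝ` at `x`. -/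
noncomputable def hess (u : E2 → ℝ) (x : E2) : Mat2 :=
  Matrix.of fun i j =>
    fderiv ℝ (fun y => fderiv ℝ u y (EuclideanSpace.single j 1)) x (EuclideanSpace.single i 1)

/-- `sup_s |u|`, the `L^∞` norm of `u` on `s`. -/
noncomputable def supAbs (u : E2 → ℝ) (s : Set E2) : ℝ := ⨆ x ∈ s, |u x|

/-- `u` is a viscosity solution of `F(D²u) = 0` on `Ω`. -/
def IsViscositySol (F : Mat2 → ℝ) (u : E2 → ℝ) (Ω : Set E2) : Prop :=
  ∀ φ : E2 → ℝ, ContDiff ℝ 2 φ → ∀ x₀ ∈ Ω,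
    (IsLocalMax (fun x => u x - φ x) x₀ → 0 ≤ F (hess φ x₀)) ∧
    (IsLocalMin (fun x => u x - φ x) x₀ → F (hess φ x₀) ≤ 0)

noncomputable def vecNorm (v : Fin 2 → ℝ) : ℝ := Real.sqrt (∑ i, (v i) ^ 2)

/-- A quadratic polynomial on ℝ², `P(x) = a + b·x + ½ xᵀQx` with `Q = D²P` symmetric. -/
structure QuadPoly where
  a : ℝ
  b : Fin 2 → ℝ
  Q : Mat2
  symm : Q.IsHermitian

noncomputable def QuadPoly.eval (P : QuadPoly) (x : E2) : ℝ :=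
  P.a + (∑ i, P.b i * x i) + (1 / 2) * ∑ i, ∑ j, P.Q i j * x i * x j

/-- The gradient `DP(x) = b + Qx` of a quadratic polynomial. -/
noncomputable def QuadPoly.grad (P : QuadPoly) (x : E2) : Fin 2 → ℝ :=
  fun i => P.b i + ∑ j, P.Q i j * x j

/-- `(Q, K)` witnesses that `g ∈ C^{2,α}(x₀)` as a function on `∂B₁`:
`|g(x) − Q(x)| ≤ K |x − x₀|^{2+α}` on `∂B₁`. -/
def PtHolderData (α : ℝ) (g : E2 → ℝ) (x₀ : E2) (Q : QuadPoly) (K : ℝ) : Prop :=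
  0 ≤ K ∧ ∀ x ∈ sphere (0 : E2) 1, |g x - Q.eval x| ≤ K * ‖x - x₀‖ ^ (2 + α)

/-- `‖g‖_{C^{2,α}(x₀)}`: the infimum over admissible `(Q, K)` of
`K + |Q(x₀)| + |DQ(x₀)| + |D²Q|`. -/
noncomputable def ptHolderNorm (α : ℝ) (g : E2 → ℝ) (x₀ : E2) : ℝ :=
  sInf {v | ∃ Q K, PtHolderData α g x₀ Q K ∧
    v = K + |Q.eval x₀| + vecNorm (Q.grad x₀) + matNorm Q.Q}

open Filter Topology

abbrev R2 : Type := ℝ × ℝ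

/-- eigenvalue gap of the symmetric matrix `[[p,q],[q,r]]`. -/
def dev (p q r : ℝ) : ℝ := √((p - r) ^ 2 + 4 * q ^ 2)

lemma dev_nonneg (p q r : ℝ) : 0 ≤ dev p q r := Real.sqrt_nonneg _

lemma dev_sq (p q r : ℝ) : dev p q r ^ 2 = (p - r) ^ 2 + 4 * q ^ 2 :=
  Real.sq_sqrt (by positivity)

lemma dev_neg (p q r : ℝ) : dev (-p) (-q) (-r) = dev p q r := by
  unfold dev; congr 1; ring

lemma dev_shift (p q r s : ℝ) : dev (p + s) q (r + s) = dev p q r := by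
  unfold dev; congr 1; ring

lemma dev_smul (c p q r : ℝ) (hc : 0 ≤ c) : dev (c * p) (c * q) (c * r) = c * dev p q r := by
  unfold dev
  rw [show (c * p - c * r) ^ 2 + 4 * (c * q) ^ 2 = c ^ 2 * ((p - r) ^ 2 + 4 * q ^ 2) by ring,
    Real.sqrt_mul (by positivity), Real.sqrt_sq hc]

lemma dev_tri (p q r p' q' r' : ℝ) :
    dev (p + p') (q + q') (r + r') ≤ dev p q r + dev p' q' r' := by
  have h1 := dev_nonneg p q r
  have h2 := dev_nonneg p' q' r'
  have s1 := dev_sq p q r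
  have s2 := dev_sq p' q' r'
  apply Real.sqrt_le_iff.mpr
  refine ⟨by positivity, ?_⟩
  have h3 : (p - r) * (p' - r') + 4 * (q * q') ≤ dev p q r * dev p' q' r' := by
    apply abs_le_of_sq_le_sq' _ (by positivity) |>.2
    rw [mul_pow, s1, s2]
    nlinarith [sq_nonneg ((p - r) * q' - (p' - r') * q)]
  nlinarith

lemma dev_psd (p q r : ℝ) (hp : 0 ≤ p + r) (h : q ^ 2 ≤ p * r) : dev p q r ≤ p + r := by
  apply Real.sqrt_le_iff.mpr
  exact ⟨hp, by nlinarith⟩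

lemma dev_le (p q r : ℝ) : dev p q r ≤ |p| + |r| + 2 * |q| := by
  apply Real.sqrt_le_iff.mpr
  refine ⟨by positivity, ?_⟩
  have h1 := abs_nonneg p
  have h2 := abs_nonneg q
  have h3 := abs_nonneg r
  have h4 : (p - r) ^ 2 ≤ (|p| + |r|) ^ 2 := by
    rw [← sq_abs (p - r)]
    exact pow_le_pow_left₀ (abs_nonneg _) (abs_sub _ _) 2
  rw [← sq_abs q]
  nlinarith [mul_nonneg h1 h2, mul_nonneg h3 h2]

lemma abs_sub_le_dev (p q r : ℝ) : |p - r| ≤ dev p q r := by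
  apply Real.abs_le_sqrt; nlinarith [sq_nonneg q]

/-- quadratic test polynomial -/
def qd (b1 b2 p q r : ℝ) (h : R2) : ℝ :=
  b1 * h.1 + b2 * h.2 + (p * h.1 ^ 2 + 2 * q * h.1 * h.2 + r * h.2 ^ 2) / 2

def SubAt (G : ℝ → ℝ → ℝ → ℝ) (v : R2 → ℝ) (z : R2) : Prop :=
  ∀ b1 b2 p q r, (∀ᶠ h in 𝓝 (0 : R2), v (z + h) ≤ v z + qd b1 b2 p q r h) → 0 ≤ G p q r

def SupAt (G : ℝ → ℝ → ℝ → ℝ) (v : R2 → ℝ) (z : R2) : Prop :=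
  ∀ b1 b2 p q r, (∀ᶠ h in 𝓝 (0 : R2), v z + qd b1 b2 p q r h ≤ v (z + h)) → G p q r ≤ 0

def SolAt (G : ℝ → ℝ → ℝ → ℝ) (v : R2 → ℝ) (z : R2) : Prop := SubAt G v z ∧ SupAt G v z

/-- supersolution of the Pucci-type extremal operator. -/
def SupS (κ : ℝ) (v : R2 → ℝ) (z : R2) : Prop :=
  ∀ b1 b2 p q r, (∀ᶠ h in 𝓝 (0 : R2), v z + qd b1 b2 p q r h ≤ v (z + h)) →
    p + r ≤ κ * dev p q r

def SS (κ : ℝ) (v : R2 → ℝ) (z : R2) : Prop := SupS κ v z ∧ SupS κ (fun x => -v x) z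

structure Op (κ : ℝ) (G : ℝ → ℝ → ℝ → ℝ) : Prop where
  cont : Continuous (fun t : ℝ × ℝ × ℝ => G t.1 t.2.1 t.2.2)
  ell : ∀ p q r p' q' r', G p' q' r' ≤ G p q r →
    0 ≤ (p - p') + (r - r') + κ * dev (p - p') (q - q') (r - r')

lemma SS.neg {κ : ℝ} {v : R2 → ℝ} {z : R2} (h : SS κ v z) : SS κ (fun x => -v x) z := by
  refine ⟨h.2, ?_⟩
  simpa using h.1

/-- solutions of `G = 0` with `G 0 = 0` are in the class. -/
lemma SolAt.ss {κ : ℝ} {G : ℝ → ℝ → ℝ → ℝ} (hG : Op κ G) (h0 : G 0 0 0 = 0) {v : R2 → ℝ} {z : R2}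
    (h : SolAt G v z) : SS κ v z := by
  constructor
  · intro b1 b2 p q r ht
    have h1 := h.2 b1 b2 p q r ht
    have h2 := hG.ell 0 0 0 p q r (by rw [h0]; exact h1)
    simp only [zero_sub] at h2
    rw [dev_neg] at h2
    linarith
  · intro b1 b2 p q r ht
    have h1 := h.1 (-b1) (-b2) (-p) (-q) (-r) (by
      filter_upwards [ht] with h hh
      simp only [qd] at hh ⊢
      linarith)
    have h2 := hG.ell (-p) (-q) (-r) 0 0 0 (by rw [h0]; exact h1)
    simp only [sub_zero] at h2
    rw [dev_neg] at h2
    linarith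

lemma SupS.slack {κ : ℝ} {v : R2 → ℝ} {z : R2} (hv : SupS κ v z) (b1 b2 p q r : ℝ)
    (h : ∀ η > 0, ∀ᶠ h in 𝓝 (0 : R2), v z + qd b1 b2 p q r h - η * (h.1 ^ 2 + h.2 ^ 2) ≤ v (z + h)) :
    p + r ≤ κ * dev p q r := by
  apply le_of_forall_pos_le_add
  intro ε hε
  have h1 := hv b1 b2 (p + -(ε / 2)) q (r + -(ε / 2)) (by
    filter_upwards [h (ε / 4) (by positivity)] with h hh
    refine le_trans (le_of_eq ?_) hh
    simp only [qd]; ring)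
  rw [dev_shift] at h1
  linarith

/-- Locality. -/
lemma SupS.congr {κ : ℝ} {v v' : R2 → ℝ} {z : R2} (hv : SupS κ v z) (h : ∀ᶠ x in 𝓝 z, v x = v' x) :
    SupS κ v' z := by
  intro b1 b2 p q r ht
  apply hv b1 b2 p q r
  have h1 : Tendsto (fun h : R2 => z + h) (𝓝 0) (𝓝 z) := by
    have : Continuous (fun h : R2 => z + h) := by fun_prop
    simpa using this.tendsto 0
  filter_upwards [ht, h1.eventually h] with y hh hh2
  rw [hh2, h.self_of_nhds]; exact hh

lemma SupS.smul_add {κ : ℝ} {v : R2 → ℝ} {z : R2} (hv : SupS κ v z) (c a b1 b2 : ℝ) (hc : 0 < c) :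
    SupS κ (fun x => c * v x + a + b1 * x.1 + b2 * x.2) z := by
  intro d1 d2 p q r ht
  have h1 := hv (c⁻¹ * (d1 - b1)) (c⁻¹ * (d2 - b2)) (c⁻¹ * p) (c⁻¹ * q) (c⁻¹ * r) (by
    filter_upwards [ht] with h hh
    simp only [qd, Prod.fst_add, Prod.snd_add] at hh ⊢
    have : c⁻¹ * (d1 * h.1 + d2 * h.2 + (p * h.1 ^ 2 + 2 * q * h.1 * h.2 + r * h.2 ^ 2) / 2
        - b1 * h.1 - b2 * h.2) ≤ v (z + h) - v z := by
      rw [inv_mul_le_iff₀ hc]; linarith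
    refine le_trans (le_of_eq ?_) (add_le_add_right this (v z) |>.trans (by linarith))
    ring)
  rw [dev_smul _ _ _ _ (by positivity)] at h1
  have h2 : c * (c⁻¹ * p + c⁻¹ * r) ≤ c * (κ * (c⁻¹ * dev p q r)) := by gcongr
  have h3 : c * c⁻¹ = 1 := by field_simp
  calc p + r = c * (c⁻¹ * p + c⁻¹ * r) := by linear_combination (-p - r) * h3
    _ ≤ _ := h2
    _ = _ := by linear_combination (κ * dev p q r) * h3

lemma SS.smul_add {κ : ℝ} {v : R2 → ℝ} {z : R2} (hv : SS κ v z) (c a b1 b2 : ℝ) (hc : 0 < c) :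
    SS κ (fun x => c * v x + a + b1 * x.1 + b2 * x.2) z := by
  refine ⟨hv.1.smul_add c a b1 b2 hc, ?_⟩
  have := hv.2.smul_add c (-a) (-b1) (-b2) hc
  convert this using 1
  funext x; ring

/-- conformal linear map -/
def cmap (z0 : R2) (α β : ℝ) (x : R2) : R2 :=
  (z0.1 + (α * x.1 - β * x.2), z0.2 + (β * x.1 + α * x.2))

lemma cmap_cont (z0 : R2) (α β : ℝ) : Continuous (cmap z0 α β) := by
  unfold cmap; fun_prop

lemma SupS.comp {κ : ℝ} {v : R2 → ℝ} (z0 : R2) (α β : ℝ) (h0 : 0 < α ^ 2 + β ^ 2) {z : R2}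
    (hv : SupS κ v (cmap z0 α β z)) : SupS κ (fun x => v (cmap z0 α β x)) z := by
  intro b1 b2 p q r ht
  set s := α ^ 2 + β ^ 2 with hs
  have hinv : ∀ h : R2, cmap z0 α β (z + ((α * h.1 + β * h.2) / s, (-β * h.1 + α * h.2) / s))
      = cmap z0 α β z + h := by
    intro h
    have : s ≠ 0 := h0.ne'
    ext
    · simp only [cmap, Prod.fst_add, Prod.snd_add]; field_simp; rw [hs]; ring
    · simp only [cmap, Prod.fst_add, Prod.snd_add]; field_simp; rw [hs]; ring
  have hc : Tendsto (fun h : R2 => ((α * h.1 + β * h.2) / s, (-β * h.1 + α * h.2) / s)) (𝓝 0)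
      (𝓝 (0 : R2)) := by
    have : Continuous (fun h : R2 => ((α * h.1 + β * h.2) / s, (-β * h.1 + α * h.2) / s)) := by
      fun_prop
    have h := this.tendsto 0
    simp only [Prod.fst_zero, Prod.snd_zero, mul_zero, add_zero, zero_div, Prod.mk_zero_zero] at h
    exact h
  have h1 := hv ((b1 * α - b2 * β) / s) ((b1 * β + b2 * α) / s)
    ((p * α ^ 2 - 2 * q * α * β + r * β ^ 2) / s ^ 2)
    ((p * α * β + q * (α ^ 2 - β ^ 2) - r * α * β) / s ^ 2)
    ((p * β ^ 2 + 2 * q * α * β + r * α ^ 2) / s ^ 2) (by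
      filter_upwards [hc.eventually ht] with h hh
      rw [hinv] at hh
      refine le_trans (le_of_eq ?_) hh
      simp only [qd]
      field_simp
      ring)
  have hd : dev ((p * α ^ 2 - 2 * q * α * β + r * β ^ 2) / s ^ 2)
    ((p * α * β + q * (α ^ 2 - β ^ 2) - r * α * β) / s ^ 2)
    ((p * β ^ 2 + 2 * q * α * β + r * α ^ 2) / s ^ 2) = s⁻¹ * dev p q r := by
    rw [← dev_smul _ _ _ _ (by positivity)]
    unfold dev
    congr 1
    field_simp
    rw [hs]; ring
  rw [hd] at h1
  have h2 : (p * α ^ 2 - 2 * q * α * β + r * β ^ 2) / s ^ 2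
    + (p * β ^ 2 + 2 * q * α * β + r * α ^ 2) / s ^ 2 = s⁻¹ * (p + r) := by
    field_simp; rw [hs]; ring
  rw [h2] at h1
  have h3 : s⁻¹ * (p + r) ≤ s⁻¹ * (κ * dev p q r) := by linarith
  exact le_of_mul_le_mul_left h3 (by positivity)

lemma SS.comp {κ : ℝ} {v : R2 → ℝ} (z0 : R2) (α β : ℝ) (h0 : 0 < α ^ 2 + β ^ 2) {z : R2}
    (hv : SS κ v (cmap z0 α β z)) : SS κ (fun x => v (cmap z0 α β x)) z :=
  ⟨hv.1.comp z0 α β h0, SupS.comp (v := fun x => -v x) z0 α β h0 hv.2⟩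

lemma norm_sq_le_sq (h : R2) : ‖h‖ ^ 2 ≤ h.1 ^ 2 + h.2 ^ 2 := by
  rw [Prod.norm_def]
  rcases max_cases ‖h.1‖ ‖h.2‖ with ⟨h', _⟩ | ⟨h', _⟩ <;> rw [h', Real.norm_eq_abs, sq_abs]
  · linarith [sq_nonneg h.2]
  · linarith [sq_nonneg h.1]

lemma exp_lower (s : ℝ) (hs : |s| ≤ 1) : 1 + s + s ^ 2 / 2 - |s| ^ 3 ≤ Real.exp s := by
  have h := Real.exp_bound hs (n := 3) (by norm_num)
  simp only [Finset.sum_range_succ, Finset.sum_range_zero, Nat.factorial] at h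
  norm_num at h
  have h1 := (abs_le.mp h).1
  have h2 : 0 ≤ |s| ^ 3 := by positivity
  nlinarith

set_option maxHeartbeats 1600000 in
/-- strict exponential subsolutions cannot touch supersolutions from below. -/
lemma SupS.exp_barrier {κ : ℝ} (hκ0 : 0 ≤ κ) {v : R2 → ℝ} {z : R2} (hv : SupS κ v z)
    (Q : R2 → ℝ) (g1 g2 H11 H12 H22 : ℝ) (hQ : ∀ h, Q (z + h) = Q z + qd g1 g2 H11 H12 H22 h)
    (c k : ℝ) (hc : 0 < c) (hk : 0 < k)
    (hbig : H11 + H22 + κ * dev H11 H12 H22 < k * (1 - κ) * (g1 ^ 2 + g2 ^ 2)) :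
    ¬ ∀ᶠ h in 𝓝 (0 : R2), c * Real.exp (-k * Q (z + h)) - c * Real.exp (-k * Q z) ≤ v (z + h) - v z := by
  intro ht
  set E := c * Real.exp (-k * Q z) with hE
  have hEpos : 0 < E := by positivity
  set e : ℝ := E * k with he
  have hepos : 0 < e := by positivity
  have key := hv.slack (-e * g1) (-e * g2) (e * (-H11 + k * g1 ^ 2)) (e * (-H12 + k * (g1 * g2)))
    (e * (-H22 + k * g2 ^ 2)) (by
    intro η hη
    set B := |g1| + |g2| with hB
    set D := (|H11| + 2 * |H12| + |H22|) / 2 with hD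
    have hB0 : 0 ≤ B := by positivity
    have hD0 : 0 ≤ D := by positivity
    set C := E * ((k * (B + D)) ^ 3 + k ^ 2 * B * D) + 1 with hC
    have hCpos : 0 < C := by positivity
    have hsmall : ∀ᶠ h in 𝓝 (0 : R2), ‖h‖ < min 1 (min (η / C) (1 / (k * (B + D) + 1))) := by
      have : Tendsto (fun h : R2 => ‖h‖) (𝓝 0) (𝓝 0) := by
        simpa using (continuous_norm (E := R2)).tendsto 0
      exact this.eventually (gt_mem_nhds (by positivity))
    filter_upwards [ht, hsmall] with h hh hs
    simp only [lt_min_iff] at hs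
    obtain ⟨hn1, hn2, hn3⟩ := hs
    set n := ‖h‖ with hn
    have hn0 : 0 ≤ n := norm_nonneg h
    have hx : |h.1| ≤ n := by simpa using norm_fst_le h
    have hy : |h.2| ≤ n := by simpa using norm_snd_le h
    set l := g1 * h.1 + g2 * h.2 with hl
    set m := (H11 * h.1 ^ 2 + 2 * H12 * h.1 * h.2 + H22 * h.2 ^ 2) / 2 with hm
    have hlb : |l| ≤ B * n := by
      calc |l| ≤ |g1 * h.1| + |g2 * h.2| := abs_add_le _ _
        _ = |g1| * |h.1| + |g2| * |h.2| := by rw [abs_mul, abs_mul]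
        _ ≤ |g1| * n + |g2| * n := by gcongr
        _ = B * n := by ring
    have hmb : |m| ≤ D * n ^ 2 := by
      have h1 : |m| ≤ (|H11| * |h.1| ^ 2 + 2 * |H12| * |h.1| * |h.2| + |H22| * |h.2| ^ 2) / 2 := by
        rw [hm, abs_div, abs_of_pos (by norm_num : (0:ℝ) < 2)]
        gcongr
        refine (abs_add_three _ _ _).trans (le_of_eq ?_)
        simp only [abs_mul, abs_pow, abs_of_pos (by norm_num : (0:ℝ) < 2)]
      refine h1.trans ?_
      calc _ ≤ (|H11| * n ^ 2 + 2 * |H12| * n * n + |H22| * n ^ 2) / 2 := by gcongr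
        _ = _ := by rw [hD]; ring
    have hqd : qd g1 g2 H11 H12 H22 h = l + m := by simp only [qd, hl, hm]
    set s := -k * (l + m) with hsdef
    have hmb' : |m| ≤ D * n := hmb.trans (by
      apply mul_le_mul_of_nonneg_left _ hD0; exact pow_le_of_le_one hn0 hn1.le two_ne_zero)
    have hsb : |s| ≤ k * (B + D) * n := by
      rw [hsdef, abs_mul, abs_neg, abs_of_pos hk]
      have := abs_add_le l m
      calc k * |l + m| ≤ k * (B * n + D * n) := by gcongr; linarith
        _ = _ := by ring
    have hkBD : 0 ≤ k * (B + D) := by positivity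
    have hs1 : |s| ≤ 1 := by
      refine hsb.trans ?_
      have : n * (k * (B + D) + 1) < 1 := by rwa [lt_div_iff₀ (by positivity)] at hn3
      have h7 : n * (k * (B + D) + 1) = k * (B + D) * n + n := by ring
      linarith
    have hexp := exp_lower s hs1
    have hs3 : |s| ^ 3 ≤ (k * (B + D)) ^ 3 * n ^ 3 := by
      rw [← mul_pow]; gcongr
    have hlm : -(B * D * n ^ 3) ≤ l * m := by
      have : |l * m| ≤ B * n * (D * n ^ 2) := by rw [abs_mul]; gcongr
      have := (abs_le.mp this).1
      linarith [this]
    have e1 : Real.exp (-k * Q (z + h)) = Real.exp (-k * Q z) * Real.exp s := by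
      rw [← Real.exp_add, hQ, hqd]; congr 1; rw [hsdef]; ring
    rw [e1] at hh
    have h2 : E * (Real.exp s - 1) ≤ v (z + h) - v z := by
      refine le_trans (le_of_eq ?_) hh; rw [hE]; ring
    have h3 : s + k ^ 2 * l ^ 2 / 2 - ((k * (B + D)) ^ 3 + k ^ 2 * B * D) * n ^ 3 ≤ Real.exp s - 1 := by
      have : s ^ 2 / 2 ≥ k ^ 2 * l ^ 2 / 2 - k ^ 2 * (B * D * n ^ 3) := by
        have : s ^ 2 = k ^ 2 * (l ^ 2 + 2 * (l * m) + m ^ 2) := by rw [hsdef]; ring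
        rw [this]
        have hk2 : 0 < k ^ 2 := by positivity
        have i1 := mul_le_mul_of_nonneg_left hlm hk2.le
        have i2 := mul_nonneg hk2.le (sq_nonneg m)
        linarith
      linarith
    have h4 := mul_le_mul_of_nonneg_left h3 hEpos.le
    have h5 : E * (((k * (B + D)) ^ 3 + k ^ 2 * B * D) * n ^ 3) ≤ η * (h.1 ^ 2 + h.2 ^ 2) := by
      have i1 : n * C < η := by rwa [lt_div_iff₀ hCpos] at hn2
      have i2 : n ^ 2 ≤ h.1 ^ 2 + h.2 ^ 2 := by
        rw [hn]; exact norm_sq_le_sq h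
      calc E * (((k * (B + D)) ^ 3 + k ^ 2 * B * D) * n ^ 3) = (C - 1) * n * n ^ 2 := by rw [hC]; ring
        _ ≤ η * n ^ 2 := by gcongr; linarith
        _ ≤ _ := by gcongr
    have h6 : qd (-e * g1) (-e * g2) (e * (-H11 + k * g1 ^ 2)) (e * (-H12 + k * (g1 * g2)))
        (e * (-H22 + k * g2 ^ 2)) h = E * (s + k ^ 2 * l ^ 2 / 2) := by
      simp only [qd, hsdef, hl, hm, he]; ring
    rw [h6]
    linarith)
  rw [dev_smul _ _ _ _ hepos.le] at key
  have k1 : (-H11 + k * g1 ^ 2) + (-H22 + k * g2 ^ 2)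
      ≤ κ * dev (-H11 + k * g1 ^ 2) (-H12 + k * (g1 * g2)) (-H22 + k * g2 ^ 2) := by
    have : e * ((-H11 + k * g1 ^ 2) + (-H22 + k * g2 ^ 2))
      ≤ e * (κ * dev (-H11 + k * g1 ^ 2) (-H12 + k * (g1 * g2)) (-H22 + k * g2 ^ 2)) := by linarith
    exact le_of_mul_le_mul_left this hepos
  have k2 := dev_tri (-H11) (-H12) (-H22) (k * g1 ^ 2) (k * (g1 * g2)) (k * g2 ^ 2)
  rw [dev_neg] at k2
  have k3 := dev_psd (k * g1 ^ 2) (k * (g1 * g2)) (k * g2 ^ 2) (by positivity) (by ring_nf; rfl)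
  have k4 : κ * dev (-H11 + k * g1 ^ 2) (-H12 + k * (g1 * g2)) (-H22 + k * g2 ^ 2)
    ≤ κ * (dev H11 H12 H22 + (k * g1 ^ 2 + k * g2 ^ 2)) := by gcongr; linarith
  linarith

/-- quadratic strict barrier -/
lemma SupS.quad_barrier {κ : ℝ} {v : R2 → ℝ} {z : R2} (hv : SupS κ v z)
    (Q : R2 → ℝ) (g1 g2 H11 H12 H22 : ℝ) (hQ : ∀ h, Q (z + h) = Q z + qd g1 g2 H11 H12 H22 h)
    (hbig : κ * dev H11 H12 H22 < H11 + H22) :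
    ¬ IsLocalMax (fun x => Q x - v x) z := by
  intro h
  have hc : Tendsto (fun h : R2 => z + h) (𝓝 0) (𝓝 z) := by
    have : Continuous (fun h : R2 => z + h) := by fun_prop
    simpa using this.tendsto 0
  have := hv g1 g2 H11 H12 H22 (by
    filter_upwards [hc.eventually h] with y hy
    rw [hQ] at hy; linarith)
  linarith

lemma SupS.exp_barrier' {κ : ℝ} (hκ0 : 0 ≤ κ) {v : R2 → ℝ} {z : R2} (hv : SupS κ v z)
    (Q : R2 → ℝ) (g1 g2 H11 H12 H22 : ℝ) (hQ : ∀ h, Q (z + h) = Q z + qd g1 g2 H11 H12 H22 h)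
    (c k d : ℝ) (hc : 0 < c) (hk : 0 < k)
    (hbig : H11 + H22 + κ * dev H11 H12 H22 < k * (1 - κ) * (g1 ^ 2 + g2 ^ 2)) :
    ¬ IsLocalMax (fun x => c * (Real.exp (-k * Q x) - d) - v x) z := by
  intro h
  have hct : Tendsto (fun h : R2 => z + h) (𝓝 0) (𝓝 z) := by
    have : Continuous (fun h : R2 => z + h) := by fun_prop
    simpa using this.tendsto 0
  apply hv.exp_barrier hκ0 Q g1 g2 H11 H12 H22 hQ c k hc hk hbig
  filter_upwards [hct.eventually h] with y hy
  linarith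

/-- Escape lemma. -/
lemma escape {f : R2 → ℝ} {O K : Set R2} (hO : IsOpen O) (hK : IsCompact K) (hKO : K ⊆ O)
    (hf : ContinuousOn f O) (hmax : ∀ z ∈ O, 0 < f z → ¬ IsLocalMax f z) {p : R2} (hp : p ∈ O)
    (hfp : 0 < f p) :
    ∃ C : Set R2, IsPathConnected C ∧ p ∈ C ∧ C ⊆ O ∩ {x | 0 < f x} ∧ ∃ y ∈ C, y ∉ K := by
  set U : Set R2 := O ∩ {x | 0 < f x} with hU
  have hUo : IsOpen U := hf.isOpen_inter_preimage hO isOpen_Ioi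
  have hpU : p ∈ U := ⟨hp, hfp⟩
  set C := connectedComponentIn U p with hC
  have hCo : IsOpen C := hUo.connectedComponentIn
  have hCc : IsConnected C := isConnected_connectedComponentIn_iff.mpr hpU
  have hpC : p ∈ C := mem_connectedComponentIn hpU
  have hCU : C ⊆ U := connectedComponentIn_subset U p
  refine ⟨C, hCo.isConnected_iff_isPathConnected.mp hCc, hpC, hCU, ?_⟩
  by_contra hcon
  push Not at hcon
  have hcl : closure C ⊆ K := closure_minimal hcon hK.isClosed
  have hcc : IsCompact (closure C) := hK.of_isClosed_subset isClosed_closure hcl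
  obtain ⟨z, hz, hzmax⟩ := hcc.exists_isMaxOn ⟨p, subset_closure hpC⟩
    (hf.mono (hcl.trans hKO))
  have hzp : f p ≤ f z := hzmax (subset_closure hpC)
  have hzU : z ∈ U := ⟨hKO (hcl hz), lt_of_lt_of_le hfp hzp⟩
  have hzC : z ∈ C := by
    have h1 : IsPreconnected (insert z C) :=
      hCc.isPreconnected.subset_closure (subset_insert _ _)
        (insert_subset hz subset_closure)
    have h2 : insert z C ⊆ connectedComponentIn U p :=
      h1.subset_connectedComponentIn (mem_insert_of_mem _ hpC) (insert_subset hzU hCU)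
    exact h2 (mem_insert _ _)
  apply hmax z hzU.1 hzU.2
  filter_upwards [hCo.mem_nhds hzC] with y hy
  exact hzmax (subset_closure hy)

/-- Maximum principle on a compact set. -/
lemma max_princ {f : R2 → ℝ} {K : Set R2} (hK : IsCompact K) (hf : ContinuousOn f K)
    (h : ∀ z ∈ K, 0 < f z → (∃ y ∈ K, f z < f y) ∨ (z ∈ interior K ∧ ¬ IsLocalMax f z)) :
    ∀ z ∈ K, f z ≤ 0 := by
  intro x hx
  by_contra hcon
  push Not at hcon
  obtain ⟨z, hz, hzmax⟩ := hK.exists_isMaxOn ⟨x, hx⟩ hf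
  have h0 : 0 < f z := lt_of_lt_of_le hcon (hzmax hx)
  rcases h z hz h0 with ⟨y, hy, hlt⟩ | ⟨hi, hn⟩
  · exact absurd (hzmax hy) (not_le.mpr hlt)
  · apply hn
    filter_upwards [mem_interior_iff_mem_nhds.mp hi] with y hy
    exact hzmax hy

lemma ivt_sin_nonneg (φ : ℝ → ℝ) (hφ : Continuous φ) (h : ∀ t, 0 ≤ Real.sin (φ t))
    (h0 : 0 ≤ φ 0) (h0' : φ 0 ≤ π) : 0 ≤ φ 1 ∧ φ 1 ≤ π := by
  have hiv : ∀ c, c ∈ uIcc (φ 0) (φ 1) → ∃ t, φ t = c := fun c hc => by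
    obtain ⟨t, -, ht⟩ := intermediate_value_uIcc (hφ.continuousOn (s := uIcc 0 1)) hc
    exact ⟨t, ht⟩
  have hpi := Real.pi_pos
  constructor
  · by_contra hcon
    push Not at hcon
    have h1 : max (φ 1) (-(π / 2)) < 0 := max_lt hcon (by linarith)
    obtain ⟨t, ht⟩ := hiv (max (φ 1) (-(π / 2))) (by
      rw [uIcc_of_ge (by linarith)]
      exact ⟨le_max_left _ _, by linarith⟩)
    have h2 := h t
    rw [ht] at h2
    have h3 := Real.sin_neg_of_neg_of_neg_pi_lt h1 (lt_of_lt_of_le (by linarith) (le_max_right _ _))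
    linarith
  · by_contra hcon
    push Not at hcon
    have h1 : π < min (φ 1) (3 * π / 2) := lt_min hcon (by linarith)
    obtain ⟨t, ht⟩ := hiv (min (φ 1) (3 * π / 2)) (by
      rw [uIcc_of_le (by linarith)]
      exact ⟨by linarith, min_le_left _ _⟩)
    have h2 := h t
    rw [ht] at h2
    have h3 := Real.sin_neg_of_neg_of_neg_pi_lt (x := min (φ 1) (3 * π / 2) - 2 * π)
      (by linarith [min_le_right (φ 1) (3 * π / 2)]) (by linarith)
    rw [Real.sin_sub_two_pi] at h3
    linarith

lemma crossing_aux (γ η : ℝ → R2) (hγ : Continuous γ) (hη : Continuous η)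
    (h1 : ∀ t, (γ 0).2 ≤ (η t).2) (h2 : ∀ t, (η t).2 ≤ (γ 1).2)
    (h3 : ∀ s, (η 0).1 < (γ s).1) (h4 : ∀ s, (γ s).1 < (η 1).1) : ∃ s t, γ s = η t := by
  by_contra hcon
  push Not at hcon
  let g : ℝ × ℝ → ℂ := fun p => ⟨(γ p.1).1 - (η p.2).1, (γ p.1).2 - (η p.2).2⟩
  have hg : Continuous g := by
    have : g = fun p => (((γ p.1).1 - (η p.2).1 : ℝ) : ℂ) + (((γ p.1).2 - (η p.2).2 : ℝ) : ℂ) * Complex.I := by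
      funext p; apply Complex.ext <;> simp [g]
    rw [this]; fun_prop
  have hsc : IsSimplyConnected (univ : Set (ℝ × ℝ)) := by
    have : ContractibleSpace (univ : Set (ℝ × ℝ)) := (Homeomorph.Set.univ (ℝ × ℝ)).contractibleSpace
    unfold IsSimplyConnected
    infer_instance
  obtain ⟨θ, hθ, hθe⟩ := Complex.exists_continuousOn_eqOn_exp_comp hsc isOpen_univ hg.continuousOn (by
    rintro ⟨p, -, hp⟩
    have e1 := congrArg Complex.re hp
    have e2 := congrArg Complex.im hp
    simp only [g, Complex.zero_re, Complex.zero_im] at e1 e2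
    exact hcon p.1 p.2 (Prod.ext (by linarith) (by linarith)))
  have hθ' : Continuous θ := by rwa [← continuousOn_univ]
  have hre : ∀ s t, (γ s).1 - (η t).1 = Real.exp (θ (s, t)).re * Real.cos (θ (s, t)).im := by
    intro s t
    rw [← Complex.exp_re]
    exact (congrArg Complex.re (hθe (mem_univ (s, t)))).symm
  have him : ∀ s t, (γ s).2 - (η t).2 = Real.exp (θ (s, t)).re * Real.sin (θ (s, t)).im := by
    intro s t
    rw [← Complex.exp_im]
    exact (congrArg Complex.im (hθe (mem_univ (s, t)))).symm
  obtain ⟨k, hk⟩ : ∃ k : ℤ, |(θ (0, 0)).im - k * (2 * π)| ≤ π := by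
    refine ⟨round ((θ (0, 0)).im / (2 * π)), ?_⟩
    have := abs_sub_round ((θ (0, 0)).im / (2 * π))
    have hpi := Real.pi_pos
    have h5 : (θ (0, 0)).im - (round ((θ (0, 0)).im / (2 * π)) : ℝ) * (2 * π)
      = (2 * π) * ((θ (0, 0)).im / (2 * π) - round ((θ (0, 0)).im / (2 * π))) := by
      field_simp
    rw [h5, abs_mul, abs_of_pos (by positivity)]
    calc (2 * π) * _ ≤ 2 * π * (1 / 2) := by gcongr
      _ = π := by ring
  let φ : ℝ × ℝ → ℝ := fun p => (θ p).im - k * (2 * π)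
  have hφ : Continuous φ := by
    have := Complex.continuous_im.comp hθ'
    exact this.sub continuous_const
  have hc : ∀ s t, 0 < (γ s).1 - (η t).1 → 0 < Real.cos (φ (s, t)) := by
    intro s t h
    rw [hre] at h
    have : Real.cos (φ (s, t)) = Real.cos (θ (s, t)).im := Real.cos_sub_int_mul_two_pi _ k
    rw [this]
    exact pos_of_mul_pos_right h (Real.exp_pos _).le
  have hc' : ∀ s t, (γ s).1 - (η t).1 < 0 → Real.cos (φ (s, t)) < 0 := by
    intro s t h
    rw [hre] at h
    have : Real.cos (φ (s, t)) = Real.cos (θ (s, t)).im := Real.cos_sub_int_mul_two_pi _ k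
    rw [this]
    by_contra hh
    push Not at hh
    have := mul_nonneg (Real.exp_pos (θ (s, t)).re).le hh
    linarith
  have hs : ∀ s t, 0 ≤ (γ s).2 - (η t).2 → 0 ≤ Real.sin (φ (s, t)) := by
    intro s t h
    rw [him] at h
    have : Real.sin (φ (s, t)) = Real.sin (θ (s, t)).im := Real.sin_sub_int_mul_two_pi _ k
    rw [this]
    exact nonneg_of_mul_nonneg_right h (Real.exp_pos _)
  have hs' : ∀ s t, (γ s).2 - (η t).2 ≤ 0 → Real.sin (φ (s, t)) ≤ 0 := by
    intro s t h
    rw [him] at h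
    have : Real.sin (φ (s, t)) = Real.sin (θ (s, t)).im := Real.sin_sub_int_mul_two_pi _ k
    rw [this]
    by_contra hh
    push Not at hh
    have := mul_pos (Real.exp_pos (θ (s, t)).re) hh
    linarith
  have hpi := Real.pi_pos
  -- bottom side
  have hb : ∀ s, |φ (s, 0)| < π / 2 := by
    intro s
    have hcont : Continuous (fun s : ℝ => |φ (s, 0)|) := by fun_prop
    by_contra hh
    push Not at hh
    have h00 : |φ (0, 0)| < π / 2 := by
      by_contra h'
      push Not at h'
      have hk' : |φ (0, 0)| ≤ π := hk
      have := Real.cos_nonpos_of_pi_div_two_le_of_le h' (by linarith)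
      rw [Real.cos_abs] at this
      linarith [hc 0 0 (by linarith [h3 0])]
    obtain ⟨t, -, ht⟩ := intermediate_value_uIcc (hcont.continuousOn (s := uIcc 0 s))
      (show π / 2 ∈ uIcc _ _ by rw [uIcc_of_le (by linarith)]; exact ⟨h00.le, hh⟩)
    have h6 := hc t 0 (by linarith [h3 t])
    rw [← Real.cos_abs] at h6
    simp only at ht
    rw [ht, Real.cos_pi_div_two] at h6
    exact lt_irrefl _ h6
  have hR : 0 ≤ φ (1, 1) ∧ φ (1, 1) ≤ π := by
    refine ivt_sin_nonneg (fun t => φ (1, t)) (by fun_prop) (fun t => hs 1 t (by linarith [h2 t])) ?_ ?_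
    · by_contra hh
      push Not at hh
      have := hs 1 0 (by linarith [h2 0])
      linarith [Real.sin_neg_of_neg_of_neg_pi_lt hh (by linarith [(abs_lt.mp (hb 1)).1])]
    · linarith [(abs_lt.mp (hb 1)).2]
  have hL : 0 ≤ -φ (0, 1) ∧ -φ (0, 1) ≤ π := by
    refine ivt_sin_nonneg (fun t => -φ (0, t)) (by fun_prop) (fun t => ?_) ?_ ?_
    · rw [Real.sin_neg]; linarith [hs' 0 t (by linarith [h1 t])]
    · by_contra hh
      push Not at hh
      have := hs' 0 0 (by linarith [h1 0])
      linarith [Real.sin_pos_of_pos_of_lt_pi (x := φ (0, 0)) (by linarith)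
        (by linarith [(abs_lt.mp (hb 0)).2])]
    · linarith [(abs_lt.mp (hb 0)).1]
  have hcont : Continuous (fun s : ℝ => φ (s, 1)) := by fun_prop
  obtain ⟨t, -, ht⟩ := intermediate_value_uIcc (hcont.continuousOn (s := uIcc 0 1))
      (show (0:ℝ) ∈ uIcc _ _ by rw [uIcc_of_le (by linarith)]; exact ⟨by linarith, by linarith⟩)
  have h7 := hc' t 1 (by linarith [h4 t])
  simp only at ht
  rw [ht, Real.cos_zero] at h7
  linarith

/-- Two paths crossing a rectangle in transversal directions meet. -/
lemma crossing {a b c d : R2} (γ : Path a b) (η : Path c d)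
    (h1 : ∀ t, a.2 ≤ (η t).2) (h2 : ∀ t, (η t).2 ≤ b.2)
    (h3 : ∀ s, c.1 < (γ s).1) (h4 : ∀ s, (γ s).1 < d.1) : ∃ s t, γ s = η t := by
  obtain ⟨s, t, h⟩ := crossing_aux γ.extend η.extend γ.continuous_extend η.continuous_extend
    (fun t => by rw [γ.extend_zero]; exact h1 _) (fun t => by rw [γ.extend_one]; exact h2 _)
    (fun t => by rw [η.extend_zero]; exact h3 _) (fun t => by rw [η.extend_one]; exact h4 _)
  exact ⟨_, _, h⟩

lemma qd_sqsum (z h : R2) : (z + h).1 ^ 2 + (z + h).2 ^ 2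
    = z.1 ^ 2 + z.2 ^ 2 + qd (2 * z.1) (2 * z.2) 2 0 2 h := by
  simp only [qd, Prod.fst_add, Prod.snd_add]; ring

lemma dev_id (a : ℝ) : dev a 0 a = 0 := by simp [dev]

lemma isCompact_disc (R : ℝ) : IsCompact {x : R2 | x.1 ^ 2 + x.2 ^ 2 ≤ R} := by
  apply Metric.isCompact_of_isClosed_isBounded
  · exact isClosed_le (by fun_prop) continuous_const
  · refine (Metric.isBounded_closedBall (x := (0 : R2)) (r := R + 1)).subset ?_
    intro x hx
    rw [mem_closedBall_zero_iff]
    have h1 := norm_sq_le_sq x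
    have h2 : x.1 ^ 2 + x.2 ^ 2 ≤ R := hx
    have h3 : 0 ≤ R := by nlinarith [sq_nonneg x.1, sq_nonneg x.2]
    by_contra h
    push Not at h
    nlinarith

/-- annulus lemma, normalised. -/
lemma annulus0 {κ s : ℝ} (hκ0 : 0 ≤ κ) (hκ1 : κ < 1) (hs : 0 < s) :
    ∃ θ > 0, ∀ (v : R2 → ℝ) (m : ℝ), 0 < m →
      ContinuousOn v {x : R2 | x.1 ^ 2 + x.2 ^ 2 ≤ 1} →
      (∀ x : R2, x.1 ^ 2 + x.2 ^ 2 ≤ 1 → 0 ≤ v x) →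
      (∀ x : R2, x.1 ^ 2 + x.2 ^ 2 < 1 → SupS κ v x) →
      (∀ x : R2, x.1 ^ 2 + x.2 ^ 2 ≤ s ^ 2 → x.1 ^ 2 + x.2 ^ 2 ≤ 1 → m ≤ v x) →
      ∀ x : R2, x.1 ^ 2 + x.2 ^ 2 ≤ 1 → θ * m * (1 - (x.1 ^ 2 + x.2 ^ 2)) ≤ v x := by
  have h1κ : 0 < 1 - κ := by linarith
  obtain ⟨k, hk⟩ : ∃ k, k = 2 / ((1 - κ) * s ^ 2) := ⟨_, rfl⟩
  have hk0 : 0 < k := by rw [hk]; positivity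
  have hks : k * ((1 - κ) * s ^ 2) = 2 := by rw [hk]; field_simp
  refine ⟨k * Real.exp (-k), by positivity, ?_⟩
  intro v m hm hcont hpos hsup hin x hx
  have key := max_princ (f := fun x : R2 => m * (Real.exp (-k * (x.1 ^ 2 + x.2 ^ 2)) - Real.exp (-k)) - v x)
    (isCompact_disc 1) (by
      apply ContinuousOn.sub _ hcont
      apply Continuous.continuousOn; fun_prop) (by
      intro z hz hfz
      right
      have hz' : z.1 ^ 2 + z.2 ^ 2 ≤ 1 := hz
      have hlt : z.1 ^ 2 + z.2 ^ 2 < 1 := by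
        rcases lt_or_eq_of_le hz' with h | h
        · exact h
        · rw [h] at hfz
          have := hpos z hz'
          simp only [mul_one, sub_self, mul_zero, zero_sub] at hfz
          linarith
      have hgt : s ^ 2 < z.1 ^ 2 + z.2 ^ 2 := by
        by_contra hcon
        push Not at hcon
        have h1 := hin z hcon hz'
        have h2 : Real.exp (-k * (z.1 ^ 2 + z.2 ^ 2)) ≤ 1 := by
          rw [Real.exp_le_one_iff]
          have : 0 ≤ k * (z.1 ^ 2 + z.2 ^ 2) := by positivity
          linarith
        have h3 := Real.exp_pos (-k)
        have h4 : m * (Real.exp (-k * (z.1 ^ 2 + z.2 ^ 2)) - Real.exp (-k)) ≤ m * 1 := by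
          gcongr; linarith
        linarith
      constructor
      · apply mem_interior.mpr
        refine ⟨{x : R2 | x.1 ^ 2 + x.2 ^ 2 < 1}, ?_, ?_, hlt⟩
        · intro y hy; exact (show y.1 ^ 2 + y.2 ^ 2 < 1 from hy).le
        · exact isOpen_lt (by fun_prop) continuous_const
      · apply (hsup z hlt).exp_barrier' hκ0 (fun x => x.1 ^ 2 + x.2 ^ 2) (2 * z.1) (2 * z.2) 2 0 2
          (qd_sqsum z) m k (Real.exp (-k)) hm hk0
        rw [dev_id]
        have h5 : k * (1 - κ) * s ^ 2 < k * (1 - κ) * (z.1 ^ 2 + z.2 ^ 2) := by gcongr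
        linarith) x hx
  have h6 := Real.add_one_le_exp (k * (1 - (x.1 ^ 2 + x.2 ^ 2)))
  have h7 : Real.exp (-k * (x.1 ^ 2 + x.2 ^ 2)) = Real.exp (-k) * Real.exp (k * (1 - (x.1 ^ 2 + x.2 ^ 2))) := by
    rw [← Real.exp_add]; congr 1; ring
  rw [h7] at key
  have h8 : Real.exp (-k) * (k * (1 - (x.1 ^ 2 + x.2 ^ 2)))
    ≤ Real.exp (-k) * Real.exp (k * (1 - (x.1 ^ 2 + x.2 ^ 2))) - Real.exp (-k) := by
    have := mul_le_mul_of_nonneg_left h6 (Real.exp_pos (-k)).le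
    linarith
  have h9 := mul_le_mul_of_nonneg_left h8 hm.le
  linarith

/-- annulus lemma. -/
lemma annulus {κ s : ℝ} (hκ0 : 0 ≤ κ) (hκ1 : κ < 1) (hs : 0 < s) :
    ∃ θ > 0, ∀ (v : R2 → ℝ) (c : R2) (R m : ℝ), 0 < m → 0 < R →
      ContinuousOn v {x : R2 | (x.1 - c.1) ^ 2 + (x.2 - c.2) ^ 2 ≤ R ^ 2} →
      (∀ x : R2, (x.1 - c.1) ^ 2 + (x.2 - c.2) ^ 2 ≤ R ^ 2 → 0 ≤ v x) →
      (∀ x : R2, (x.1 - c.1) ^ 2 + (x.2 - c.2) ^ 2 < R ^ 2 → SupS κ v x) →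
      (∀ x : R2, (x.1 - c.1) ^ 2 + (x.2 - c.2) ^ 2 ≤ (s * R) ^ 2 →
        (x.1 - c.1) ^ 2 + (x.2 - c.2) ^ 2 ≤ R ^ 2 → m ≤ v x) →
      ∀ x : R2, (x.1 - c.1) ^ 2 + (x.2 - c.2) ^ 2 ≤ R ^ 2 →
        θ * m * (1 - ((x.1 - c.1) ^ 2 + (x.2 - c.2) ^ 2) / R ^ 2) ≤ v x := by
  obtain ⟨θ, hθ, H⟩ := annulus0 hκ0 hκ1 hs
  refine ⟨θ, hθ, ?_⟩
  intro v c R m hm hR hcont hpos hsup hin x hx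
  have hR2 : 0 < R ^ 2 := by positivity
  have hcm : ∀ y : R2, ((cmap c R 0 y).1 - c.1) ^ 2 + ((cmap c R 0 y).2 - c.2) ^ 2
      = R ^ 2 * (y.1 ^ 2 + y.2 ^ 2) := by
    intro y; simp only [cmap]; ring
  have hle : ∀ y : R2, y.1 ^ 2 + y.2 ^ 2 ≤ 1 →
      ((cmap c R 0 y).1 - c.1) ^ 2 + ((cmap c R 0 y).2 - c.2) ^ 2 ≤ R ^ 2 := by
    intro y hy; rw [hcm]; exact mul_le_of_le_one_right hR2.le hy
  have h := H (fun y => v (cmap c R 0 y)) m hm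
    (hcont.comp (cmap_cont c R 0).continuousOn (fun y hy => hle y hy))
    (fun y hy => hpos _ (hle y hy))
    (fun y hy => by
      apply SupS.comp c R 0 (by simpa using hR2)
      apply hsup
      rw [hcm]; exact mul_lt_of_lt_one_right hR2 hy)
    (fun y hy hy1 => by
      apply hin _ _ (hle y hy1)
      rw [hcm, mul_pow, mul_comm]
      gcongr)
    ((x.1 - c.1) / R, (x.2 - c.2) / R) (by
      simp only [div_pow]
      rw [← add_div, div_le_one hR2]; exact hx)
  have hx' : cmap c R 0 ((x.1 - c.1) / R, (x.2 - c.2) / R) = x := by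
    ext <;> simp only [cmap] <;> field_simp <;> ring
  simp only [hx', div_pow, ← add_div] at h
  exact h

def Bx (a : ℝ) : Set R2 := {x | |x.1| < a ∧ |x.2| < a}

def Bc (a : ℝ) : Set R2 := {x | |x.1| ≤ a ∧ |x.2| ≤ a}

lemma isOpen_Bx (a : ℝ) : IsOpen (Bx a) := by
  apply IsOpen.and <;> exact isOpen_lt (by fun_prop) continuous_const

lemma isCompact_Bc (a : ℝ) : IsCompact (Bc a) := by
  have : Bc a = closedBall (0 : R2) a := by
    ext x
    simp [Bc, Prod.norm_def]
  rw [this]; exact isCompact_closedBall _ _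

lemma Bc_sub_Bx {a b : ℝ} (h : a < b) : Bc a ⊆ Bx b :=
  fun _ hx => ⟨hx.1.trans_lt h, hx.2.trans_lt h⟩

lemma Bx_mono {a b : ℝ} (h : a ≤ b) : Bx a ⊆ Bx b :=
  fun _ hx => ⟨hx.1.trans_le h, hx.2.trans_le h⟩

/-- existence of the high path. -/
lemma high_path {κ : ℝ} (hκ1 : κ < 1) {v : R2 → ℝ} (hc : ContinuousOn v (Bx 8))
    (hss : ∀ z ∈ Bx 8, SS κ v z) {p : R2} (hp : p ∈ Bc 1) (hvp : 1 ≤ v p) :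
    ∃ y : R2, ∃ γ : Path p y, (∀ t, γ t ∈ Bx (57/20) ∧ 1/2 < v (γ t)) ∧ y ∉ Bc (14/5) := by
  obtain ⟨C, hC, hpC, hCs, y, hyC, hy⟩ := escape (f := fun x => (x.1 ^ 2 / 100 - 3/4) - (-v x))
    (isOpen_Bx (57/20)) (isCompact_Bc (14/5)) (Bc_sub_Bx (by norm_num))
    (by
      apply ContinuousOn.sub
      · apply Continuous.continuousOn; fun_prop
      · exact (hc.mono (Bx_mono (by norm_num))).neg)
    (by
      intro z hz _
      apply (hss z (Bx_mono (by norm_num) hz)).2.quad_barrier (fun x => x.1 ^ 2 / 100 - 3/4)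
        (z.1 / 50) 0 (1/50) 0 0
      · intro h; simp only [qd, Prod.fst_add]; ring
      · have : dev (1/50) 0 0 = 1/50 := by
          unfold dev
          rw [show ((1:ℝ)/50 - 0) ^ 2 + 4 * 0 ^ 2 = (1/50) ^ 2 by ring, Real.sqrt_sq (by norm_num)]
        rw [this]; linarith)
    (Bc_sub_Bx (by norm_num) hp) (by nlinarith [sq_nonneg p.1])
  obtain ⟨γ, hγ⟩ := hC.joinedIn p hpC y hyC
  refine ⟨y, γ, fun t => ?_, hy⟩
  have h1 := hCs (hγ t)
  refine ⟨h1.1, ?_⟩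
  have h2 : 0 < ((γ t).1 ^ 2 / 100 - 3/4) - (-v (γ t)) := h1.2
  have h3 := h1.1.1
  have h4 : (γ t).1 ^ 2 ≤ (57/20) ^ 2 := sq_le_sq' (by linarith [(abs_lt.mp h3).1]) (abs_lt.mp h3).2.le
  norm_num at h4
  linarith

/-- one-sided low path. `σ = ±1`. -/
lemma low_path {κ : ℝ} (hκ0 : 0 ≤ κ) (hκ1 : κ < 1) {k : ℝ} (hk : k = 29 / (1 - κ)) {v : R2 → ℝ}
    (hc : ContinuousOn v (Bx 8))
    (hss : ∀ z ∈ Bx 8, SS κ v z) (hpos : ∀ z ∈ Bx 8, 0 ≤ v z) (σ : ℝ) (hσ : σ = 1 ∨ σ = -1) {q : R2}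
    (hq : |q.1| ≤ 1/4 ∧ |q.2 - 2| ≤ 1/4)
    (hvq : v q < 1/2 * Real.exp (-(3 * k)) * (Real.exp (-(11/16 * k)) - Real.exp (-k))) :
    ∃ y : R2, ∃ η : Path q y, (∀ t, 1 < (η t).2 ∧ (η t).2 < 14/5 ∧ v (η t) < 1/2) ∧
      σ * y.1 < -(29/10) := by
  have h1κ : 0 < 1 - κ := by linarith
  have hk0 : 0 < k := by rw [hk]; positivity
  have hkk : k * (1 - κ) = 29 := by rw [hk]; field_simp
  have hσ2 : σ ^ 2 = 1 := by rcases hσ with h | h <;> rw [h] <;> norm_num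
  have hq3 : q ∈ Bx 3 := by
    constructor
    · linarith [hq.1]
    · rw [abs_lt]; constructor <;> linarith [(abs_le.mp hq.2).1, (abs_le.mp hq.2).2]
  have hσx : ∀ x : R2, |σ * x.1| = |x.1| := by
    intro x; rcases hσ with h | h <;> rw [h] <;> simp
  obtain ⟨C, hC, hpC, hCs, y, hyC, hy⟩ := escape
    (f := fun x => (1/2 * Real.exp (-(3 * k))) * (Real.exp (-k * (σ * x.1 + 7 * (x.2 - 2) ^ 2)) - Real.exp (-k)) - v x)
    (isOpen_Bx 3) (isCompact_Bc (29/10)) (Bc_sub_Bx (by norm_num))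
    (by
      apply ContinuousOn.sub
      · apply Continuous.continuousOn; fun_prop
      · exact hc.mono (Bx_mono (by norm_num)))
    (by
      intro z hz _
      apply (hss z (Bx_mono (by norm_num) hz)).1.exp_barrier' hκ0 (fun x => σ * x.1 + 7 * (x.2 - 2) ^ 2)
        σ (14 * (z.2 - 2)) 0 0 14
      · intro h; simp only [qd, Prod.fst_add, Prod.snd_add]; ring
      · positivity
      · exact hk0
      · have : dev 0 0 14 = 14 := by
          unfold dev
          rw [show ((0:ℝ) - 14) ^ 2 + 4 * 0 ^ 2 = 14 ^ 2 by ring, Real.sqrt_sq (by norm_num)]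
        rw [this, hkk, hσ2]
        nlinarith [sq_nonneg (14 * (z.2 - 2))])
    hq3 (by
      have h1 : σ * q.1 + 7 * (q.2 - 2) ^ 2 ≤ 11/16 := by
        have h2 := hq.1
        rw [← hσx] at h2
        have h3 : (q.2 - 2) ^ 2 ≤ (1/4) ^ 2 := sq_le_sq' (abs_le.mp hq.2).1 (abs_le.mp hq.2).2
        have h4 := (abs_le.mp h2).2
        linarith
      have h5 : Real.exp (-(11/16 * k)) ≤ Real.exp (-k * (σ * q.1 + 7 * (q.2 - 2) ^ 2)) := by
        apply Real.exp_le_exp.mpr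
        have := mul_le_mul_of_nonneg_left h1 hk0.le
        linarith
      have h6 : 1/2 * Real.exp (-(3 * k)) * (Real.exp (-(11/16 * k)) - Real.exp (-k))
        ≤ 1/2 * Real.exp (-(3 * k)) * (Real.exp (-k * (σ * q.1 + 7 * (q.2 - 2) ^ 2)) - Real.exp (-k)) := by
        gcongr
      linarith)
  have hin : ∀ x ∈ C, x ∈ Bx 3 ∧ σ * x.1 + 7 * (x.2 - 2) ^ 2 < 1 ∧ v x < 1/2 ∧ 1 < x.2 ∧ x.2 < 14/5 := by
    intro x hx
    obtain ⟨hx3, hf⟩ := hCs hx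
    have hf' : 0 < (1/2 * Real.exp (-(3 * k))) * (Real.exp (-k * (σ * x.1 + 7 * (x.2 - 2) ^ 2)) - Real.exp (-k)) - v x := hf
    have hv0 := hpos x (Bx_mono (by norm_num) hx3)
    have h0 : 0 < Real.exp (-k * (σ * x.1 + 7 * (x.2 - 2) ^ 2)) - Real.exp (-k) :=
      pos_of_mul_pos_right (a := 1/2 * Real.exp (-(3 * k))) (by linarith) (by positivity)
    have h1 : σ * x.1 + 7 * (x.2 - 2) ^ 2 < 1 := by
      have := Real.exp_lt_exp.mp (sub_pos.mp h0)
      by_contra hcon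
      push Not at hcon
      have := mul_le_mul_of_nonneg_left hcon hk0.le
      linarith
    have hsx : -3 < σ * x.1 := by
      have := hx3.1
      rw [← hσx] at this
      exact (abs_lt.mp this).1
    have h2 : (x.2 - 2) ^ 2 < (4/5) ^ 2 := by linarith
    have h3 := abs_lt_of_sq_lt_sq h2 (by norm_num)
    refine ⟨hx3, h1, ?_, by linarith [(abs_lt.mp h3).1], by linarith [(abs_lt.mp h3).2]⟩
    have h4 : Real.exp (-k * (σ * x.1 + 7 * (x.2 - 2) ^ 2)) ≤ Real.exp (3 * k) := by
      apply Real.exp_le_exp.mpr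
      have : k * (-3) ≤ k * (σ * x.1 + 7 * (x.2 - 2) ^ 2) := by
        apply mul_le_mul_of_nonneg_left _ hk0.le
        linarith [sq_nonneg (x.2 - 2)]
      linarith
    have h5 : Real.exp (-(3 * k)) * Real.exp (3 * k) = 1 := by
      rw [← Real.exp_add]; simp
    have h6 : 1/2 * Real.exp (-(3 * k)) * (Real.exp (-k * (σ * x.1 + 7 * (x.2 - 2) ^ 2)) - Real.exp (-k))
        ≤ 1/2 * Real.exp (-(3 * k)) * Real.exp (3 * k) := by
      gcongr
      linarith [Real.exp_pos (-k)]
    linarith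
  obtain ⟨η, hη⟩ := hC.joinedIn q hpC y hyC
  refine ⟨y, η, fun t => ?_, ?_⟩
  · have := hin _ (hη t)
    exact ⟨this.2.2.2.1, this.2.2.2.2, this.2.2.1⟩
  · obtain ⟨h3, h1, -, h4, h5⟩ := hin y hyC
    by_contra hcon
    push Not at hcon
    apply hy
    constructor
    · rw [← hσx, abs_le]
      exact ⟨hcon, by linarith [sq_nonneg (y.2 - 2)]⟩
    · rw [abs_le]; constructor <;> linarith

lemma harnack_top {κ : ℝ} (hκ0 : 0 ≤ κ) (hκ1 : κ < 1) :
    ∃ c > 0, ∀ v : R2 → ℝ, ContinuousOn v (Bx 8) → (∀ z ∈ Bx 8, SS κ v z) → (∀ z ∈ Bx 8, 0 ≤ v z) →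
      ∀ p y : R2, p ∈ Bc 1 → ∀ γ : Path p y, (∀ t, γ t ∈ Bx (57/20) ∧ 1/2 < v (γ t)) →
      14/5 < y.2 → ∀ z ∈ Bc 1, c ≤ v z := by
  obtain ⟨θ, hθ, HA⟩ := annulus (s := 1/20) hκ0 hκ1 (by norm_num)
  obtain ⟨k, hk⟩ : ∃ k, k = 29 / (1 - κ) := ⟨_, rfl⟩
  have hk0 : 0 < k := by rw [hk]; have : 0 < 1 - κ := by linarith
                         positivity
  obtain ⟨m, hm⟩ : ∃ m, m = 1/2 * Real.exp (-(3 * k)) * (Real.exp (-(11/16 * k)) - Real.exp (-k)) := ⟨_, rfl⟩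
  have hm0 : 0 < m := by
    rw [hm]
    apply mul_pos (by positivity)
    rw [sub_pos]; apply Real.exp_lt_exp.mpr; linarith
  refine ⟨θ * m * (3/5), by positivity, ?_⟩
  intro v hc hss hpos p y hp γ hγ hy z hz
  have hbox : ∀ q : R2, |q.1| ≤ 1/4 ∧ |q.2 - 2| ≤ 1/4 → m ≤ v q := by
    intro q hq
    by_contra hcon
    push Not at hcon
    rw [hm] at hcon
    obtain ⟨y1, η1, h1, hy1⟩ := low_path hκ0 hκ1 hk hc hss hpos 1 (Or.inl rfl) hq hcon
    obtain ⟨y2, η2, h2, hy2⟩ := low_path hκ0 hκ1 hk hc hss hpos (-1) (Or.inr rfl) hq hcon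
    have hall : ∀ t, 1 < ((η1.symm.trans η2) t).2 ∧ ((η1.symm.trans η2) t).2 < 14/5 ∧
        v ((η1.symm.trans η2) t) < 1/2 := by
      intro t
      have : (η1.symm.trans η2) t ∈ range η1 ∪ range η2 := by
        rw [← η1.symm_range, ← Path.trans_range]; exact mem_range_self t
      rcases this with ⟨s, hs⟩ | ⟨s, hs⟩
      · rw [← hs]; exact h1 s
      · rw [← hs]; exact h2 s
    obtain ⟨s, t, hst⟩ := crossing γ (η1.symm.trans η2)
      (fun t => by linarith [(hall t).1, (abs_le.mp hp.2).2])
      (fun t => by linarith [(hall t).2.1])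
      (fun s => by linarith [(abs_lt.mp (hγ s).1.1).1])
      (fun s => by linarith [(abs_lt.mp (hγ s).1.1).2])
    have h3 := (hγ s).2
    rw [hst] at h3
    linarith [(hall t).2.2]
  have hsub : ∀ x : R2, (x.1 - 0) ^ 2 + (x.2 - 2) ^ 2 ≤ 5 ^ 2 → x ∈ Bx 8 := by
    intro x hx
    have h1 : |x.1 - 0| ≤ 5 := abs_le_of_sq_le_sq (by linarith [sq_nonneg (x.2 - 2)]) (by norm_num)
    have h2 : |x.2 - 2| ≤ 5 := abs_le_of_sq_le_sq (by linarith [sq_nonneg (x.1 - 0)]) (by norm_num)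
    rw [abs_le] at h1 h2
    constructor <;> rw [abs_lt] <;> constructor <;> linarith
  have h := HA v (0, 2) 5 m hm0 (by norm_num) (hc.mono hsub)
    (fun x hx => hpos x (hsub x hx)) (fun x hx => (hss x (hsub x hx.le)).1)
    (fun x hx _ => by
      apply hbox
      simp only at hx
      constructor
      · have := abs_le_of_sq_le_sq (a := x.1 - 0) (b := 1/4) (by linarith [sq_nonneg (x.2 - 2)]) (by norm_num)
        simpa using this
      · exact abs_le_of_sq_le_sq (by linarith [sq_nonneg (x.1 - 0)]) (by norm_num))
    z
  have hz1 : (z.1 - 0) ^ 2 ≤ 1 ^ 2 := sq_le_sq' (by linarith [(abs_le.mp hz.1).1]) (by linarith [(abs_le.mp hz.1).2])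
  have hz2 : (z.2 - 2) ^ 2 ≤ 3 ^ 2 := sq_le_sq' (by linarith [(abs_le.mp hz.2).1]) (by linarith [(abs_le.mp hz.2).2])
  have h' := h (by simp only; linarith)
  simp only at h'
  refine le_trans ?_ h'
  gcongr
  linarith

lemma harnack_rot {κ c : ℝ} 
    (H : ∀ v : R2 → ℝ, ContinuousOn v (Bx 8) → (∀ z ∈ Bx 8, SS κ v z) → (∀ z ∈ Bx 8, 0 ≤ v z) →
      ∀ p y : R2, p ∈ Bc 1 → ∀ γ : Path p y, (∀ t, γ t ∈ Bx (57/20) ∧ 1/2 < v (γ t)) →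
      14/5 < y.2 → ∀ z ∈ Bc 1, c ≤ v z)
    (α β : ℝ) (hab : α ^ 2 + β ^ 2 = 1) (hrot : ∀ a, ∀ x ∈ Bx a, cmap 0 α β x ∈ Bx a)
    (hroti : ∀ a, ∀ x ∈ Bx a, cmap 0 α (-β) x ∈ Bx a)
    (hrotc : ∀ a, ∀ x ∈ Bc a, cmap 0 α (-β) x ∈ Bc a)
    (v : R2 → ℝ) (hc : ContinuousOn v (Bx 8)) (hss : ∀ z ∈ Bx 8, SS κ v z) (hpos : ∀ z ∈ Bx 8, 0 ≤ v z)
    (p y : R2) (hp : p ∈ Bc 1) (γ : Path p y) (hγ : ∀ t, γ t ∈ Bx (57/20) ∧ 1/2 < v (γ t))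
    (hy : 14/5 < -β * y.1 + α * y.2) : ∀ z ∈ Bc 1, c ≤ v z := by
  intro z hz
  have hinv : ∀ x, cmap 0 α β (cmap 0 α (-β) x) = x := by
    intro x
    ext
    · simp only [cmap, Prod.fst_zero, Prod.snd_zero]; linear_combination x.1 * hab
    · simp only [cmap, Prod.fst_zero, Prod.snd_zero]; linear_combination x.2 * hab
  have h := H (fun x => v (cmap 0 α β x)) (hc.comp (cmap_cont 0 α β).continuousOn (hrot 8))
    (fun x hx => (hss _ (hrot 8 x hx)).comp 0 α β (by rw [hab]; norm_num))
    (fun x hx => hpos _ (hrot 8 x hx)) _ _ (hrotc 1 p hp) (γ.map (cmap_cont 0 α (-β)))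
    (fun t => ⟨hroti _ _ (hγ t).1, by
      simp only [Path.map_coe, Function.comp, hinv]; exact (hγ t).2⟩)
    (by simpa [cmap] using hy) (cmap 0 α (-β) z) (hrotc 1 z hz)
  simpa only [hinv] using h

/-- Harnack inequality. -/
lemma harnack {κ : ℝ} (hκ0 : 0 ≤ κ) (hκ1 : κ < 1) :
    ∃ c > 0, ∀ v : R2 → ℝ, ContinuousOn v (Bx 8) → (∀ z ∈ Bx 8, SS κ v z) → (∀ z ∈ Bx 8, 0 ≤ v z) →
      ∀ p ∈ Bc 1, 1 ≤ v p → ∀ z ∈ Bc 1, c ≤ v z := by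
  obtain ⟨c, hc0, H⟩ := harnack_top hκ0 hκ1
  refine ⟨c, hc0, ?_⟩
  intro v hc hss hpos p hp hvp
  obtain ⟨y, γ, hγ, hy⟩ := high_path hκ1 hc hss hp hvp
  have hcase : 14/5 < y.2 ∨ 14/5 < -y.2 ∨ 14/5 < y.1 ∨ 14/5 < -y.1 := by
    by_contra hcon
    push Not at hcon
    apply hy
    constructor <;> rw [abs_le] <;> constructor <;> linarith
  rcases hcase with h | h | h | h
  · exact H v hc hss hpos p y hp γ hγ h
  · refine harnack_rot H (-1) 0 (by norm_num) ?_ ?_ ?_ v hc hss hpos p y hp γ hγ (by linarith) <;>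
      (intro a x hx; simpa [cmap, Bx, Bc] using hx)
  · refine harnack_rot H 0 (-1) (by norm_num) ?_ ?_ ?_ v hc hss hpos p y hp γ hγ (by linarith) <;>
      (intro a x hx; simpa [cmap, Bx, Bc] using hx.symm)
  · refine harnack_rot H 0 1 (by norm_num) ?_ ?_ ?_ v hc hss hpos p y hp γ hγ (by linarith) <;>
      (intro a x hx; simpa [cmap, Bx, Bc] using hx.symm)

/-- closed (curved) box -/
def Tc (r : ℝ) : Set R2 := {x | |x.1| ≤ 1 ∧ x.2 ≤ 1 ∧ r * (x.1 ^ 2 + x.2 ^ 2) ≤ 2 * x.2}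

/-- open (curved) box -/
def To (r : ℝ) : Set R2 := {x | |x.1| < 1 ∧ x.2 < 1 ∧ r * (x.1 ^ 2 + x.2 ^ 2) < 2 * x.2}

lemma Tc_nonneg {r : ℝ} (hr : 0 ≤ r) {x : R2} (hx : x ∈ Tc r) : 0 ≤ x.2 := by
  have h1 : 0 ≤ r * (x.1 ^ 2 + x.2 ^ 2) := by positivity
  linarith [hx.2.2]

lemma isOpen_To (r : ℝ) : IsOpen (To r) := by
  refine IsOpen.and ?_ (IsOpen.and ?_ ?_) <;> exact isOpen_lt (by fun_prop) (by fun_prop)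

lemma isClosed_Tc (r : ℝ) : IsClosed (Tc r) := by
  refine IsClosed.and ?_ (IsClosed.and ?_ ?_) <;> exact isClosed_le (by fun_prop) (by fun_prop)

lemma To_sub_Tc (r : ℝ) : To r ⊆ Tc r := fun _ h => ⟨h.1.le, h.2.1.le, h.2.2.le⟩

lemma isCompact_Tc {r : ℝ} (hr : 0 ≤ r) : IsCompact (Tc r) := by
  refine (isCompact_Bc 1).of_isClosed_subset (isClosed_Tc r) ?_
  intro x hx
  exact ⟨hx.1, by rw [abs_of_nonneg (Tc_nonneg hr hx)]; exact hx.2.1⟩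

lemma dev_diag (a b : ℝ) : dev a 0 b = |a - b| := by
  unfold dev
  rw [show (a - b) ^ 2 + 4 * 0 ^ 2 = (a - b) ^ 2 by ring, Real.sqrt_sq_eq_abs]

lemma bdry_one {κ : ℝ} (hκ1 : κ < 1) {r N e : ℝ} (hr : 0 ≤ r) (hN : 0 < N) (he : 0 ≤ e) {v : R2 → ℝ}
    (hc : ContinuousOn v (Tc r)) (hss : ∀ z ∈ To r, SupS κ v z) (h1 : ∀ z ∈ Tc r, -N ≤ v z)
    (h2 : ∀ z ∈ Tc r, r * (z.1 ^ 2 + z.2 ^ 2) = 2 * z.2 → -e ≤ v z) {z : R2} (hz : z ∈ Tc r)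
    (hz2 : |z.1| ≤ 1/2) : -(N * (9 / (1 - κ) + 1) * z.2 + e) ≤ v z := by
  have h1κ : 0 < 1 - κ := by linarith
  obtain ⟨M, hM⟩ : ∃ M, M = 9 / (1 - κ) := ⟨_, rfl⟩
  have hM0 : 0 < M := by rw [hM]; positivity
  have hMk : M * (1 - κ) = 9 := by rw [hM]; field_simp
  rw [← hM]
  have hKc : IsCompact (Tc r ∩ {x | |x.1 - z.1| ≤ 1/2}) :=
    (isCompact_Tc hr).inter_right (isClosed_le (by fun_prop) (by fun_prop))
  have key := max_princ
    (f := fun x : R2 => (-e - N * (4 * (x.1 - z.1) ^ 2 + (M + 1) * x.2 - M * x.2 ^ 2)) - v x) hKc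
    (by
      apply ContinuousOn.sub
      · apply Continuous.continuousOn; fun_prop
      · exact hc.mono inter_subset_left)
    (by
      intro x hx hfx
      right
      obtain ⟨hxT, hxz⟩ := hx
      have hxz' : |x.1 - z.1| ≤ 1/2 := hxz
      have hx0 := Tc_nonneg hr hxT
      have hx1 := hxT.2.1
      have hpar : x.2 ≤ (M + 1) * x.2 - M * x.2 ^ 2 := by
        have : 0 ≤ M * (x.2 * (1 - x.2)) := by
          have : 0 ≤ 1 - x.2 := by linarith
          positivity
        linarith
      have hsq := sq_nonneg (x.1 - z.1)
      have hmemT : x ∈ To r ∩ {x : R2 | |x.1 - z.1| < 1/2} := by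
        have hside : |x.1 - z.1| < 1/2 := by
          rcases lt_or_eq_of_le hxz' with h | h
          · exact h
          · exfalso
            have h3 : (x.1 - z.1) ^ 2 = (1/2) ^ 2 := by rw [← sq_abs, h]
            have h4 : N * 1 ≤ N * (4 * (x.1 - z.1) ^ 2 + (M + 1) * x.2 - M * x.2 ^ 2) := by
              apply mul_le_mul_of_nonneg_left _ hN.le
              rw [h3]; linarith
            linarith [h1 x hxT]
        refine ⟨⟨?_, ?_, ?_⟩, hside⟩
        · calc |x.1| = |(x.1 - z.1) + z.1| := by ring_nf
            _ ≤ |x.1 - z.1| + |z.1| := abs_add_le _ _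
            _ < 1 := by linarith
        · rcases lt_or_eq_of_le hx1 with h | h
          · exact h
          · exfalso
            have h4 : N * 1 ≤ N * (4 * (x.1 - z.1) ^ 2 + (M + 1) * x.2 - M * x.2 ^ 2) := by
              apply mul_le_mul_of_nonneg_left _ hN.le
              linarith
            linarith [h1 x hxT]
        · rcases lt_or_eq_of_le hxT.2.2 with h | h
          · exact h
          · exfalso
            have h4 : N * 0 ≤ N * (4 * (x.1 - z.1) ^ 2 + (M + 1) * x.2 - M * x.2 ^ 2) := by
              apply mul_le_mul_of_nonneg_left _ hN.le
              linarith
            linarith [h2 x hxT h]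
      constructor
      · apply mem_interior.mpr
        refine ⟨_, ?_, (isOpen_To r).inter (isOpen_lt (by fun_prop) continuous_const), hmemT⟩
        intro y hy
        exact ⟨To_sub_Tc r hy.1, (show |y.1 - z.1| < 1/2 from hy.2).le⟩
      · apply (hss x hmemT.1).quad_barrier
          (fun x : R2 => -e - N * (4 * (x.1 - z.1) ^ 2 + (M + 1) * x.2 - M * x.2 ^ 2))
          (-(N * (8 * (x.1 - z.1)))) (-(N * (M + 1 - 2 * M * x.2))) (-(8 * N)) 0 (2 * M * N)
        · intro h; simp only [qd, Prod.fst_add, Prod.snd_add]; ring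
        · rw [dev_diag, show -(8 * N) - 2 * M * N = -(N * (8 + 2 * M)) by ring, abs_neg,
            abs_of_pos (by positivity)]
          have : κ * (8 + 2 * M) < -8 + 2 * M := by linarith
          have := mul_lt_mul_of_pos_left this hN
          linarith) z ⟨hz, by simp⟩
  simp only [sub_self] at key
  have h5 : 0 ≤ N * (M * z.2 ^ 2) := by positivity
  linarith

/-- boundary Lipschitz estimate. -/
lemma bdry_lip {κ : ℝ} (hκ1 : κ < 1) {r N e : ℝ} (hr : 0 ≤ r) (hN : 0 < N) (he : 0 ≤ e) {v : R2 → ℝ}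
    (hc : ContinuousOn v (Tc r)) (hss : ∀ z ∈ To r, SS κ v z) (h1 : ∀ z ∈ Tc r, |v z| ≤ N)
    (h2 : ∀ z ∈ Tc r, r * (z.1 ^ 2 + z.2 ^ 2) = 2 * z.2 → |v z| ≤ e) {z : R2} (hz : z ∈ Tc r)
    (hz2 : |z.1| ≤ 1/2) : |v z| ≤ N * (9 / (1 - κ) + 1) * z.2 + e := by
  rw [abs_le]
  constructor
  · exact bdry_one hκ1 hr hN he hc (fun z hz => (hss z hz).1) (fun z hz => (abs_le.mp (h1 z hz)).1)
      (fun z hz h => (abs_le.mp (h2 z hz h)).1) hz hz2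
  · have := bdry_one (v := fun z => -v z) hκ1 hr hN he hc.neg (fun z hz => (hss z hz).2)
      (fun z hz => by linarith [(abs_le.mp (h1 z hz)).2])
      (fun z hz h => by linarith [(abs_le.mp (h2 z hz h)).2]) hz hz2
    linarith

/-- flat closed rectangle -/
def Rc (R : ℝ) : Set R2 := {x | |x.1| ≤ R ∧ 0 ≤ x.2 ∧ x.2 ≤ R}

def Ro (R : ℝ) : Set R2 := {x | |x.1| < R ∧ 0 < x.2 ∧ x.2 < R}

lemma Tc_zero : Tc 0 = Rc 1 := by
  ext x
  simp only [Tc, Rc, mem_ofPred_eq, zero_mul]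
  constructor
  · rintro ⟨a, b, c⟩; exact ⟨a, by linarith, b⟩
  · rintro ⟨a, b, c⟩; exact ⟨a, c, by linarith⟩

lemma To_zero : To 0 = Ro 1 := by
  ext x
  simp only [To, Ro, mem_ofPred_eq, zero_mul]
  constructor
  · rintro ⟨a, b, c⟩; exact ⟨a, by linarith, b⟩
  · rintro ⟨a, b, c⟩; exact ⟨a, c, by linarith⟩

lemma Ro_sub_Rc (R : ℝ) : Ro R ⊆ Rc R := fun _ h => ⟨h.1.le, h.2.1.le, h.2.2.le⟩

lemma isOpen_Ro (r : ℝ) : IsOpen (Ro r) := by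
  refine IsOpen.and ?_ (IsOpen.and ?_ ?_) <;> exact isOpen_lt (by fun_prop) (by fun_prop)

/-- one-sided growth -/
lemma krylov_pos {κ : ℝ} (hκ0 : 0 ≤ κ) (hκ1 : κ < 1) :
    ∃ θ > 0, θ < 1 ∧ ∀ (v : R2 → ℝ) (m : ℝ), 0 < m → ContinuousOn v (Rc 1) → (∀ z ∈ Ro 1, SS κ v z) →
      (∀ z ∈ Rc 1, 0 ≤ v z) → m / 2 ≤ v (0, 1/2) → ∀ z ∈ Rc (1/32), 2 * θ * m * z.2 ≤ v z := by
  obtain ⟨c, hc0, H⟩ := harnack hκ0 hκ1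
  obtain ⟨θ, hθ, HA⟩ := annulus (s := 1/16) hκ0 hκ1 (by norm_num)
  refine ⟨min (1/2) (θ * c / 2), by positivity, lt_of_le_of_lt (min_le_left _ _) (by norm_num), ?_⟩
  intro v m hm hc hss hpos hE z hz
  have hmap : ∀ x ∈ Bx 8, cmap (0, 1/2) (1/16) 0 x ∈ Ro 1 := by
    intro x hx
    have h1 := abs_lt.mp hx.1
    have h2 := abs_lt.mp hx.2
    simp only [cmap, Ro, mem_ofPred_eq]
    refine ⟨?_, by linarith, by linarith⟩
    rw [abs_lt]; constructor <;> linarith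
  have hH := H (fun x => (2 / m) * v (cmap (0, 1/2) (1/16) 0 x) + 0 + 0 * x.1 + 0 * x.2)
    (by
      have : ContinuousOn (fun x => v (cmap (0, 1/2) (1/16) 0 x)) (Bx 8) :=
        hc.comp (cmap_cont _ _ _).continuousOn (fun x hx => Ro_sub_Rc 1 (hmap x hx))
      exact (((this.const_mul _).add continuousOn_const).add (by fun_prop)).add (by fun_prop))
    (fun x hx => ((hss _ (hmap x hx)).comp (0, 1/2) (1/16) 0 (by norm_num)).smul_add (2 / m) 0 0 0 (by positivity))
    (fun x hx => by
      have := hpos _ (Ro_sub_Rc 1 (hmap x hx))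
      have : 0 ≤ 2 / m * v (cmap (0, 1/2) (1/16) 0 x) := by positivity
      linarith)
    0 (by simp [Bc]) (by
      have h3 : 2 / m * (m / 2) ≤ 2 / m * v (0, 1/2) := by gcongr
      have h4 : 2 / m * (m / 2) = 1 := by field_simp
      simp only [cmap, Prod.fst_zero, Prod.snd_zero, mul_zero, sub_zero, add_zero]
      linarith)
  have hinner : ∀ y : R2, |y.1| ≤ 1/16 → |y.2 - 1/2| ≤ 1/16 → c * m / 2 ≤ v y := by
    intro y hy1 hy2
    have h3 := hH (16 * y.1, 16 * (y.2 - 1/2)) (by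
      constructor <;> simp only [abs_mul, abs_of_pos (show (0:ℝ) < 16 by norm_num)] <;> linarith)
    have h4 : cmap (0, 1/2) (1/16) 0 (16 * y.1, 16 * (y.2 - 1/2)) = y := by
      ext <;> simp only [cmap] <;> ring
    rw [h4] at h3
    have h5 : c ≤ 2 / m * v y := by linarith
    have h6 : m / 2 * c ≤ m / 2 * (2 / m * v y) := by gcongr
    have h7 : m / 2 * (2 / m * v y) = v y := by field_simp
    linarith
  have hz1 := abs_le.mp hz.1
  have hsub : ∀ x : R2, (x.1 - z.1) ^ 2 + (x.2 - 1/2) ^ 2 ≤ (1/2) ^ 2 → x ∈ Rc 1 := by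
    intro x hx
    have h1 := abs_le_of_sq_le_sq' (a := x.1 - z.1) (b := 1/2) (by linarith [sq_nonneg (x.2 - 1/2)]) (by norm_num)
    have h2 := abs_le_of_sq_le_sq' (a := x.2 - 1/2) (b := 1/2) (by linarith [sq_nonneg (x.1 - z.1)]) (by norm_num)
    refine ⟨?_, by linarith, by linarith⟩
    rw [abs_le]; constructor <;> linarith
  have hsub' : ∀ x : R2, (x.1 - z.1) ^ 2 + (x.2 - 1/2) ^ 2 < (1/2) ^ 2 → x ∈ Ro 1 := by
    intro x hx
    have h1 := abs_lt_of_sq_lt_sq' (a := x.1 - z.1) (b := 1/2) (by linarith [sq_nonneg (x.2 - 1/2)]) (by norm_num)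
    have h2 := abs_lt_of_sq_lt_sq' (a := x.2 - 1/2) (b := 1/2) (by linarith [sq_nonneg (x.1 - z.1)]) (by norm_num)
    refine ⟨?_, by linarith, by linarith⟩
    rw [abs_lt]; constructor <;> linarith
  have h := HA v (z.1, 1/2) (1/2) (c * m / 2) (by positivity) (by norm_num) (hc.mono hsub)
    (fun x hx => hpos x (hsub x hx)) (fun x hx => (hss x (hsub' x hx)).1)
    (fun x hx _ => by
      simp only at hx
      have h1 := abs_le_of_sq_le_sq' (a := x.1 - z.1) (b := 1/32) (by linarith [sq_nonneg (x.2 - 1/2)]) (by norm_num)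
      have h2 := abs_le_of_sq_le_sq' (a := x.2 - 1/2) (b := 1/32) (by linarith [sq_nonneg (x.1 - z.1)]) (by norm_num)
      apply hinner <;> rw [abs_le] <;> constructor <;> linarith) z
  have hz2 := hz.2.1
  have hz3 := hz.2.2
  have hsm : z.2 * z.2 ≤ 1/32 * z.2 := by gcongr
  have h' := h (by simp only; linarith)
  refine le_trans ?_ h'
  simp only
  have e1 : 2 * z.2 ≤ 1 - ((z.1 - z.1) ^ 2 + (z.2 - 1/2) ^ 2) / (1/2) ^ 2 := by
    have : 1 - ((z.1 - z.1) ^ 2 + (z.2 - 1/2) ^ 2) / (1/2) ^ 2 = 4 * z.2 - 4 * (z.2 * z.2) := by ring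
    rw [this]; linarith
  calc 2 * min (1/2) (θ * c / 2) * m * z.2 ≤ 2 * (θ * c / 2) * m * z.2 := by
        gcongr; exact min_le_right _ _
    _ = θ * (c * m / 2) * (2 * z.2) := by ring
    _ ≤ _ := by gcongr

lemma krylov0 {κ : ℝ} (hκ0 : 0 ≤ κ) (hκ1 : κ < 1) :
    ∃ θ > 0, θ < 1 ∧ ∀ (w : R2 → ℝ) (b m e : ℝ), 0 < m → 0 ≤ e → ContinuousOn w (Rc 1) → (∀ z ∈ Ro 1, SS κ w z) →
      (∀ z ∈ Rc 1, |w z - b * z.2| ≤ m * z.2 + e) →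
      ∃ b', |b' - b| ≤ m ∧ ∀ z ∈ Rc (1/32), |w z - b' * z.2| ≤ (1 - θ) * m * z.2 + e := by
  obtain ⟨θ, hθ, hθ1, H⟩ := krylov_pos hκ0 hκ1
  refine ⟨θ, hθ, hθ1, ?_⟩
  intro w b m e hm he hc hss hb
  have hmθ : θ * m ≤ m := mul_le_of_le_one_left hm.le hθ1.le
  have hR : ∀ z ∈ Rc (1/32), z ∈ Rc 1 := by
    rintro z ⟨h1, h2, h3⟩; exact ⟨by linarith, h2, by linarith⟩
  by_cases hE : 0 ≤ w (0, 1/2) - b * (1/2)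
  · refine ⟨b + θ * m, by rw [add_sub_cancel_left, abs_of_pos (by positivity)]; exact hmθ, ?_⟩
    have h := H (fun z => 1 * w z + e + 0 * z.1 + (m - b) * z.2) m hm (by fun_prop)
      (fun z hz => (hss z hz).smul_add 1 e 0 (m - b) (by norm_num))
      (fun z hz => by have := (abs_le.mp (hb z hz)).1; linarith)
      (by simp only; linarith)
    intro z hz
    have h1 := h z hz
    have h2 := abs_le.mp (hb z (hR z hz))
    have h3 : 0 ≤ θ * m * z.2 := by have := hz.2.1; positivity
    rw [abs_le]; constructor <;> linarith
  · push Not at hE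
    refine ⟨b - θ * m, by rw [sub_sub_cancel_left, abs_neg, abs_of_pos (by positivity)]; exact hmθ, ?_⟩
    have h := H (fun z => 1 * (-w z) + e + 0 * z.1 + (m + b) * z.2) m hm (by fun_prop)
      (fun z hz => (hss z hz).neg.smul_add 1 e 0 (m + b) (by norm_num))
      (fun z hz => by have := (abs_le.mp (hb z hz)).2; linarith)
      (by simp only; linarith)
    intro z hz
    have h1 := h z hz
    have h2 := abs_le.mp (hb z (hR z hz))
    have h3 : 0 ≤ θ * m * z.2 := by have := hz.2.1; positivity
    rw [abs_le]; constructor <;> linarith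

lemma cmap_scale_Rc {R ρ : ℝ} (hR : 0 < R) {x : R2} (hx : x ∈ Rc ρ) : cmap 0 R 0 x ∈ Rc (R * ρ) := by
  obtain ⟨h1, h2, h3⟩ := hx
  simp only [cmap, Rc, mem_ofPred_eq, Prod.fst_zero, Prod.snd_zero, zero_mul, sub_zero, zero_add]
  refine ⟨?_, by positivity, by gcongr⟩
  rw [abs_mul, abs_of_pos hR]; gcongr

lemma cmap_scale_Ro {R ρ : ℝ} (hR : 0 < R) {x : R2} (hx : x ∈ Ro ρ) : cmap 0 R 0 x ∈ Ro (R * ρ) := by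
  obtain ⟨h1, h2, h3⟩ := hx
  simp only [cmap, Ro, mem_ofPred_eq, Prod.fst_zero, Prod.snd_zero, zero_mul, sub_zero, zero_add]
  refine ⟨?_, by positivity, by gcongr⟩
  rw [abs_mul, abs_of_pos hR]; gcongr

lemma krylov {κ : ℝ} (hκ0 : 0 ≤ κ) (hκ1 : κ < 1) :
    ∃ θ > 0, θ < 1 ∧ ∀ (w : R2 → ℝ) (R b m e : ℝ), 0 < R → 0 < m → 0 ≤ e → ContinuousOn w (Rc R) →
      (∀ z ∈ Ro R, SS κ w z) →
      (∀ z ∈ Rc R, |w z - b * z.2| ≤ m * z.2 + e) →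
      ∃ b', |b' - b| ≤ m ∧ ∀ z ∈ Rc (R / 32), |w z - b' * z.2| ≤ (1 - θ) * m * z.2 + e := by
  obtain ⟨θ, hθ, hθ1, H⟩ := krylov0 hκ0 hκ1
  refine ⟨θ, hθ, hθ1, ?_⟩
  intro w R b m e hR hm he hc hss hb
  have h1 : ∀ x ∈ Rc 1, cmap 0 R 0 x ∈ Rc R := fun x hx => by simpa using cmap_scale_Rc hR hx
  have h2 : ∀ x ∈ Ro 1, cmap 0 R 0 x ∈ Ro R := fun x hx => by simpa using cmap_scale_Ro hR hx
  have hc2 : ∀ x, (cmap 0 R 0 x).2 = R * x.2 := by intro x; simp [cmap]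
  obtain ⟨b', hb', hw⟩ := H (fun x => w (cmap 0 R 0 x)) (R * b) (R * m) e (by positivity) he
    (hc.comp (cmap_cont _ _ _).continuousOn h1)
    (fun z hz => (hss _ (h2 z hz)).comp 0 R 0 (by positivity))
    (fun z hz => by
      have := hb _ (h1 z hz)
      rw [hc2] at this
      calc |w (cmap 0 R 0 z) - R * b * z.2| = |w (cmap 0 R 0 z) - b * (R * z.2)| := by ring_nf
        _ ≤ _ := this
        _ = _ := by ring)
  refine ⟨b' / R, ?_, ?_⟩
  · have : b' / R - b = (b' - R * b) / R := by field_simp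
    rw [this, abs_div, abs_of_pos hR, div_le_iff₀ hR]; linarith
  · intro z hz
    have h3 := hw (z.1 / R, z.2 / R) (by
      obtain ⟨a1, a2, a3⟩ := hz
      refine ⟨?_, by positivity, ?_⟩
      · simp only; rw [abs_div, abs_of_pos hR, div_le_iff₀ hR]; linarith
      · simp only; rw [div_le_iff₀ hR]; linarith)
    have h4 : cmap 0 R 0 (z.1 / R, z.2 / R) = z := by
      ext <;> simp only [cmap, Prod.fst_zero, Prod.snd_zero] <;> field_simp <;> ring
    rw [h4] at h3
    simp only at h3
    calc |w z - b' / R * z.2| = |w z - b' * (z.2 / R)| := by ring_nf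
      _ ≤ _ := h3
      _ = _ := by field_simp

lemma jensen_step {V : Type*} [NormedAddCommGroup V] [NormedSpace ℝ V] {f : V → ℝ} {C ε r a : ℝ}
    (hC : 0 ≤ C) (hε : 0 ≤ ε) (hr : 0 ≤ r)
    {ℓ ℓz : V →L[ℝ] ℝ} {A : V →L[ℝ] V →L[ℝ] ℝ} {x y y' z : V}
    (hy1 : f y ≤ f z + ℓz (y - z)) (hy2 : f z + ℓz (y - z) - C * ‖y - z‖ ^ 2 ≤ f y)
    (hy1' : f y' ≤ f z + ℓz (y' - z)) (hy2' : f z + ℓz (y' - z) - C * ‖y' - z‖ ^ 2 ≤ f y')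
    (hz : ‖y - z‖ ≤ ε * r) (hyy : ‖y' - y‖ ≤ ε * r)
    (hd : ‖ℓz - ℓ - A (z - x)‖ ≤ 2 * ε * r) (ha : ‖A‖ ≤ a) :
    |f y' - f y - ℓ (y' - y) - A (y - x) (y' - y)| ≤ (4 * C + 2 + a) * (ε * r) ^ 2 := by
  have hεr : 0 ≤ ε * r := by positivity
  have ha0 : 0 ≤ a := le_trans (norm_nonneg A) ha
  have h1 : ‖y' - z‖ ≤ 2 * (ε * r) := by
    calc ‖y' - z‖ = ‖(y' - y) + (y - z)‖ := by congr 1; abel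
      _ ≤ ‖y' - y‖ + ‖y - z‖ := norm_add_le _ _
      _ ≤ _ := by linarith
  have h2 : C * ‖y' - z‖ ^ 2 ≤ C * (2 * (ε * r)) ^ 2 := by gcongr
  have h3 : C * ‖y - z‖ ^ 2 ≤ C * (ε * r) ^ 2 := by gcongr
  have h4 : ℓz (y' - z) - ℓz (y - z) = ℓz (y' - y) := by rw [← map_sub]; congr 1; abel
  have h5 : |(ℓz - ℓ - A (z - x)) (y' - y)| ≤ 2 * ε * r * (ε * r) := by
    calc |(ℓz - ℓ - A (z - x)) (y' - y)| ≤ ‖ℓz - ℓ - A (z - x)‖ * ‖y' - y‖ :=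
          (ℓz - ℓ - A (z - x)).le_opNorm _
      _ ≤ _ := by gcongr
  have h6 : |A (z - y) (y' - y)| ≤ a * (ε * r) * (ε * r) := by
    calc |A (z - y) (y' - y)| ≤ ‖A‖ * ‖z - y‖ * ‖y' - y‖ := A.le_opNorm₂ _ _
      _ ≤ _ := by rw [norm_sub_rev z y]; gcongr
  have h7 : (ℓz - ℓ - A (z - x)) (y' - y) + A (z - y) (y' - y)
      = ℓz (y' - y) - ℓ (y' - y) - A (y - x) (y' - y) := by
    simp only [sub_apply, map_sub]; ring
  have h8 : 0 ≤ C * (ε * r) ^ 2 := by positivity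
  rw [abs_le] at h5 h6 ⊢
  constructor <;> linarith

lemma jensen_sum {a : ℕ → ℝ} {N : ℕ} {p q E : ℝ}
    (h : ∀ i < N, |a (i + 1) - a i - p - i * q| ≤ E) :
    ∀ k ≤ N, |a k - a 0 - k * p - (k * (k - 1) / 2) * q| ≤ k * E := by
  intro k
  induction k with
  | zero => intro _; simp
  | succ k ih =>
    intro hk
    have h1 := ih (by omega)
    have h2 := h k (by omega)
    push_cast
    rw [abs_le] at h1 h2 ⊢
    constructor <;> linarith [h1.1, h1.2, h2.1, h2.2]

lemma jensen_exp {V : Type*} [NormedAddCommGroup V] [NormedSpace ℝ V] {f : V → ℝ} {C : ℝ} (hC : 0 ≤ C)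
    {K U : Set V} {x : V} (hxU : U ∈ 𝓝 x) {g : V → (V →L[ℝ] ℝ)} {A : V →L[ℝ] V →L[ℝ] ℝ}
    (hg : HasFDerivAt g A x)
    (hK1 : ∀ z ∈ K, ∀ y ∈ U, f y ≤ f z + g z (y - z))
    (hK2 : ∀ z ∈ K, ∀ y ∈ U, f z + g z (y - z) - C * ‖y - z‖ ^ 2 ≤ f y)
    (hden : ∀ N : ℕ, 0 < N → ∀ i ≤ N, ∀ᶠ H in 𝓝[≠] (0 : V), ∃ z ∈ K, ‖(x + (i / N : ℝ) • H) - z‖ ≤ ‖H‖ / N) :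
    ∀ η > 0, ∀ᶠ H in 𝓝 (0 : V), |f (x + H) - f x - g x H - 1/2 * A H H| ≤ η * ‖H‖ ^ 2 := by
  intro η hη
  have hC2 : 0 < 4 * C + 2 + 2 * ‖A‖ := by positivity
  obtain ⟨N, hN⟩ := exists_nat_gt ((4 * C + 2 + 2 * ‖A‖) / η)
  have hN0 : (0:ℝ) < N := lt_trans (by positivity) hN
  have hN0' : 0 < N := by exact_mod_cast hN0
  have hN1 : (1:ℝ) ≤ N := by exact_mod_cast hN0'
  have hNη : (4 * C + 2 + 2 * ‖A‖) / N ≤ η := by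
    rw [div_lt_iff₀ hη] at hN
    rw [div_le_iff₀ hN0]; linarith
  suffices h : ∀ᶠ H in 𝓝[≠] (0 : V), |f (x + H) - f x - g x H - 1/2 * A H H| ≤ η * ‖H‖ ^ 2 by
    rw [eventually_nhdsWithin_iff] at h
    filter_upwards [h] with H hH
    by_cases h0 : H = 0
    · subst h0; simp
    · exact hH h0
  have e1 : ∀ᶠ H in 𝓝[≠] (0 : V), ∀ i ≤ N, ∃ z ∈ K, ‖(x + (i / N : ℝ) • H) - z‖ ≤ ‖H‖ / N := by
    have : ∀ᶠ H in 𝓝[≠] (0 : V), ∀ i ∈ Finset.range (N + 1),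
        ∃ z ∈ K, ‖(x + (i / N : ℝ) • H) - z‖ ≤ ‖H‖ / N := by
      rw [Filter.eventually_all_finset]
      intro i hi
      exact hden N hN0' i (by simpa [Nat.lt_succ_iff] using hi)
    filter_upwards [this] with H hH i hi
    exact hH i (by simpa [Nat.lt_succ_iff] using hi)
  have e2 : ∀ᶠ z in 𝓝 x, ‖g z - g x - A (z - x)‖ ≤ (1 / N : ℝ) * ‖z - x‖ := by
    have := hg.isLittleO.def (c := 1 / N) (by positivity)
    exact this
  obtain ⟨s, hs, hsp⟩ := Metric.eventually_nhds_iff.mp (e2.and hxU)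
  have e3 : ∀ᶠ H in 𝓝[≠] (0 : V), ‖H‖ < s / 2 := by
    apply eventually_nhdsWithin_of_eventually_nhds
    have : Tendsto (fun h : V => ‖h‖) (𝓝 0) (𝓝 0) := by
      simpa using (continuous_norm (E := V)).tendsto 0
    exact this.eventually (gt_mem_nhds (by positivity))
  filter_upwards [e1, e3] with H hH hs2
  have hUy : ∀ i ≤ N, x + (i / N : ℝ) • H ∈ U ∧ ‖(i / N : ℝ) • H‖ ≤ ‖H‖ := by
    intro i hi
    have h1 : ‖(i / N : ℝ) • H‖ ≤ ‖H‖ := by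
      rw [norm_smul, Real.norm_eq_abs, abs_of_nonneg (by positivity)]
      apply mul_le_of_le_one_left (norm_nonneg _)
      rw [div_le_one hN0]; exact_mod_cast hi
    refine ⟨(hsp ?_).2, h1⟩
    rw [dist_eq_norm, add_sub_cancel_left]; linarith
  have hstep : ∀ i < N, |f (x + ((i + 1 : ℕ) / N : ℝ) • H) - f (x + (i / N : ℝ) • H) - (1 / N : ℝ) * g x H
      - i * ((1 / N : ℝ) ^ 2 * A H H)| ≤ (4 * C + 2 + ‖A‖) * (1 / N * ‖H‖) ^ 2 := by
    intro i hi
    obtain ⟨z, hzK, hz⟩ := hH i hi.le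
    obtain ⟨hyU, hy⟩ := hUy i hi.le
    have hyU' := (hUy (i + 1) hi).1
    have hdiff : (x + ((i + 1 : ℕ) / N : ℝ) • H) - (x + (i / N : ℝ) • H) = (1 / N : ℝ) • H := by
      rw [add_sub_add_left_eq_sub, ← sub_smul]; congr 1; push_cast; ring
    have hzx : ‖z - x‖ ≤ 2 * ‖H‖ := by
      calc ‖z - x‖ = ‖(i / N : ℝ) • H - ((x + (i / N : ℝ) • H) - z)‖ := by congr 1; abel
        _ ≤ ‖(i / N : ℝ) • H‖ + ‖(x + (i / N : ℝ) • H) - z‖ := norm_sub_le _ _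
        _ ≤ ‖H‖ + ‖H‖ / N := by linarith
        _ ≤ ‖H‖ + ‖H‖ := by gcongr; exact div_le_self (norm_nonneg _) hN1
        _ = _ := by ring
    have h := jensen_step (x := x) (ℓ := g x) (A := A) (a := ‖A‖) (ε := 1 / N) (r := ‖H‖) hC (by positivity) (norm_nonneg _)
      (hK1 z hzK _ hyU) (hK2 z hzK _ hyU) (hK1 z hzK _ hyU') (hK2 z hzK _ hyU') (by rwa [one_div_mul_eq_div])
      (by rw [hdiff, norm_smul, Real.norm_eq_abs, abs_of_nonneg (by positivity)])
      (by
        have := (hsp (y := z) (by rw [dist_eq_norm]; linarith)).1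
        refine this.trans ?_
        calc (1 / N : ℝ) * ‖z - x‖ ≤ 1 / N * (2 * ‖H‖) := by gcongr
          _ = _ := by ring) le_rfl
    rw [hdiff, add_sub_cancel_left] at h
    simp only [map_smul, smul_apply, smul_eq_mul] at h
    convert h using 2
    ring
  have hsum := jensen_sum (a := fun i => f (x + (i / N : ℝ) • H)) hstep N le_rfl
  simp only [Nat.cast_zero, zero_div, zero_smul, add_zero, div_self hN0.ne', one_smul] at hsum
  have hA : |A H H| ≤ ‖A‖ * ‖H‖ * ‖H‖ := A.le_opNorm₂ _ _
  have hA2 : |A H H / (2 * N)| ≤ ‖A‖ * ‖H‖ ^ 2 / N := by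
    rw [abs_div, abs_of_pos (by positivity : (0:ℝ) < 2 * N)]
    calc |A H H| / (2 * N) ≤ ‖A‖ * ‖H‖ * ‖H‖ / (1 * N) := by gcongr; norm_num
      _ = _ := by ring
  have hmain : f (x + H) - f x - g x H - 1/2 * A H H =
      (f (x + H) - f x - N * (1 / N * g x H) - N * (N - 1) / 2 * ((1 / N) ^ 2 * A H H)) - A H H / (2 * N) := by
    field_simp
    ring
  rw [hmain]
  refine (abs_sub _ _).trans ?_
  calc _ ≤ N * ((4 * C + 2 + ‖A‖) * (1 / N * ‖H‖) ^ 2) + ‖A‖ * ‖H‖ ^ 2 / N := add_le_add hsum hA2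
    _ = (4 * C + 2 + 2 * ‖A‖) / N * ‖H‖ ^ 2 := by field_simp; ring
    _ ≤ _ := by gcongr

lemma jensen_meas {V : Type} [NormedAddCommGroup V] [NormedSpace ℝ V] [FiniteDimensional ℝ V]
    [MeasurableSpace V] [BorelSpace V] {K : Set V} {p : V → (V →L[ℝ] ℝ)} {Lc : NNReal}
    (hL : LipschitzOnWith Lc p K) {δ : ℝ} (hδ : 0 < δ) (him : closedBall 0 δ ⊆ p '' K) :
    ∃ x ∈ K, ∃ g : V → (V →L[ℝ] ℝ), EqOn p g K ∧ DifferentiableAt ℝ g x ∧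
      ∀ N : ℕ, 0 < N → ∀ i ≤ N, ∀ᶠ H in 𝓝[≠] (0 : V), ∃ z ∈ K, ‖(x + (i / N : ℝ) • H) - z‖ ≤ ‖H‖ / N := by
  let _ : MeasurableSpace (V →L[ℝ] ℝ) := borel _
  have : BorelSpace (V →L[ℝ] ℝ) := ⟨rfl⟩
  have hfin : Module.finrank ℝ (V →L[ℝ] ℝ) = Module.finrank ℝ V := by
    rw [← LinearEquiv.finrank_eq (LinearMap.toContinuousLinearMap (𝕜 := ℝ) (E := V) (F' := ℝ))]
    exact Subspace.dual_finrank_eq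
  obtain ⟨μ, hμ⟩ : ∃ μ : MeasureTheory.Measure V, μ = MeasureTheory.Measure.hausdorffMeasure (Module.finrank ℝ V : ℝ) := ⟨_, rfl⟩
  have : μ.IsAddHaarMeasure := hμ ▸ MeasureTheory.isAddHaarMeasure_hausdorffMeasure
  have : ProperSpace V := FiniteDimensional.proper ℝ V
  have hKpos : μ K ≠ 0 := by
    intro h0
    have h1 := hL.hausdorffMeasure_image_le (d := (Module.finrank ℝ V : ℝ)) (by positivity)
    rw [← hμ, h0, mul_zero] at h1
    have : (MeasureTheory.Measure.hausdorffMeasure (Module.finrank ℝ V : ℝ) : MeasureTheory.Measure (V →L[ℝ] ℝ)).IsAddHaarMeasure := by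
      rw [← hfin]; exact MeasureTheory.isAddHaarMeasure_hausdorffMeasure
    have h2 := Metric.measure_closedBall_pos (MeasureTheory.Measure.hausdorffMeasure (Module.finrank ℝ V : ℝ) : MeasureTheory.Measure (V →L[ℝ] ℝ)) 0 hδ
    exact absurd (h2.trans_le ((MeasureTheory.measure_mono him).trans h1)) (lt_irrefl _)
  obtain ⟨g, hgL, hgE⟩ := hL.extend_finite_dimension
  have hd : ∀ᵐ x ∂μ.restrict K, DifferentiableAt ℝ g x :=
    MeasureTheory.ae_restrict_of_ae hgL.ae_differentiableAt
  have hden : ∀ᵐ x ∂μ.restrict K, ∀ N : ℕ, 0 < N → ∀ i ≤ N, ∀ᶠ H in 𝓝[≠] (0 : V),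
      ∃ z ∈ K, ‖(x + (i / N : ℝ) • H) - z‖ ≤ ‖H‖ / N := by
    rw [MeasureTheory.ae_all_iff]
    intro N
    filter_upwards [IsUnifLocDoublingMeasure.ae_tendsto_measure_inter_div μ K (N : ℝ)] with x hx hN i hi
    have hN0 : (0:ℝ) < N := by exact_mod_cast hN
    have t1 : Tendsto (fun H : V => ‖H‖ / N) (𝓝[≠] (0 : V)) (𝓝[>] 0) := by
      apply tendsto_nhdsWithin_of_tendsto_nhds_of_eventually_within
      · have : Continuous (fun H : V => ‖H‖ / N) := by fun_prop
        have h := this.tendsto 0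
        simp only [norm_zero, zero_div] at h
        exact h.mono_left nhdsWithin_le_nhds
      · filter_upwards [self_mem_nhdsWithin] with H hH
        have : 0 < ‖H‖ := norm_pos_iff.mpr hH
        exact div_pos this hN0
    have t2 : ∀ᶠ H in 𝓝[≠] (0 : V), x ∈ closedBall (x + (i / N : ℝ) • H) (N * (‖H‖ / N)) := by
      filter_upwards with H
      rw [mem_closedBall, dist_eq_norm, sub_add_cancel_left, norm_neg, norm_smul, Real.norm_eq_abs,
        abs_of_nonneg (by positivity), mul_div_cancel₀ _ hN0.ne']
      apply mul_le_of_le_one_left (norm_nonneg _)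
      rw [div_le_one hN0]; exact_mod_cast hi
    have t3 := hx (fun H : V => x + (i / N : ℝ) • H) (fun H => ‖H‖ / N) t1 t2
    filter_upwards [t3.eventually_ne one_ne_zero] with H hH
    by_contra hcon
    push Not at hcon
    apply hH
    have : K ∩ closedBall (x + (i / N : ℝ) • H) (‖H‖ / N) = ∅ := by
      ext z
      simp only [mem_inter_iff, mem_closedBall, mem_empty_iff_false, iff_false, not_and, not_le]
      intro hz
      rw [dist_comm, dist_eq_norm]
      exact hcon z hz
    rw [this]; simp
  have hboth := hd.and hden
  by_contra hcon
  push Not at hcon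
  apply hKpos
  rw [MeasureTheory.ae_iff] at hboth
  refine le_antisymm ?_ (zero_le)
  calc μ K ≤ μ ({a | ¬(DifferentiableAt ℝ g a ∧ ∀ N : ℕ, 0 < N → ∀ i ≤ N, ∀ᶠ H in 𝓝[≠] (0 : V),
      ∃ z ∈ K, ‖(a + (i / N : ℝ) • H) - z‖ ≤ ‖H‖ / N)} ∩ K) := by
        apply MeasureTheory.measure_mono
        intro x hx
        refine ⟨?_, hx⟩
        rintro ⟨h1, h2⟩
        obtain ⟨N, hN, i, hi, h3⟩ := hcon x hx g hgE h1
        apply h3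
        filter_upwards [h2 N hN i hi] with H hH
        intro h4
        obtain ⟨z, hz, hz2⟩ := hH
        exact absurd (h4 z hz) (not_lt.mpr hz2)
    _ ≤ _ := MeasureTheory.Measure.le_restrict_apply _ _
    _ = 0 := hboth

lemma jensen {V : Type} [NormedAddCommGroup V] [NormedSpace ℝ V] [FiniteDimensional ℝ V]
    [MeasurableSpace V] [BorelSpace V] {f : V → ℝ} (hf : Continuous f) {C : ℝ} (hC : 0 ≤ C)
    (hsc : ∀ X, ∃ p : V →L[ℝ] ℝ, ∀ H, f X + p H - C * ‖H‖ ^ 2 ≤ f (X + H))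
    {X0 : V} {ρ : ℝ} (hρ : 0 < ρ) (hsph : ∀ X ∈ sphere X0 ρ, f X < f X0) :
    ∃ X ∈ ball X0 ρ, ∃ (p : V →L[ℝ] ℝ) (A : V →L[ℝ] V →L[ℝ] ℝ),
      (∀ η > 0, ∀ᶠ H in 𝓝 (0 : V), |f (X + H) - f X - p H - 1/2 * A H H| ≤ η * ‖H‖ ^ 2) ∧
      ∀ H, A H H ≤ 0 := by
  have : ProperSpace V := FiniteDimensional.proper ℝ V
  choose p hp using hsc
  obtain ⟨ε, hε, hεs⟩ : ∃ ε > 0, ∀ X ∈ sphere X0 ρ, f X ≤ f X0 - ε := by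
    rcases (sphere X0 ρ).eq_empty_or_nonempty with he | hne
    · exact ⟨1, one_pos, by simp [he]⟩
    · obtain ⟨Y, hY, hYm⟩ := (isCompact_sphere X0 ρ).exists_isMaxOn hne hf.continuousOn
      refine ⟨f X0 - f Y, by linarith [hsph Y hY], fun X hX => ?_⟩
      have : f X ≤ f Y := hYm hX
      linarith
  obtain ⟨S, hS⟩ : ∃ S : Set V, S = {X | X ∈ closedBall X0 ρ ∧ f X0 - ε / 2 ≤ f X} := ⟨_, rfl⟩
  have hScomp : IsCompact S := by
    have : S = closedBall X0 ρ ∩ {X | f X0 - ε / 2 ≤ f X} := by rw [hS]; rfl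
    rw [this]
    exact (isCompact_closedBall X0 ρ).inter_right (isClosed_le continuous_const hf)
  have hSball : S ⊆ ball X0 ρ := by
    intro X hX
    rw [hS] at hX
    rw [mem_ball]
    rcases lt_or_eq_of_le (mem_closedBall.mp hX.1) with h | h
    · exact h
    · linarith [hεs X h, hX.2]
  obtain ⟨τ, hτ, hτs⟩ := hScomp.exists_cthickening_subset_open isOpen_ball hSball
  obtain ⟨δ, hδ⟩ : ∃ δ, δ = ε / (2 * ρ) := ⟨_, rfl⟩
  have hδ0 : 0 < δ := by rw [hδ]; positivity
  have hδρ : δ * ρ = ε / 2 := by rw [hδ]; field_simp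
  -- contact points
  have key : ∀ X ∈ closedBall X0 ρ, ∀ ℓ : V →L[ℝ] ℝ, ‖ℓ‖ ≤ δ →
      (∀ Y ∈ closedBall X0 ρ, f Y - ℓ Y ≤ f X - ℓ X) → X ∈ S ∧ p X = ℓ := by
    intro X hX ℓ hℓ hmax
    have hXS : X ∈ S := by
      rw [hS]
      refine ⟨hX, ?_⟩
      have h1 := hmax X0 (mem_closedBall_self hρ.le)
      have h2 : |ℓ (X - X0)| ≤ δ * ρ := by
        calc |ℓ (X - X0)| ≤ ‖ℓ‖ * ‖X - X0‖ := ℓ.le_opNorm _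
          _ ≤ δ * ρ := by
            gcongr
            rw [← dist_eq_norm]; exact hX
      rw [map_sub] at h2
      have := (abs_le.mp h2).1
      linarith
    refine ⟨hXS, ?_⟩
    have hle : ∀ H, (p X - ℓ) H ≤ 0 := by
      intro H
      by_contra hcon
      push Not at hcon
      have hXb := hSball hXS
      have hc : Continuous (fun t : ℝ => X + t • H) := by fun_prop
      have e1 : ∀ᶠ t : ℝ in 𝓝[>] 0, X + t • H ∈ closedBall X0 ρ := by
        apply eventually_nhdsWithin_of_eventually_nhds
        have := hc.tendsto 0
        simp only [zero_smul, add_zero] at this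
        exact this.eventually (mem_of_superset (isOpen_ball.mem_nhds hXb) ball_subset_closedBall)
      have e2 : ∀ᶠ t : ℝ in 𝓝[>] 0, t * (C * ‖H‖ ^ 2) < (p X - ℓ) H := by
        apply eventually_nhdsWithin_of_eventually_nhds
        have hc2 : Continuous (fun t : ℝ => t * (C * ‖H‖ ^ 2)) := by fun_prop
        have := hc2.tendsto 0
        simp only [zero_mul] at this
        exact this.eventually (gt_mem_nhds hcon)
      obtain ⟨t, h1, h2, h3⟩ := (e1.and (e2.and self_mem_nhdsWithin)).exists
      have ht : 0 < t := h3
      have h4 := hp X (t • H)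
      have h5 := hmax _ h1
      rw [norm_smul, Real.norm_eq_abs, abs_of_pos ht, mul_pow] at h4
      simp only [map_smul, map_add, smul_eq_mul] at h4 h5
      simp only [sub_apply] at h2
      have h6 : t * (t * (C * ‖H‖ ^ 2)) < t * (p X H - ℓ H) := mul_lt_mul_of_pos_left h2 ht
      linarith
    ext H
    have h1 := hle H
    have h2 := hle (-H)
    rw [map_neg] at h2
    simp only [sub_apply] at h1 h2
    linarith
  obtain ⟨K, hK⟩ : ∃ K : Set V, K = {X | X ∈ closedBall X0 ρ ∧ ‖p X‖ ≤ δ ∧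
    ∀ Y ∈ closedBall X0 ρ, f Y ≤ f X + p X (Y - X)} := ⟨_, rfl⟩
  have hKmem : ∀ X ∈ K, X ∈ closedBall X0 ρ ∧ ‖p X‖ ≤ δ ∧
    ∀ Y ∈ closedBall X0 ρ, f Y ≤ f X + p X (Y - X) := by
    intro X hX; rw [hK] at hX; exact hX
  have hKS : K ⊆ S := by
    intro X hX
    obtain ⟨h1, h2, h3⟩ := hKmem X hX
    refine (key X h1 (p X) h2 fun Y hY => ?_).1
    have := h3 Y hY
    rw [map_sub] at this
    linarith
  have him : closedBall 0 δ ⊆ p '' K := by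
    intro ℓ hℓ
    obtain ⟨X, hX, hXm⟩ := (isCompact_closedBall X0 ρ).exists_isMaxOn ⟨X0, mem_closedBall_self hρ.le⟩
      (f := fun X => f X - ℓ X) (by fun_prop)
    have hℓ' : ‖ℓ‖ ≤ δ := by simpa using hℓ
    have h1 := key X hX ℓ hℓ' (fun Y hY => hXm hY)
    refine ⟨X, ?_, h1.2⟩
    rw [hK]
    refine ⟨hX, by rw [h1.2]; exact hℓ', fun Y hY => ?_⟩
    have : f Y - ℓ Y ≤ f X - ℓ X := hXm hY
    rw [h1.2, map_sub]; linarith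
  have hLip : LipschitzOnWith (2 * C + 2 * δ / τ).toNNReal p K := by
    apply LipschitzOnWith.of_dist_le_mul
    intro X hX Y hY
    rw [Real.coe_toNNReal _ (by positivity), dist_eq_norm, dist_eq_norm]
    obtain ⟨hX1, hX2, hX3⟩ := hKmem X hX
    obtain ⟨hY1, hY2, hY3⟩ := hKmem Y hY
    have hd0 : 0 ≤ ‖X - Y‖ := norm_nonneg _
    rcases eq_or_lt_of_le hd0 with h0 | h0
    · have : X = Y := by rwa [eq_comm, norm_sub_eq_zero_iff] at h0
      subst this; simp
    rcases le_or_gt ‖X - Y‖ τ with hd | hd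
    · have hone : ∀ H, ‖H‖ ≤ ‖X - Y‖ → (p Y - p X) H ≤ 2 * C * ‖X - Y‖ ^ 2 := by
        intro H hH
        have h1 : Y + H ∈ closedBall X0 ρ := by
          apply ball_subset_closedBall
          apply hτs
          apply mem_cthickening_of_dist_le _ Y _ _ (hKS hY)
          rw [dist_eq_norm, add_sub_cancel_left]; linarith
        have h2 := hp Y H
        have h3 := hX3 _ h1
        have h4 := hp X (Y - X)
        rw [add_sub_cancel] at h4
        rw [show Y + H - X = (Y - X) + H by abel, map_add] at h3
        have h5 : C * ‖H‖ ^ 2 ≤ C * ‖X - Y‖ ^ 2 := by gcongr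
        rw [norm_sub_rev Y X] at h4
        simp only [sub_apply]
        linarith
      have h1 := ContinuousLinearMap.opNorm_bound_of_ball_bound h0 (2 * C * ‖X - Y‖ ^ 2) (p Y - p X) (by
        intro H hH
        have hH' : ‖H‖ ≤ ‖X - Y‖ := by simpa using hH
        rw [Real.norm_eq_abs, abs_le]
        refine ⟨?_, hone H hH'⟩
        have := hone (-H) (by rwa [norm_neg])
        rw [map_neg] at this
        linarith)
      rw [norm_sub_rev]
      refine h1.trans ?_
      rw [div_le_iff₀ h0]
      have : 0 ≤ 2 * δ / τ * ‖X - Y‖ * ‖X - Y‖ := by positivity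
      linarith
    · calc ‖p X - p Y‖ ≤ ‖p X‖ + ‖p Y‖ := norm_sub_le _ _
        _ ≤ 2 * δ / τ * τ := by rw [div_mul_cancel₀ _ hτ.ne']; linarith
        _ ≤ 2 * δ / τ * ‖X - Y‖ := by gcongr
        _ ≤ _ := by
          have : 0 ≤ 2 * C * ‖X - Y‖ := by positivity
          linarith
  obtain ⟨x, hxK, g, hgE, hgd, hden⟩ := jensen_meas hLip hδ0 him
  have hxb : x ∈ ball X0 ρ := hSball (hKS hxK)
  have hU : ball X0 ρ ∈ 𝓝 x := isOpen_ball.mem_nhds hxb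
  have hexp := jensen_exp hC hU hgd.hasFDerivAt
    (fun z hz y hy => by rw [← hgE hz]; exact (hKmem z hz).2.2 y (ball_subset_closedBall hy))
    (fun z hz y hy => by
      rw [← hgE hz]
      have := hp z (y - z)
      rwa [add_sub_cancel] at this) hden
  refine ⟨x, hxb, g x, fderiv ℝ g x, hexp, fun H => ?_⟩
  by_contra hcon
  push Not at hcon
  obtain ⟨η, hη⟩ : ∃ η, η = fderiv ℝ g x H H / (4 * (‖H‖ ^ 2 + 1)) := ⟨_, rfl⟩
  have hη0 : 0 < η := by rw [hη]; positivity
  have hη1 : η * (‖H‖ ^ 2 + 1) = fderiv ℝ g x H H / 4 := by rw [hη]; field_simp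
  have hc : Continuous (fun t : ℝ => t • H) := by fun_prop
  have hc' : Tendsto (fun t : ℝ => t • H) (𝓝[>] 0) (𝓝 0) := by
    have := hc.tendsto 0
    simp only [zero_smul] at this
    exact this.mono_left nhdsWithin_le_nhds
  have hU2 : ∀ᶠ H in 𝓝 (0 : V), x + H ∈ ball X0 ρ := by
    have hc : Continuous (fun H : V => x + H) := by fun_prop
    have := hc.tendsto 0
    simp only [add_zero] at this
    exact this.eventually hU
  obtain ⟨t, ⟨h1, h2⟩, h3⟩ := ((hc'.eventually ((hexp η hη0).and hU2)).and self_mem_nhdsWithin).exists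
  have ht : 0 < t := h3
  have h4 := (hKmem x hxK).2.2 _ (ball_subset_closedBall h2)
  rw [add_sub_cancel_left, hgE hxK] at h4
  have h5 := (abs_le.mp h1).1
  rw [norm_smul, Real.norm_eq_abs, abs_of_pos ht, mul_pow] at h5
  simp only [map_smul, smul_apply, smul_eq_mul] at h4 h5
  have h6 : 0 < t ^ 2 * (fderiv ℝ g x H H / 4 + η) := by positivity
  have h7 : t ^ 2 * (η * (‖H‖ ^ 2 + 1)) = t ^ 2 * (fderiv ℝ g x H H / 4) := by rw [hη1]
  linarith

def sq2 (h : R2) : ℝ := h.1 ^ 2 + h.2 ^ 2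

lemma sq2_nonneg (h : R2) : 0 ≤ sq2 h := by unfold sq2; positivity

lemma norm_le_sq2 (h : R2) : ‖h‖ ^ 2 ≤ sq2 h := norm_sq_le_sq h

lemma sq2_le (h : R2) : sq2 h ≤ 2 * ‖h‖ ^ 2 := by
  have h1 : h.1 ^ 2 ≤ ‖h‖ ^ 2 := by
    rw [← sq_abs]; exact pow_le_pow_left₀ (abs_nonneg _) (norm_fst_le h) 2
  have h2 : h.2 ^ 2 ≤ ‖h‖ ^ 2 := by
    rw [← sq_abs]; exact pow_le_pow_left₀ (abs_nonneg _) (norm_snd_le h) 2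
  unfold sq2; linarith

lemma sq2_cont : Continuous sq2 := by unfold sq2; fun_prop

/-- sup-convolution over `S` -/
def scv (n : ℝ) (S : Set R2) (u : R2 → ℝ) (x : R2) : ℝ :=
  sSup ((fun y => u y - n * sq2 (x - y)) '' S)

lemma scv_spec {n : ℝ} {S : Set R2} (hS : IsCompact S) (hne : S.Nonempty) {u : R2 → ℝ}
    (hu : ContinuousOn u S) (x : R2) :
    (∃ y ∈ S, scv n S u x = u y - n * sq2 (x - y)) ∧ ∀ y ∈ S, u y - n * sq2 (x - y) ≤ scv n S u x := by
  have hc : ContinuousOn (fun y => u y - n * sq2 (x - y)) S := by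
    apply hu.sub
    exact Continuous.continuousOn (continuous_const.mul (sq2_cont.comp (continuous_const.sub continuous_id)))
  constructor
  · obtain ⟨y, hy, hym⟩ := hS.exists_sSup_image_eq hne hc
    exact ⟨y, hy, hym⟩
  · intro y hy
    exact le_csSup (hS.image_of_continuousOn hc).bddAbove ⟨y, hy, rfl⟩

lemma scv_cont {n : ℝ} {S : Set R2} (hS : IsCompact S) {u : R2 → ℝ}
    (hu : ContinuousOn u S) : Continuous (scv n S u) := by
  have : CompactSpace S := isCompact_iff_compactSpace.mp hS
  have h := IsCompact.continuous_sSup (K := (univ : Set S)) isCompact_univ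
    (f := fun (x : R2) (y : S) => u y - n * sq2 (x - y)) (by
      have h1 : Continuous (fun y : S => u y) := continuousOn_iff_continuous_domRestrict.mp hu
      have h2 := sq2_cont
      have h3 : Continuous (fun t : R2 × S => t.1 - (t.2 : R2)) := by fun_prop
      exact (h1.comp continuous_snd).sub (continuous_const.mul (h2.comp h3)))
  convert h using 2 with x
  unfold scv
  congr 1
  ext t
  simp

lemma scv_semi {n : ℝ} {S : Set R2} (hS : IsCompact S) (hne : S.Nonempty) {u : R2 → ℝ}
    (hu : ContinuousOn u S) (x : R2) :
    ∃ c1 c2, ∀ h : R2, scv n S u x + (c1 * h.1 + c2 * h.2) - n * sq2 h ≤ scv n S u (x + h) := by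
  obtain ⟨y, hy, hyx⟩ := (scv_spec hS hne hu x (n := n)).1
  refine ⟨-2 * n * (x.1 - y.1), -2 * n * (x.2 - y.2), fun h => ?_⟩
  refine le_trans (le_of_eq ?_) ((scv_spec hS hne hu (x + h) (n := n)).2 y hy)
  rw [hyx]
  simp only [sq2, Prod.fst_sub, Prod.snd_sub, Prod.fst_add, Prod.snd_add]
  ring

def lin4 (c1 c2 c3 c4 : ℝ) : (R2 × R2) →L[ℝ] ℝ :=
  (c1 • ContinuousLinearMap.fst ℝ ℝ ℝ + c2 • ContinuousLinearMap.snd ℝ ℝ ℝ).comp (ContinuousLinearMap.fst ℝ R2 R2) +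
  (c3 • ContinuousLinearMap.fst ℝ ℝ ℝ + c4 • ContinuousLinearMap.snd ℝ ℝ ℝ).comp (ContinuousLinearMap.snd ℝ R2 R2)

lemma lin4_apply (c1 c2 c3 c4 : ℝ) (H : R2 × R2) :
    lin4 c1 c2 c3 c4 H = c1 * H.1.1 + c2 * H.1.2 + (c3 * H.2.1 + c4 * H.2.2) := by
  simp [lin4]

lemma qd_le (p q r : ℝ) (h : R2) : qd 0 0 p q r h ≤ (|p| + 2 * |q| + |r|) / 2 * ‖h‖ ^ 2 := by
  have a1 : |h.1| ≤ ‖h‖ := norm_fst_le h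
  have a2 : |h.2| ≤ ‖h‖ := norm_snd_le h
  have h1 : p * h.1 ^ 2 ≤ |p| * ‖h‖ ^ 2 := by
    rw [← sq_abs h.1]
    exact mul_le_mul (le_abs_self p) (pow_le_pow_left₀ (abs_nonneg _) a1 2) (by positivity) (abs_nonneg p)
  have h2 : r * h.2 ^ 2 ≤ |r| * ‖h‖ ^ 2 := by
    rw [← sq_abs h.2]
    exact mul_le_mul (le_abs_self r) (pow_le_pow_left₀ (abs_nonneg _) a2 2) (by positivity) (abs_nonneg r)
  have h3 : q * (h.1 * h.2) ≤ |q| * ‖h‖ ^ 2 := by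
    calc q * (h.1 * h.2) ≤ |q * (h.1 * h.2)| := le_abs_self _
      _ = |q| * (|h.1| * |h.2|) := by rw [abs_mul, abs_mul]
      _ ≤ |q| * (‖h‖ * ‖h‖) := by gcongr
      _ = _ := by ring
  unfold qd
  linarith

lemma quad_split (A : (R2 × R2) →L[ℝ] (R2 × R2) →L[ℝ] ℝ) :
    (∃ a b c, ∀ ξ : R2, A (ξ, 0) (ξ, 0) = a * ξ.1 ^ 2 + 2 * b * ξ.1 * ξ.2 + c * ξ.2 ^ 2) ∧
    (∃ a b c, ∀ ξ : R2, A (0, ξ) (0, ξ) = a * ξ.1 ^ 2 + 2 * b * ξ.1 * ξ.2 + c * ξ.2 ^ 2) := by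
  constructor
  · refine ⟨A ((1,0),0) ((1,0),0), (A ((1,0),0) ((0,1),0) + A ((0,1),0) ((1,0),0)) / 2, A ((0,1),0) ((0,1),0), fun ξ => ?_⟩
    have : ((ξ, 0) : R2 × R2) = ξ.1 • (((1,0),0) : R2 × R2) + ξ.2 • (((0,1),0) : R2 × R2) := by
      ext <;> simp
    rw [this]
    simp only [map_add, map_smul, add_apply, smul_apply, smul_eq_mul]
    ring
  · refine ⟨A (0,(1,0)) (0,(1,0)), (A (0,(1,0)) (0,(0,1)) + A (0,(0,1)) (0,(1,0))) / 2, A (0,(0,1)) (0,(0,1)), fun ξ => ?_⟩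
    have : ((0, ξ) : R2 × R2) = ξ.1 • ((0,(1,0)) : R2 × R2) + ξ.2 • ((0,(0,1)) : R2 × R2) := by
      ext <;> simp
    rw [this]
    simp only [map_add, map_smul, add_apply, smul_apply, smul_eq_mul]
    ring

def dphi (b1 b2 p q r d1 d2 m η : ℝ) (X : R2 × R2) : ℝ :=
  qd b1 b2 p q r (X.1 - X.2) + qd d1 d2 (2 * m) 0 (2 * m) X.1 + η / 2 * (sq2 X.1 + sq2 X.2)

/-- the quadratic part -/
def dquad (p q r m η : ℝ) (X : R2 × R2) : ℝ :=
  qd 0 0 p q r (X.1 - X.2) + m * sq2 X.1 + η / 2 * (sq2 X.1 + sq2 X.2)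

lemma dphi_exp (b1 b2 p q r d1 d2 m η : ℝ) (X : R2 × R2) :
    ∃ c1 c2 c3 c4, ∀ H, dphi b1 b2 p q r d1 d2 m η (X + H) =
      dphi b1 b2 p q r d1 d2 m η X + lin4 c1 c2 c3 c4 H + dquad p q r m η H := by
  refine ⟨b1 + p * (X.1.1 - X.2.1) + q * (X.1.2 - X.2.2) + d1 + 2 * m * X.1.1 + η * X.1.1,
    b2 + q * (X.1.1 - X.2.1) + r * (X.1.2 - X.2.2) + d2 + 2 * m * X.1.2 + η * X.1.2,
    -b1 - p * (X.1.1 - X.2.1) - q * (X.1.2 - X.2.2) + η * X.2.1,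
    -b2 - q * (X.1.1 - X.2.1) - r * (X.1.2 - X.2.2) + η * X.2.2, fun H => ?_⟩
  rw [lin4_apply]
  simp only [dphi, dquad, qd, sq2, Prod.fst_add, Prod.snd_add, Prod.fst_sub, Prod.snd_sub]
  ring

lemma dquad_le (p q r m η : ℝ) (hη : 0 ≤ η) (H : R2 × R2) :
    dquad p q r m η H ≤ (2 * (|p| + 2 * |q| + |r|) + 2 * |m| + 2 * η) * ‖H‖ ^ 2 := by
  have n1 : ‖H.1‖ ≤ ‖H‖ := norm_fst_le H
  have n2 : ‖H.2‖ ≤ ‖H‖ := norm_snd_le H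
  have n3 : ‖H.1 - H.2‖ ≤ 2 * ‖H‖ := (norm_sub_le _ _).trans (by linarith)
  have n1' : ‖H.1‖ ^ 2 ≤ ‖H‖ ^ 2 := pow_le_pow_left₀ (norm_nonneg _) n1 2
  have n2' : ‖H.2‖ ^ 2 ≤ ‖H‖ ^ 2 := pow_le_pow_left₀ (norm_nonneg _) n2 2
  have n3' : ‖H.1 - H.2‖ ^ 2 ≤ (2 * ‖H‖) ^ 2 := pow_le_pow_left₀ (norm_nonneg _) n3 2
  have h1 := qd_le p q r (H.1 - H.2)
  have h1' : (|p| + 2 * |q| + |r|) / 2 * ‖H.1 - H.2‖ ^ 2 ≤ (|p| + 2 * |q| + |r|) / 2 * (2 * ‖H‖) ^ 2 := by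
    gcongr
  have h2 : sq2 H.1 ≤ 2 * ‖H‖ ^ 2 := (sq2_le _).trans (by linarith)
  have h3 : sq2 H.2 ≤ 2 * ‖H‖ ^ 2 := (sq2_le _).trans (by linarith)
  have h4 : m * sq2 H.1 ≤ |m| * (2 * ‖H‖ ^ 2) :=
    mul_le_mul (le_abs_self m) h2 (sq2_nonneg _) (abs_nonneg _)
  have h5 : η / 2 * (sq2 H.1 + sq2 H.2) ≤ η / 2 * (4 * ‖H‖ ^ 2) := by
    apply mul_le_mul_of_nonneg_left _ (by positivity); linarith
  unfold dquad
  linarith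

lemma dphi_cont (b1 b2 p q r d1 d2 m η : ℝ) : Continuous (dphi b1 b2 p q r d1 d2 m η) := by
  unfold dphi qd sq2; fun_prop

lemma norm4 (X : R2 × R2) : ‖X‖ ^ 2 ≤ sq2 X.1 + sq2 X.2 := by
  have h1 := norm_le_sq2 X.1
  have h2 := norm_le_sq2 X.2
  have h3 := sq2_nonneg X.1
  have h4 := sq2_nonneg X.2
  rw [Prod.norm_def]
  rcases max_choice ‖X.1‖ ‖X.2‖ with h | h <;> rw [h] <;> linarith

/-- choice of the convolution parameter: jensen data -/
lemma doubling_aux {u v : R2 → ℝ} {x z : R2} {ρ : ℝ} (hρ : 0 < ρ)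
    (hu : ContinuousOn u (closedBall x (2 * ρ))) (hv : ContinuousOn v (closedBall z (2 * ρ)))
    {b1 b2 p q r d1 d2 m η : ℝ} (hη : 0 < η)
    (ht : ∀ ξ ζ : R2, ‖ξ‖ ≤ 2 * ρ → ‖ζ‖ ≤ 2 * ρ → u (x + ξ) - v (z + ζ) ≤ u x - v z +
      (qd b1 b2 p q r (ξ - ζ) + qd d1 d2 (2 * m) 0 (2 * m) ξ)) :
    ∃ (U V : R2 → ℝ) (a c y w : R2) (P : (R2 × R2) →L[ℝ] ℝ) (A : (R2 × R2) →L[ℝ] (R2 × R2) →L[ℝ] ℝ),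
      y ∈ ball x (2 * ρ) ∧ w ∈ ball z (2 * ρ) ∧
      (∀ᶠ ξ in 𝓝 (0 : R2), u (y + ξ) - u y ≤ U (a + ξ) - U a) ∧
      (∀ᶠ ξ in 𝓝 (0 : R2), v w - v (w + ξ) ≤ V (c + ξ) - V c) ∧
      (∀ ε > 0, ∀ᶠ H in 𝓝 (0 : R2 × R2), |(U (a + H.1) + V (c + H.2)) - (U a + V c) - P H -
        1/2 * A H H - dquad p q r m η H| ≤ ε * ‖H‖ ^ 2) ∧ (∀ H, A H H ≤ 0) := by
  obtain ⟨φ, hφ⟩ : ∃ φ : R2 × R2 → ℝ, φ = fun X => dphi b1 b2 p q r d1 d2 m η (X - (x, z)) := ⟨_, rfl⟩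
  have hφc : Continuous φ := by
    rw [hφ]; exact (dphi_cont _ _ _ _ _ _ _ _ _).comp (continuous_id.sub continuous_const)
  have hS1 : IsCompact (closedBall x (2 * ρ)) := isCompact_closedBall _ _
  have hS2 : IsCompact (closedBall z (2 * ρ)) := isCompact_closedBall _ _
  have hx0 : x ∈ closedBall x (2 * ρ) := mem_closedBall_self (by positivity)
  have hz0 : z ∈ closedBall z (2 * ρ) := mem_closedBall_self (by positivity)
  have hv' : ContinuousOn (fun y => - v y) (closedBall z (2 * ρ)) := hv.neg
  obtain ⟨M, hM0, hMu, hMv⟩ : ∃ M : ℝ, 0 ≤ M ∧ (∀ y ∈ closedBall x (2 * ρ), |u y| ≤ M) ∧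
      ∀ y ∈ closedBall z (2 * ρ), |v y| ≤ M := by
    obtain ⟨M1, h1⟩ := hS1.exists_bound_of_continuousOn hu
    obtain ⟨M2, h2⟩ := hS2.exists_bound_of_continuousOn hv
    refine ⟨max M1 M2, ((norm_nonneg _).trans (h1 x hx0)).trans (le_max_left _ _),
      fun y hy => (h1 y hy).trans (le_max_left _ _), fun y hy => (h2 y hy).trans (le_max_right _ _)⟩
  have hSc : IsCompact (closedBall (x, z) (2 * ρ)) := isCompact_closedBall _ _
  obtain ⟨d0, hd0, hd0φ⟩ := Metric.uniformContinuousOn_iff_le.mp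
    (hSc.uniformContinuousOn_of_continuous hφc.continuousOn) (η * ρ ^ 2 / 16) (by positivity)
  obtain ⟨d, hd, hdd, hdρ⟩ : ∃ d > 0, d ≤ d0 ∧ d ≤ ρ / 2 :=
    ⟨min d0 (ρ / 2), by positivity, min_le_left _ _, min_le_right _ _⟩
  obtain ⟨n, hn⟩ : ∃ n, n = 2 * M / d ^ 2 + 1 := ⟨_, rfl⟩
  have hn0 : 0 < n := by rw [hn]; positivity
  have hnd : 2 * M ≤ n * d ^ 2 := by
    have h1 : 2 * M / d ^ 2 * d ^ 2 = 2 * M := div_mul_cancel₀ _ (by positivity)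
    have h2 : 0 ≤ d ^ 2 := sq_nonneg d
    rw [hn, add_mul, h1]; linarith
  obtain ⟨U, hU⟩ : ∃ U, U = scv n (closedBall x (2 * ρ)) u := ⟨_, rfl⟩
  obtain ⟨V, hV⟩ : ∃ V, V = scv n (closedBall z (2 * ρ)) (fun y => - v y) := ⟨_, rfl⟩
  have hUs := fun t => scv_spec hS1 ⟨x, hx0⟩ hu t (n := n)
  have hVs := fun t => scv_spec hS2 ⟨z, hz0⟩ hv' t (n := n)
  rw [← hU] at hUs
  rw [← hV] at hVs
  have hcl : ∀ (a y : R2), n * sq2 (a - y) ≤ 2 * M → ‖a - y‖ ≤ d := by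
    intro a y h
    have h1 := norm_le_sq2 (a - y)
    have h2 : n * ‖a - y‖ ^ 2 ≤ n * d ^ 2 := (mul_le_mul_of_nonneg_left h1 hn0.le).trans (h.trans hnd)
    have h3 : ‖a - y‖ ^ 2 ≤ d ^ 2 := le_of_mul_le_mul_left h2 hn0
    exact le_of_sq_le_sq h3 hd.le
  -- near maximisers
  have hUn : ∀ a ∈ closedBall x (2 * ρ), ∃ y ∈ closedBall x (2 * ρ), U a = u y - n * sq2 (a - y) ∧ ‖a - y‖ ≤ d := by
    intro a ha
    obtain ⟨y, hy, hyU⟩ := (hUs a).1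
    refine ⟨y, hy, hyU, hcl a y ?_⟩
    have h1 := (hUs a).2 a ha
    have h2 := abs_le.mp (hMu a ha)
    have h3 := abs_le.mp (hMu y hy)
    rw [sub_self] at h1
    have : sq2 (0 : R2) = 0 := by simp [sq2]
    rw [this, hyU] at h1
    linarith [h2.1, h3.2]
  have hVn : ∀ a ∈ closedBall z (2 * ρ), ∃ y ∈ closedBall z (2 * ρ), V a = - v y - n * sq2 (a - y) ∧ ‖a - y‖ ≤ d := by
    intro a ha
    obtain ⟨y, hy, hyU⟩ := (hVs a).1
    refine ⟨y, hy, hyU, hcl a y ?_⟩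
    have h1 := (hVs a).2 a ha
    have h2 := abs_le.mp (hMv a ha)
    have h3 := abs_le.mp (hMv y hy)
    rw [sub_self] at h1
    have : sq2 (0 : R2) = 0 := by simp [sq2]
    rw [this, hyU] at h1
    linarith [h2.2, h3.1]
  have hfc : Continuous (fun X : R2 × R2 => U X.1 + V X.2 - φ X) := by
    have h1 : Continuous U := hU ▸ scv_cont hS1 hu
    have h2 : Continuous V := hV ▸ scv_cont hS2 hv'
    exact ((h1.comp continuous_fst).add (h2.comp continuous_snd)).sub hφc
  have hφe : ∀ X : R2 × R2, ∃ c1 c2 c3 c4, ∀ H, φ (X + H) = φ X + lin4 c1 c2 c3 c4 H + dquad p q r m η H := by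
    intro X
    obtain ⟨c1, c2, c3, c4, h⟩ := dphi_exp b1 b2 p q r d1 d2 m η (X - (x, z))
    refine ⟨c1, c2, c3, c4, fun H => ?_⟩
    have := h H
    rw [hφ]
    simp only
    rw [← this]; congr 1; abel
  obtain ⟨C, hC⟩ : ∃ C, C = 4 * n + (2 * (|p| + 2 * |q| + |r|) + 2 * |m| + 2 * η) := ⟨_, rfl⟩
  have hC0 : 0 ≤ C := by rw [hC]; positivity
  have hsc : ∀ X : R2 × R2, ∃ pp : (R2 × R2) →L[ℝ] ℝ, ∀ H, (U X.1 + V X.2 - φ X) + pp H - C * ‖H‖ ^ 2 ≤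
      U (X + H).1 + V (X + H).2 - φ (X + H) := by
    intro X
    obtain ⟨c1, c2, c3, c4, h⟩ := hφe X
    obtain ⟨e1, e2, he⟩ := scv_semi hS1 ⟨x, hx0⟩ hu X.1 (n := n)
    obtain ⟨f1, f2, hf⟩ := scv_semi hS2 ⟨z, hz0⟩ hv' X.2 (n := n)
    rw [← hU] at he
    rw [← hV] at hf
    refine ⟨lin4 (e1 - c1) (e2 - c2) (f1 - c3) (f2 - c4), fun H => ?_⟩
    have k1 := he H.1
    have k2 := hf H.2
    have k3 := h H
    have k4 := dquad_le p q r m η hη.le H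
    have k5 : n * sq2 H.1 ≤ n * (2 * ‖H‖ ^ 2) := by
      gcongr
      refine (sq2_le _).trans ?_
      gcongr
      exact norm_fst_le H
    have k6 : n * sq2 H.2 ≤ n * (2 * ‖H‖ ^ 2) := by
      gcongr
      refine (sq2_le _).trans ?_
      gcongr
      exact norm_snd_le H
    rw [k3, lin4_apply, lin4_apply, hC]
    simp only [Prod.fst_add, Prod.snd_add]
    linarith
  have hsph : ∀ X ∈ sphere ((x, z) : R2 × R2) ρ, U X.1 + V X.2 - φ X < U (x, z).1 + V (x, z).2 - φ (x, z) := by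
    intro X hX
    have hXS : X ∈ closedBall ((x, z) : R2 × R2) (2 * ρ) := by
      rw [mem_closedBall]; rw [mem_sphere] at hX; linarith
    have hX1 : X.1 ∈ closedBall x (2 * ρ) := (closedBall_prod_same x z (2 * ρ) ▸ hXS : X ∈ closedBall x (2 * ρ) ×ˢ closedBall z (2 * ρ)).1
    have hX2 : X.2 ∈ closedBall z (2 * ρ) := (closedBall_prod_same x z (2 * ρ) ▸ hXS : X ∈ closedBall x (2 * ρ) ×ˢ closedBall z (2 * ρ)).2
    obtain ⟨y, hy, hyU, hyd⟩ := hUn _ hX1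
    obtain ⟨w, hw, hwV, hwd⟩ := hVn _ hX2
    have hYS : (y, w) ∈ closedBall ((x, z) : R2 × R2) (2 * ρ) := by
      rw [← closedBall_prod_same]; exact ⟨hy, hw⟩
    have hXY : dist X (y, w) ≤ d := by
      rw [dist_eq_norm, Prod.norm_def]
      exact max_le hyd hwd
    have h1 := hd0φ X hXS (y, w) hYS (hXY.trans hdd)
    rw [Real.dist_eq] at h1
    have h2 := (abs_le.mp h1).1
    have h3 := ht (y - x) (w - z) (by rw [← dist_eq_norm]; exact hy) (by rw [← dist_eq_norm]; exact hw)
    rw [add_sub_cancel, add_sub_cancel] at h3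
    have h4 : φ (y, w) = (qd b1 b2 p q r ((y - x) - (w - z)) + qd d1 d2 (2 * m) 0 (2 * m) (y - x)) +
        η / 2 * (sq2 (y - x) + sq2 (w - z)) := by rw [hφ]; rfl
    have h5 : φ (x, z) = 0 := by
      rw [hφ]; simp [dphi, qd, sq2]
    have h6 : ρ / 2 ≤ ‖(y, w) - ((x, z) : R2 × R2)‖ := by
      rw [← dist_eq_norm]
      have := dist_triangle X (y, w) ((x, z) : R2 × R2)
      rw [mem_sphere] at hX
      linarith
    have h7 : (ρ / 2) ^ 2 ≤ sq2 (y - x) + sq2 (w - z) :=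
      (pow_le_pow_left₀ (by positivity) h6 2).trans (norm4 ((y, w) - (x, z)))
    have h8 : η / 2 * (ρ / 2) ^ 2 ≤ η / 2 * (sq2 (y - x) + sq2 (w - z)) := by gcongr
    have h9 := (hUs x).2 x hx0
    have h10 := (hVs z).2 z hz0
    have hs0 : sq2 (0 : R2) = 0 := by simp [sq2]
    rw [sub_self, hs0] at h9 h10
    have h11 : 0 ≤ n * sq2 (X.1 - y) := mul_nonneg hn0.le (sq2_nonneg _)
    have h12 : 0 ≤ n * sq2 (X.2 - w) := mul_nonneg hn0.le (sq2_nonneg _)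
    have h13 : 0 < η * ρ ^ 2 := by positivity
    rw [hyU, hwV, h5]
    linarith
  obtain ⟨X, hXb, P, A, hexp, hA⟩ := jensen hfc hC0 hsc hρ hsph
  obtain ⟨c1, c2, c3, c4, hφX⟩ := hφe X
  have hXb' : X.1 ∈ ball x ρ ∧ X.2 ∈ ball z ρ := (ball_prod_same x z ρ ▸ hXb : X ∈ ball x ρ ×ˢ ball z ρ)
  obtain ⟨hXb1, hXb2⟩ := hXb'
  rw [mem_ball] at hXb1 hXb2
  obtain ⟨y, hy, hyU, hyd⟩ := hUn X.1 (by rw [mem_closedBall]; linarith)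
  obtain ⟨w, hw, hwV, hwd⟩ := hVn X.2 (by rw [mem_closedBall]; linarith)
  have hyb : y ∈ ball x (2 * ρ) := by
    rw [mem_ball]
    have := dist_triangle_left y x X.1
    rw [dist_eq_norm X.1 y] at this
    linarith
  have hwb : w ∈ ball z (2 * ρ) := by
    rw [mem_ball]
    have := dist_triangle_left w z X.2
    rw [dist_eq_norm X.2 w] at this
    linarith
  have hnear : ∀ (a b : R2), a ∈ ball b (2 * ρ) → ∀ᶠ ξ in 𝓝 (0 : R2), a + ξ ∈ closedBall b (2 * ρ) := by
    intro a b hab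
    have hc : Continuous (fun ξ : R2 => a + ξ) := by fun_prop
    have := hc.tendsto 0
    simp only [add_zero] at this
    exact this.eventually (mem_of_superset (isOpen_ball.mem_nhds hab) ball_subset_closedBall)
  refine ⟨U, V, X.1, X.2, y, w, P + lin4 c1 c2 c3 c4, A, hyb, hwb, ?_, ?_, ?_, hA⟩
  · filter_upwards [hnear y x hyb] with ξ hξ
    have h1 := (hUs (X.1 + ξ)).2 (y + ξ) hξ
    rw [add_sub_add_right_eq_sub] at h1
    linarith
  · filter_upwards [hnear w z hwb] with ξ hξ
    have h1 := (hVs (X.2 + ξ)).2 (w + ξ) hξ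
    rw [add_sub_add_right_eq_sub] at h1
    linarith
  · intro ε hε
    filter_upwards [hexp ε hε] with H hH
    rw [hφX H] at hH
    simp only [Prod.fst_add, Prod.snd_add] at hH
    rw [add_apply]
    convert hH using 2
    ring

lemma doubling {G G' : ℝ → ℝ → ℝ → ℝ} {u v : R2 → ℝ} {x z : R2} {ρ : ℝ} (hρ : 0 < ρ)
    (hu : ContinuousOn u (closedBall x (2 * ρ))) (hv : ContinuousOn v (closedBall z (2 * ρ)))
    (hsub : ∀ y ∈ ball x (2 * ρ), SubAt G u y) (hsup : ∀ y ∈ ball z (2 * ρ), SupAt G' v y)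
    {b1 b2 p q r d1 d2 m : ℝ}
    (ht : ∀ ξ ζ : R2, ‖ξ‖ ≤ 2 * ρ → ‖ζ‖ ≤ 2 * ρ → u (x + ξ) - v (z + ζ) ≤ u x - v z +
      (qd b1 b2 p q r (ξ - ζ) + qd d1 d2 (2 * m) 0 (2 * m) ξ)) {η : ℝ} (hη : 0 < η) :
    ∃ p1 q1 r1 p2 q2 r2, 0 ≤ G p1 q1 r1 ∧ G' p2 q2 r2 ≤ 0 ∧
      ∀ ξ ζ, qd 0 0 p1 q1 r1 ξ - qd 0 0 p2 q2 r2 ζ ≤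
        qd 0 0 p q r (ξ - ζ) + m * sq2 ξ + η * (sq2 ξ + sq2 ζ) := by
  obtain ⟨U, V, a, c, y, w, P, A, hy, hw, hU, hV, hexp, hA⟩ := doubling_aux hρ hu hv hη ht
  obtain ⟨⟨a1, a2, a3, ha⟩, ⟨e1, e2, e3, he⟩⟩ := quad_split A
  obtain ⟨l1, l2, hl⟩ : ∃ l1 l2, ∀ ξ : R2, P (ξ, 0) = l1 * ξ.1 + l2 * ξ.2 := by
    refine ⟨P ((1,0),0), P ((0,1),0), fun ξ => ?_⟩
    have : ((ξ, 0) : R2 × R2) = ξ.1 • (((1,0),0) : R2 × R2) + ξ.2 • (((0,1),0) : R2 × R2) := by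
      ext <;> simp
    rw [this]; simp only [map_add, map_smul, smul_eq_mul]; ring
  obtain ⟨k1, k2, hk⟩ : ∃ l1 l2, ∀ ξ : R2, P (0, ξ) = l1 * ξ.1 + l2 * ξ.2 := by
    refine ⟨P (0,(1,0)), P (0,(0,1)), fun ξ => ?_⟩
    have : ((0, ξ) : R2 × R2) = ξ.1 • ((0,(1,0)) : R2 × R2) + ξ.2 • ((0,(0,1)) : R2 × R2) := by
      ext <;> simp
    rw [this]; simp only [map_add, map_smul, smul_eq_mul]; ring
  have i1 : Tendsto (fun ξ : R2 => ((ξ, 0) : R2 × R2)) (𝓝 0) (𝓝 0) := by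
    have : Continuous (fun ξ : R2 => ((ξ, 0) : R2 × R2)) := by fun_prop
    exact this.tendsto 0
  have i2 : Tendsto (fun ξ : R2 => ((0, ξ) : R2 × R2)) (𝓝 0) (𝓝 0) := by
    have : Continuous (fun ξ : R2 => ((0, ξ) : R2 × R2)) := by fun_prop
    exact this.tendsto 0
  have hη2 : 0 < η / 2 := by positivity
  refine ⟨a1 + p + 2 * m + 2 * η, a2 + q, a3 + r + 2 * m + 2 * η, -(e1 + p + 2 * η), -(e2 + q), -(e3 + r + 2 * η),
    ?_, ?_, ?_⟩
  · apply hsub y hy l1 l2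
    filter_upwards [hU, i1.eventually (hexp (η / 2) hη2)] with ξ h1 h2
    have h3 := (abs_le.mp h2).2
    have h4 : ‖((ξ, 0) : R2 × R2)‖ ^ 2 ≤ sq2 ξ := by
      have := norm4 (ξ, 0)
      have hs0 : sq2 (0 : R2) = 0 := by simp [sq2]
      simp only [hs0, add_zero] at this
      exact this
    have h5 : η / 2 * ‖((ξ, 0) : R2 × R2)‖ ^ 2 ≤ η / 2 * sq2 ξ := by gcongr
    rw [ha, hl] at h3
    simp only [add_zero] at h3
    simp only [dquad, qd, sq2, sub_zero, Prod.fst_zero, Prod.snd_zero] at *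
    linarith
  · apply hsup w hw (-k1) (-k2)
    filter_upwards [hV, i2.eventually (hexp (η / 2) hη2)] with ξ h1 h2
    have h3 := (abs_le.mp h2).2
    have h4 : ‖((0, ξ) : R2 × R2)‖ ^ 2 ≤ sq2 ξ := by
      have := norm4 (0, ξ)
      have hs0 : sq2 (0 : R2) = 0 := by simp [sq2]
      simp only [hs0, zero_add] at this
      exact this
    have h5 : η / 2 * ‖((0, ξ) : R2 × R2)‖ ^ 2 ≤ η / 2 * sq2 ξ := by gcongr
    rw [he, hk] at h3
    simp only [add_zero] at h3
    simp only [dquad, qd, sq2, zero_sub, Prod.fst_zero, Prod.snd_zero, Prod.fst_neg, Prod.snd_neg] at *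
    linarith
  · intro ξ ζ
    have hD : 1/2 * A (ξ, ζ) (ξ, ζ) - 1/2 * A (ξ, 0) (ξ, 0) - 1/2 * A (0, ζ) (0, ζ) =
        p * ξ.1 * ζ.1 + q * (ξ.1 * ζ.2 + ξ.2 * ζ.1) + r * ξ.2 * ζ.2 := by
      apply eq_of_abs_sub_le_all
      intro ε hε
      obtain ⟨ε', hε'⟩ : ∃ e, e = ε / (3 * (‖((ξ, ζ) : R2 × R2)‖ ^ 2 + 1)) := ⟨_, rfl⟩
      have hε0 : 0 < ε' := by rw [hε']; positivity
      have hε1 : 3 * (ε' * ‖((ξ, ζ) : R2 × R2)‖ ^ 2) ≤ ε := by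
        have : 3 * (ε' * (‖((ξ, ζ) : R2 × R2)‖ ^ 2 + 1)) = ε := by rw [hε']; field_simp
        linarith
      have hct : ∀ H : R2 × R2, Tendsto (fun t : ℝ => t • H) (𝓝[>] 0) (𝓝 0) := by
        intro H
        have hc : Continuous (fun t : ℝ => t • H) := by fun_prop
        have := hc.tendsto 0
        simp only [zero_smul] at this
        exact this.mono_left nhdsWithin_le_nhds
      obtain ⟨t, ⟨h1, h2, h3⟩, h4⟩ := (((hct (ξ, ζ)).eventually (hexp ε' hε0)).and
        (((hct (ξ, 0)).eventually (hexp ε' hε0)).and ((hct (0, ζ)).eventually (hexp ε' hε0))) |>.and self_mem_nhdsWithin).exists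
      have ht0 : 0 < t := h4
      have n1 : ‖t • ((ξ, ζ) : R2 × R2)‖ ^ 2 = t ^ 2 * ‖((ξ, ζ) : R2 × R2)‖ ^ 2 := by
        rw [norm_smul, Real.norm_eq_abs, abs_of_pos ht0, mul_pow]
      have n2 : ‖t • ((ξ, 0) : R2 × R2)‖ ^ 2 ≤ t ^ 2 * ‖((ξ, ζ) : R2 × R2)‖ ^ 2 := by
        rw [norm_smul, Real.norm_eq_abs, abs_of_pos ht0, mul_pow]
        gcongr
        simp [Prod.norm_def]
      have n3 : ‖t • ((0, ζ) : R2 × R2)‖ ^ 2 ≤ t ^ 2 * ‖((ξ, ζ) : R2 × R2)‖ ^ 2 := by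
        rw [norm_smul, Real.norm_eq_abs, abs_of_pos ht0, mul_pow]
        gcongr
        simp [Prod.norm_def]
      rw [n1] at h1
      replace h2 := h2.trans (mul_le_mul_of_nonneg_left n2 hε0.le)
      replace h3 := h3.trans (mul_le_mul_of_nonneg_left n3 hε0.le)
      have hPs : P (ξ, ζ) = P (ξ, 0) + P (0, ζ) := by rw [← map_add]; simp
      simp only [map_smul, smul_apply, smul_eq_mul, Prod.smul_fst, Prod.smul_snd, smul_zero, add_zero, hPs] at h1 h2 h3
      have hq : dquad p q r m η (t • (ξ, ζ)) - dquad p q r m η (t • (ξ, 0)) - dquad p q r m η (t • (0, ζ)) =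
          - (t ^ 2 * (p * ξ.1 * ζ.1 + q * (ξ.1 * ζ.2 + ξ.2 * ζ.1) + r * ξ.2 * ζ.2)) := by
        simp only [dquad, qd, sq2, Prod.smul_fst, Prod.smul_snd, Prod.fst_sub, Prod.snd_sub, smul_eq_mul, Prod.fst_zero, Prod.snd_zero]
        ring
      have ht2 : 0 < t ^ 2 := by positivity
      rw [← mul_le_mul_iff_of_pos_left ht2]
      have hR : t ^ 2 * (3 * (ε' * ‖((ξ, ζ) : R2 × R2)‖ ^ 2)) ≤ t ^ 2 * ε := by gcongr
      refine le_trans ?_ hR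
      rw [← abs_of_pos ht2, ← abs_mul, abs_of_pos ht2]
      rw [abs_le] at h1 h2 h3 ⊢
      constructor <;> linarith [h1.1, h1.2, h2.1, h2.2, h3.1, h3.2]
    have h1 := hA (ξ, ζ)
    rw [ha, he] at hD
    simp only [qd, sq2, Prod.fst_sub, Prod.snd_sub]
    linarith

lemma form_nonneg {p q r : ℝ} (h : ∀ ξ : R2, 0 ≤ qd 0 0 p q r ξ) : 0 ≤ p ∧ 0 ≤ r ∧ q ^ 2 ≤ p * r := by
  have h1 := h (1, 0)
  have h2 := h (0, 1)
  have h3 := h (r, -q)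
  have h4 := h (-q, p)
  have h5 := h (1, -q)
  simp only [qd] at h1 h2 h3 h4 h5
  have hp : 0 ≤ p := by linarith
  have hr : 0 ≤ r := by linarith
  refine ⟨hp, hr, ?_⟩
  have h3' : 0 ≤ r * (p * r - q ^ 2) := by linarith
  have h4' : 0 ≤ p * (p * r - q ^ 2) := by linarith
  by_contra hcon
  push Not at hcon
  have h6 : p * r - q ^ 2 < 0 := by linarith
  have hr0 : r = 0 := le_antisymm (by by_contra hh; push Not at hh; linarith [mul_neg_of_pos_of_neg hh h6]) hr
  have hp0 : p = 0 := le_antisymm (by by_contra hh; push Not at hh; linarith [mul_neg_of_pos_of_neg hh h6]) hp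
  rw [hr0, hp0] at h5 hcon
  linarith

lemma form_tr {p q r c : ℝ} (h : ∀ ξ : R2, qd 0 0 p q r ξ ≤ c * sq2 ξ) :
    dev p q r ≤ 4 * c - (p + r) := by
  obtain ⟨h1, h2, h3⟩ := form_nonneg (p := -p + 2 * c) (q := -q) (r := -r + 2 * c) (fun ξ => by
    have := h ξ
    simp only [qd, sq2] at this ⊢
    linarith)
  have h4 := dev_psd _ _ _ (by linarith) h3
  rw [dev_shift, dev_neg] at h4
  linarith

lemma diff_supS {κ : ℝ} (hκ0 : 0 ≤ κ) (hκ1 : κ < 1) {G : ℝ → ℝ → ℝ → ℝ} (hG : Op κ G) {u v : R2 → ℝ} {z : R2} {s : ℝ}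
    (hs : 0 < s) (hu : ContinuousOn u (closedBall z s)) (hv : ContinuousOn v (closedBall z s))
    (hsub : ∀ y ∈ ball z s, SubAt G u y) (hsup : ∀ y ∈ ball z s, SupAt G v y) :
    SupS κ (fun x => v x - u x) z := by
  intro b1 b2 p q r ht
  by_contra hcon
  push Not at hcon
  obtain ⟨θ, hθ⟩ : ∃ θ, θ = (p + r - κ * dev p q r) / 16 := ⟨_, rfl⟩
  have hθ0 : 0 < θ := by rw [hθ]; apply div_pos _ (by norm_num); linarith
  obtain ⟨s', hs', ht'⟩ := Metric.eventually_nhds_iff.mp ht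
  obtain ⟨R, hR, hRs, hRs'⟩ : ∃ R > 0, R ≤ s ∧ R < s' :=
    ⟨min s (s' / 2), by positivity, min_le_left _ _, (min_le_right _ _).trans_lt (by linarith)⟩
  -- the strictified quadratic
  obtain ⟨Q, hQ⟩ : ∃ Q : R2 → ℝ, Q = fun x => qd b1 b2 (p - 2 * θ) q (r - 2 * θ) (x - z) := ⟨_, rfl⟩
  have hQc : Continuous Q := by rw [hQ]; unfold qd; fun_prop
  have hQz : Q z = 0 := by rw [hQ]; simp [qd]
  have hsB : closedBall z R ⊆ closedBall z s := closedBall_subset_closedBall hRs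
  have huR := hu.mono hsB
  have hvR := hv.mono hsB
  have hstr : ∀ x ∈ closedBall z R, u x - v x + Q x ≤ u z - v z - θ * sq2 (x - z) := by
    intro x hx
    have hx' : dist (x - z) 0 < s' := by
      rw [dist_zero_right, ← dist_eq_norm]; exact lt_of_le_of_lt hx hRs'
    have h1 := ht' hx'
    simp only [add_sub_cancel] at h1
    rw [hQ]
    simp only [qd, sq2] at h1 ⊢
    linarith
  have hK := isCompact_closedBall z R
  have hz0 : z ∈ closedBall z R := mem_closedBall_self hR.le
  obtain ⟨M, hM⟩ := hK.exists_bound_of_continuousOn (f := fun a => u a + Q a - (u z - v z))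
    ((huR.add hQc.continuousOn).sub continuousOn_const)
  obtain ⟨M2, hM2⟩ := hK.exists_bound_of_continuousOn hvR
  have hM0 : 0 ≤ M := (norm_nonneg _).trans (hM z hz0)
  have hM20 : 0 ≤ M2 := (norm_nonneg _).trans (hM2 z hz0)
  obtain ⟨d0, hd0, hd0v⟩ := Metric.uniformContinuousOn_iff_le.mp
    (hK.uniformContinuousOn_of_continuous hvR) (θ * R ^ 2 / 16) (by positivity)
  obtain ⟨d, hd, hdd, hdR⟩ : ∃ d > 0, d ≤ d0 ∧ d ≤ R / 4 :=
    ⟨min d0 (R / 4), by positivity, min_le_left _ _, min_le_right _ _⟩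
  obtain ⟨n, hn⟩ : ∃ n, n = (M + M2) / d ^ 2 + 1 := ⟨_, rfl⟩
  have hn0 : 0 < n := by rw [hn]; positivity
  have hnd : M + M2 ≤ n * d ^ 2 := by
    have h1 : (M + M2) / d ^ 2 * d ^ 2 = M + M2 := div_mul_cancel₀ _ (by positivity)
    have h2 : 0 ≤ d ^ 2 := sq_nonneg d
    rw [hn, add_mul, h1]; linarith
  -- maximise
  obtain ⟨⟨x, y⟩, hxy, hmax⟩ := (hK.prod hK).exists_isMaxOn ⟨(z, z), hz0, hz0⟩
    (f := fun X : R2 × R2 => u X.1 + Q X.1 - v X.2 - n * sq2 (X.1 - X.2)) (by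
      have h1 : ContinuousOn (fun X : R2 × R2 => u X.1) (closedBall z R ×ˢ closedBall z R) :=
        huR.comp continuousOn_fst (fun X hX => hX.1)
      have h2 : ContinuousOn (fun X : R2 × R2 => v X.2) (closedBall z R ×ˢ closedBall z R) :=
        hvR.comp continuousOn_snd (fun X hX => hX.2)
      have h3 : Continuous (fun X : R2 × R2 => Q X.1) := hQc.comp continuous_fst
      have h4 : Continuous (fun X : R2 × R2 => n * sq2 (X.1 - X.2)) :=
        continuous_const.mul (sq2_cont.comp (continuous_fst.sub continuous_snd))
      exact ((h1.add h3.continuousOn).sub h2).sub h4.continuousOn)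
  obtain ⟨hx, hy⟩ : x ∈ closedBall z R ∧ y ∈ closedBall z R := hxy
  have hmax' : ∀ a ∈ closedBall z R, ∀ b ∈ closedBall z R,
      u a + Q a - v b - n * sq2 (a - b) ≤ u x + Q x - v y - n * sq2 (x - y) :=
    fun a ha b hb => hmax (show (a, b) ∈ closedBall z R ×ˢ closedBall z R from ⟨ha, hb⟩)
  have hs0 : sq2 (0 : R2) = 0 := by simp [sq2]
  have hzz := hmax' z hz0 z hz0
  rw [sub_self, hs0, hQz] at hzz
  have hxyd : ‖x - y‖ ≤ d := by
    have h1 := norm_le_sq2 (x - y)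
    have k1 := (abs_le.mp (hM x hx)).2
    have k2 := (abs_le.mp (hM2 y hy)).1
    have h2 : n * ‖x - y‖ ^ 2 ≤ n * d ^ 2 := (mul_le_mul_of_nonneg_left h1 hn0.le).trans (by linarith)
    exact le_of_sq_le_sq (le_of_mul_le_mul_left h2 hn0) hd.le
  have hvv := hd0v x hx y hy (by rw [dist_eq_norm]; exact hxyd.trans hdd)
  rw [Real.dist_eq] at hvv
  have hxz : ‖x - z‖ ≤ R / 4 := by
    have h1 := hstr x hx
    have h2 := (abs_le.mp hvv).2
    have h3 := norm_le_sq2 (x - z)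
    have h4 : 0 ≤ n * sq2 (x - y) := mul_nonneg hn0.le (sq2_nonneg _)
    have h5 : θ * ‖x - z‖ ^ 2 ≤ θ * (R / 4) ^ 2 :=
      (mul_le_mul_of_nonneg_left h3 hθ0.le).trans (by linarith)
    exact le_of_sq_le_sq (le_of_mul_le_mul_left h5 hθ0) (by positivity)
  have hyz : ‖y - z‖ ≤ R / 2 := by
    calc ‖y - z‖ = ‖(x - z) - (x - y)‖ := by congr 1; abel
      _ ≤ ‖x - z‖ + ‖x - y‖ := norm_sub_le _ _
      _ ≤ _ := by linarith
  have hin : ∀ a : R2, ‖a - z‖ ≤ R / 2 → closedBall a (2 * (R / 8)) ⊆ closedBall z R ∧ closedBall a (2 * (R / 8)) ⊆ ball z s := by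
    intro a ha
    rw [← dist_eq_norm] at ha
    constructor
    · exact closedBall_subset_closedBall' (by linarith)
    · exact (closedBall_subset_ball' (ε₂ := R) (by linarith)).trans (ball_subset_ball hRs)
  obtain ⟨hx1, hx2⟩ := hin x (by linarith)
  obtain ⟨hy1, hy2⟩ := hin y hyz
  -- the shifted operator
  obtain ⟨p1, q1, r1, p2, q2, r2, hG1, hG2, hform⟩ := doubling (ρ := R / 8) (x := x) (z := y)
    (G := fun P' Q' R' => G (P' - (p - 2 * θ)) (Q' - q) (R' - (r - 2 * θ))) (G' := G)
    (u := fun a => u a + Q a) (v := v) (by positivity)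
    ((huR.add hQc.continuousOn).mono hx1) (hvR.mono hy1)
    (by
      intro a ha e1 e2 P' Q' R' hh
      apply hsub a (hx2 (ball_subset_closedBall ha)) (e1 - (b1 + (p - 2 * θ) * (a.1 - z.1) + q * (a.2 - z.2)))
        (e2 - (b2 + q * (a.1 - z.1) + (r - 2 * θ) * (a.2 - z.2)))
      filter_upwards [hh] with h hh
      rw [hQ] at hh
      simp only [qd, Prod.fst_sub, Prod.snd_sub, Prod.fst_add, Prod.snd_add] at hh ⊢
      linarith)
    (fun a ha => hsup a (hy2 (ball_subset_closedBall ha)))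
    (b1 := 2 * n * (x.1 - y.1)) (b2 := 2 * n * (x.2 - y.2)) (p := 2 * n) (q := 0) (r := 2 * n) (d1 := 0) (d2 := 0) (m := 0)
    (by
      intro ξ ζ hξ hζ
      have := hmax' (x + ξ) (hx1 (by simpa using hξ)) (y + ζ) (hy1 (by simpa using hζ))
      simp only [qd, sq2, Prod.fst_sub, Prod.snd_sub, Prod.fst_add, Prod.snd_add] at this ⊢
      linarith) hθ0
  have hft := form_tr (p := p1 - p2) (q := q1 - q2) (r := r1 - r2) (c := 2 * θ) (by
    intro ξ
    have := hform ξ ξ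
    simp only [qd, sq2, Prod.fst_sub, Prod.snd_sub] at this ⊢
    linarith)
  have hell := hG.ell _ _ _ _ _ _ (hG2.trans hG1)
  have htri := dev_tri (p1 - p2) (q1 - q2) (r1 - r2) (-p + 2 * θ) (-q) (-r + 2 * θ)
  rw [dev_shift, dev_neg] at htri
  have e1 : p1 - (p - 2 * θ) - p2 = (p1 - p2) + (-p + 2 * θ) := by ring
  have e2 : q1 - q - q2 = (q1 - q2) + -q := by ring
  have e3 : r1 - (r - 2 * θ) - r2 = (r1 - r2) + (-r + 2 * θ) := by ring
  rw [e1, e2, e3] at hell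
  have h1 := mul_le_mul_of_nonneg_left htri hκ0
  have h2 : κ * dev (p1 - p2) (q1 - q2) (r1 - r2) ≤ 1 * dev (p1 - p2) (q1 - q2) (r1 - r2) :=
    mul_le_mul_of_nonneg_right hκ1.le (dev_nonneg _ _ _)
  linarith

def eu (s : R2) : ℝ := √(sq2 s)

lemma eu_nonneg (s : R2) : 0 ≤ eu s := Real.sqrt_nonneg _
lemma eu_sq (s : R2) : eu s ^ 2 = sq2 s := Real.sq_sqrt (sq2_nonneg s)
lemma eu_cont : Continuous eu := Real.continuous_sqrt.comp sq2_cont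

lemma abs_fst_le_eu (s : R2) : |s.1| ≤ eu s := by
  apply Real.abs_le_sqrt; unfold sq2; linarith [sq_nonneg s.2]

lemma abs_snd_le_eu (s : R2) : |s.2| ≤ eu s := by
  apply Real.abs_le_sqrt; unfold sq2; linarith [sq_nonneg s.1]

/-- touching of `t - t²` from above by a quadratic -/
lemma eu_touch {s σ : R2} {e1 e2 t : ℝ} (ht : 0 < t) (hs1 : s.1 = t * e1) (hs2 : s.2 = t * e2)
    (he : e1 ^ 2 + e2 ^ 2 = 1) (ha : t / 2 < t + (e1 * σ.1 + e2 * σ.2)) :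
    eu (s + σ) - eu (s + σ) ^ 2 ≤ t - t ^ 2 + (1 - 2 * t) * (e1 * σ.1 + e2 * σ.2)
      - (e1 * σ.1 + e2 * σ.2) ^ 2 + (e1 * σ.2 - e2 * σ.1) ^ 2 / t := by
  obtain ⟨α, hα⟩ : ∃ α, α = e1 * σ.1 + e2 * σ.2 := ⟨_, rfl⟩
  obtain ⟨β, hβ⟩ : ∃ β, β = e1 * σ.2 - e2 * σ.1 := ⟨_, rfl⟩
  have hsq : sq2 (s + σ) = (t + α) ^ 2 + β ^ 2 := by
    simp only [sq2, Prod.fst_add, Prod.snd_add, hs1, hs2, hα, hβ]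
    linear_combination (t ^ 2 - 0 * t + (σ.1 ^ 2 + σ.2 ^ 2) * (-1)) * he
  rw [← hα] at ha ⊢
  rw [← hβ]
  have h1 : eu (s + σ) ≤ (t + α) + β ^ 2 / t := by
    apply Real.sqrt_le_iff.mpr
    have hb : 0 ≤ β ^ 2 / t := by positivity
    refine ⟨by linarith, ?_⟩
    rw [hsq]
    have h2 : β ^ 2 = β ^ 2 / t * t := by field_simp
    have h3 : β ^ 2 / t * t ≤ β ^ 2 / t * (2 * (t + α)) := by gcongr; linarith
    have h4 : 0 ≤ (β ^ 2 / t) ^ 2 := sq_nonneg _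
    linarith
  rw [eu_sq, hsq]
  have := sq_nonneg β
  linarith

lemma il {κ : ℝ} (hκ0 : 0 ≤ κ) {G : ℝ → ℝ → ℝ → ℝ} (hG : Op κ G) {v : R2 → ℝ}
    (hc : ContinuousOn v (Rc (1/2))) (hsol : ∀ z ∈ Ro (1/2), SolAt G v z)
    (h1 : ∀ z ∈ Rc (1/2), |v z| ≤ 1) {A e L : ℝ} (he : 0 ≤ e) (h2 : ∀ z ∈ Rc (1/2), |v z| ≤ A * z.2 + e)
    (hA : 0 ≤ A) (hLA : 2 * A ≤ L) (hL : 20 ≤ L) (hLκ : 64 < L * (1 - κ)) {X0 Z0 : R2} (hX0 : X0 ∈ Rc (1/4)) (hZ0 : Z0 ∈ Rc (1/2))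
    (hXZ : eu (X0 - Z0) ≤ 1/8) : v X0 - v Z0 ≤ L * eu (X0 - Z0) + 2 * e := by
  obtain ⟨D, hD⟩ : ∃ D : Set (R2 × R2), D = {X | X ∈ Rc (1/2) ×ˢ Rc (1/2) ∧ eu (X.1 - X.2) ≤ 1/8 ∧ eu (X.1 - X0) ≤ 1/8} := ⟨_, rfl⟩
  obtain ⟨Φ, hΦ⟩ : ∃ Φ : R2 × R2 → ℝ, Φ = fun X => v X.1 - v X.2 - L * (eu (X.1 - X.2) - eu (X.1 - X.2) ^ 2)
    - 128 * sq2 (X.1 - X0) - 2 * e := ⟨_, rfl⟩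
  have hRcomp : IsCompact (Rc (1/2)) := by
    have : Rc (1/2) = Icc (-(1/2)) (1/2) ×ˢ Icc 0 (1/2) := by
      ext x; simp only [Rc, mem_ofPred_eq, mem_prod, mem_Icc, abs_le]
    rw [this]; exact isCompact_Icc.prod isCompact_Icc
  have cA : Continuous (fun X : R2 × R2 => eu (X.1 - X.2)) := eu_cont.comp (continuous_fst.sub continuous_snd)
  have cB : Continuous (fun X : R2 × R2 => eu (X.1 - X0)) := eu_cont.comp (continuous_fst.sub continuous_const)
  have cB' : Continuous (fun X : R2 × R2 => sq2 (X.1 - X0)) := sq2_cont.comp (continuous_fst.sub continuous_const)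
  have hDc : IsCompact D := by
    have : D = (Rc (1/2) ×ˢ Rc (1/2)) ∩ ({X | eu (X.1 - X.2) ≤ 1/8} ∩ {X | eu (X.1 - X0) ≤ 1/8}) := by rw [hD]; rfl
    rw [this]
    exact (hRcomp.prod hRcomp).inter_right ((isClosed_le cA continuous_const).inter (isClosed_le cB continuous_const))
  have hX0' : X0 ∈ Rc (1/2) := by
    obtain ⟨k1, k2, k3⟩ := hX0
    exact ⟨by linarith, k2, by linarith⟩
  have heu0 : eu (0 : R2) = 0 := by simp [eu, sq2]
  have h0D : (X0, Z0) ∈ D := by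
    rw [hD]
    exact ⟨⟨hX0', hZ0⟩, hXZ, by simp only [sub_self, heu0]; norm_num⟩
  have hΦc : ContinuousOn Φ D := by
    rw [hΦ]
    have k1 : ContinuousOn (fun X : R2 × R2 => v X.1) D := hc.comp continuousOn_fst (fun X hX => by rw [hD] at hX; exact hX.1.1)
    have k2 : ContinuousOn (fun X : R2 × R2 => v X.2) D := hc.comp continuousOn_snd (fun X hX => by rw [hD] at hX; exact hX.1.2)
    have k3 : Continuous (fun X : R2 × R2 => L * (eu (X.1 - X.2) - eu (X.1 - X.2) ^ 2)) := by fun_prop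
    exact (((k1.sub k2).sub k3.continuousOn).sub (continuous_const.mul cB').continuousOn).sub continuousOn_const
  obtain ⟨⟨X, Z⟩, hXZD, hmax⟩ := hDc.exists_isMaxOn ⟨_, h0D⟩ hΦc
  have hmax' : ∀ Y ∈ D, Φ Y ≤ Φ (X, Z) := fun Y hY => hmax hY
  suffices hle : Φ (X, Z) ≤ 0 by
    have k := (hmax' _ h0D).trans hle
    rw [hΦ] at k
    simp only [sub_self] at k
    have hs0 : sq2 (0 : R2) = 0 := by simp [sq2]
    rw [hs0] at k
    have : 0 ≤ L * eu (X0 - Z0) ^ 2 := by positivity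
    linarith
  by_contra hpos
  push Not at hpos
  have hmem := hXZD
  rw [hD] at hmem
  obtain ⟨⟨hX, hZ⟩, ht8, hd8⟩ := hmem
  simp only at hX hZ ht8 hd8
  obtain ⟨t, ht⟩ : ∃ t, t = eu (X - Z) := ⟨_, rfl⟩
  rw [← ht] at ht8
  have ht0 : 0 ≤ t := ht ▸ eu_nonneg _
  have hval : 0 < v X - v Z - L * (t - t ^ 2) - 128 * sq2 (X - X0) - 2 * e := by
    rw [hΦ] at hpos; rw [ht]; exact hpos
  have hvX := abs_le.mp (h1 X hX)
  have hvZ := abs_le.mp (h1 Z hZ)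
  have hvX2 := abs_le.mp (h2 X hX)
  have hvZ2 := abs_le.mp (h2 Z hZ)
  have hsq0 := sq2_nonneg (X - X0)
  have htt : L * (t / 2) ≤ L * (t - t ^ 2) := by
    apply mul_le_mul_of_nonneg_left _ (by linarith)
    have : t * t ≤ t * (1 / 8) := mul_le_mul_of_nonneg_left ht8 ht0
    linarith
  have htA : A * t ≤ L * (t / 2) := by
    have : 2 * A * t ≤ L * t := mul_le_mul_of_nonneg_right hLA ht0
    linarith
  have hLt0 : 0 ≤ A * t := mul_nonneg hA ht0
  have hst : |X.2 - Z.2| ≤ t := by rw [ht]; exact abs_snd_le_eu (X - Z)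
  -- interior facts
  have f1 : 0 < X.2 := by
    rcases lt_or_eq_of_le hX.2.1 with h | h
    · exact h
    · exfalso
      rw [← h] at hvX2 hst
      have : A * Z.2 ≤ A * t := mul_le_mul_of_nonneg_left (by linarith [(abs_le.mp hst).1]) hA
      linarith
  have f2 : 0 < Z.2 := by
    rcases lt_or_eq_of_le hZ.2.1 with h | h
    · exact h
    · exfalso
      rw [← h] at hvZ2 hst
      have : A * X.2 ≤ A * t := mul_le_mul_of_nonneg_left (by linarith [(abs_le.mp hst).2]) hA
      linarith
  have f3 : t < 1/8 := by
    rcases lt_or_eq_of_le ht8 with h | h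
    · exact h
    · exfalso
      rw [h] at hval
      have : 20 * (1/8 - (1/8:ℝ)^2) ≤ L * (1/8 - (1/8)^2) := mul_le_mul_of_nonneg_right hL (by norm_num)
      linarith
  have f4 : eu (X - X0) < 1/8 := by
    rcases lt_or_eq_of_le hd8 with h | h
    · exact h
    · exfalso
      have h' := eu_sq (X - X0)
      rw [h] at h'
      rw [← h'] at hval
      norm_num at hval
      linarith
  have f5 : 0 < t := by
    rcases lt_or_eq_of_le ht0 with h | h
    · exact h
    · exfalso
      have h' := eu_sq (X - Z)
      rw [← ht, ← h] at h'
      have hn := norm_le_sq2 (X - Z)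
      rw [← h'] at hn
      have : ‖X - Z‖ = 0 := by
        have h9 := norm_nonneg (X - Z)
        exact pow_eq_zero_iff two_ne_zero |>.mp (le_antisymm (by simpa using hn) (sq_nonneg _))
      have hXZe : X = Z := by rwa [norm_sub_eq_zero_iff] at this
      rw [hXZe, ← h] at hval
      norm_num at hval
      linarith [sq2_nonneg (Z - X0)]
  have f6 : |X.1| < 3/8 ∧ X.2 < 3/8 := by
    have k1 := abs_fst_le_eu (X - X0)
    have k2 := abs_snd_le_eu (X - X0)
    simp only [Prod.fst_sub, Prod.snd_sub] at k1 k2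
    obtain ⟨m1, m2, m3⟩ := hX0
    rw [abs_le] at k1 k2 m1
    rw [abs_lt]
    refine ⟨⟨by linarith, by linarith⟩, by linarith⟩
  have f7 : |Z.1| < 1/2 ∧ Z.2 < 1/2 := by
    have k1 := abs_fst_le_eu (X - Z)
    have k2 := abs_snd_le_eu (X - Z)
    simp only [Prod.fst_sub, Prod.snd_sub] at k1 k2
    obtain ⟨m1, m3⟩ := f6
    rw [← ht] at k1 k2
    rw [abs_le] at k1 k2
    rw [abs_lt] at m1 ⊢
    refine ⟨⟨by linarith, by linarith⟩, by linarith⟩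
  obtain ⟨e1, he1⟩ : ∃ e1, e1 = (X - Z).1 / t := ⟨_, rfl⟩
  obtain ⟨e2, he2⟩ : ∃ e2, e2 = (X - Z).2 / t := ⟨_, rfl⟩
  have hs1 : (X - Z).1 = t * e1 := by rw [he1]; field_simp
  have hs2 : (X - Z).2 = t * e2 := by rw [he2]; field_simp
  have hee : e1 ^ 2 + e2 ^ 2 = 1 := by
    have h' := eu_sq (X - Z)
    unfold sq2 at h'
    rw [← ht, hs1, hs2] at h'
    have : t ^ 2 * (e1 ^ 2 + e2 ^ 2) = t ^ 2 * 1 := by linarith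
    exact mul_left_cancel₀ (by positivity) this
  -- neighbourhood
  have hXo : X ∈ Ro (1/2) := ⟨by linarith [f6.1], f1, by linarith [f6.2]⟩
  have hZo : Z ∈ Ro (1/2) := ⟨f7.1, f2, f7.2⟩
  have n1 : ∀ᶠ Y : R2 × R2 in 𝓝 (X, Z), Y.1 ∈ Ro (1/2) ∧ Y.2 ∈ Ro (1/2) :=
    ((isOpen_Ro _).prod (isOpen_Ro _)).mem_nhds (show (X, Z) ∈ Ro (1/2) ×ˢ Ro (1/2) from ⟨hXo, hZo⟩)
  have n2 : ∀ᶠ Y : R2 × R2 in 𝓝 (X, Z), eu (Y.1 - Y.2) < 1/8 :=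
    (isOpen_lt cA continuous_const).mem_nhds (show eu (X - Z) < 1/8 by rw [← ht]; exact f3)
  have n3 : ∀ᶠ Y : R2 × R2 in 𝓝 (X, Z), eu (Y.1 - X0) < 1/8 :=
    (isOpen_lt cB continuous_const).mem_nhds (show eu (X - X0) < 1/8 from f4)
  have n4 : ∀ᶠ Y : R2 × R2 in 𝓝 (X, Z), t / 2 < t + (e1 * ((Y.1 - X) - (Y.2 - Z)).1 + e2 * ((Y.1 - X) - (Y.2 - Z)).2) := by
    have hcc : Continuous (fun Y : R2 × R2 => t + (e1 * ((Y.1 - X) - (Y.2 - Z)).1 + e2 * ((Y.1 - X) - (Y.2 - Z)).2)) := by fun_prop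
    refine (isOpen_lt continuous_const hcc).mem_nhds ?_
    change t / 2 < t + (e1 * ((X - X) - (Z - Z)).1 + e2 * ((X - X) - (Z - Z)).2)
    simp only [sub_self, Prod.fst_zero, Prod.snd_zero, mul_zero, add_zero]
    linarith
  obtain ⟨ρ', hρ', hball⟩ := Metric.eventually_nhds_iff.mp (n1.and (n2.and (n3.and n4)))
  obtain ⟨ρ, hρ⟩ : ∃ ρ, ρ = ρ' / 4 := ⟨_, rfl⟩
  have hρ0 : 0 < ρ := by rw [hρ]; positivity
  have hball' : ∀ ξ ζ : R2, ‖ξ‖ ≤ 2 * ρ → ‖ζ‖ ≤ 2 * ρ → dist ((X + ξ, Z + ζ) : R2 × R2) (X, Z) < ρ' := by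
    intro ξ ζ k1 k2
    rw [dist_eq_norm, Prod.norm_def]
    simp only [Prod.fst_sub, Prod.snd_sub, add_sub_cancel_left]
    exact max_lt (by linarith) (by linarith)
  have hbX : closedBall X (2 * ρ) ⊆ Ro (1/2) := by
    intro y hy
    have := (hball (hball' (y - X) 0 (by rw [← dist_eq_norm]; exact hy) (by simp; positivity))).1.1
    simpa using this
  have hbZ : closedBall Z (2 * ρ) ⊆ Ro (1/2) := by
    intro y hy
    have := (hball (hball' 0 (y - Z) (by simp; positivity) (by rw [← dist_eq_norm]; exact hy))).1.2
    simpa using this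
  obtain ⟨η, hη⟩ : ∃ η, η = (8 * (L * (1 - κ)) - 512) / 16 := ⟨_, rfl⟩
  have hη0 : 0 < η := by rw [hη]; linarith
  obtain ⟨p1, q1, r1, p2, q2, r2, hG1, hG2, hform⟩ := doubling (ρ := ρ) (x := X) (z := Z) (G := G) (G' := G) (u := v) (v := v) hρ0
    (hc.mono (hbX.trans (Ro_sub_Rc _))) (hc.mono (hbZ.trans (Ro_sub_Rc _)))
    (fun y hy => (hsol y (hbX (ball_subset_closedBall hy))).1) (fun y hy => (hsol y (hbZ (ball_subset_closedBall hy))).2)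
    (b1 := L * ((1 - 2 * t) * e1)) (b2 := L * ((1 - 2 * t) * e2))
    (p := 2 * L * (-e1 ^ 2 + e2 ^ 2 / t)) (q := 2 * L * (-e1 * e2 - e1 * e2 / t)) (r := 2 * L * (-e2 ^ 2 + e1 ^ 2 / t))
    (d1 := 256 * (X.1 - X0.1)) (d2 := 256 * (X.2 - X0.2)) (m := 128) (by
      intro ξ ζ k1 k2
      obtain ⟨⟨g1, g1'⟩, g2, g3, g4⟩ := hball (hball' ξ ζ k1 k2)
      have hin : (X + ξ, Z + ζ) ∈ D := by
        rw [hD]; exact ⟨⟨Ro_sub_Rc _ g1, Ro_sub_Rc _ g1'⟩, g2.le, g3.le⟩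
      have k3 := hmax' _ hin
      simp only [add_sub_cancel_left] at g4
      have k4 := eu_touch (s := X - Z) (σ := ξ - ζ) f5 hs1 hs2 hee g4
      have k5 : L * (eu (X - Z + (ξ - ζ)) - eu (X - Z + (ξ - ζ)) ^ 2) ≤ _ := mul_le_mul_of_nonneg_left k4 (by linarith : 0 ≤ L)
      rw [hΦ] at k3
      simp only at k3
      rw [← ht, show X + ξ - (Z + ζ) = X - Z + (ξ - ζ) by abel] at k3
      have k6 : 128 * sq2 (X + ξ - X0) = 128 * sq2 (X - X0) + qd (256 * (X.1 - X0.1)) (256 * (X.2 - X0.2)) (2 * 128) 0 (2 * 128) ξ := by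
        simp only [sq2, qd, Prod.fst_sub, Prod.snd_sub, Prod.fst_add, Prod.snd_add]; ring
      have k7 : L * (t - t ^ 2 + (1 - 2 * t) * (e1 * (ξ - ζ).1 + e2 * (ξ - ζ).2)
          - (e1 * (ξ - ζ).1 + e2 * (ξ - ζ).2) ^ 2 + (e1 * (ξ - ζ).2 - e2 * (ξ - ζ).1) ^ 2 / t) =
          L * (t - t ^ 2) + qd (L * ((1 - 2 * t) * e1)) (L * ((1 - 2 * t) * e2)) (2 * L * (-e1 ^ 2 + e2 ^ 2 / t))
            (2 * L * (-e1 * e2 - e1 * e2 / t)) (2 * L * (-e2 ^ 2 + e1 ^ 2 / t)) (ξ - ζ) := by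
        unfold qd; ring
      rw [k7] at k5
      rw [k6] at k3
      generalize L * (eu (X - Z + (ξ - ζ)) - eu (X - Z + (ξ - ζ)) ^ 2) = T1 at k3 k5
      generalize L * (t - t ^ 2) = T2 at k3 k5
      generalize qd _ _ _ _ _ (ξ - ζ) = T3 at k5 ⊢
      linarith) hη0
  have hell := hG.ell _ _ _ _ _ _ (hG2.trans hG1)
  have hft := form_tr (p := p1 - p2) (q := q1 - q2) (r := r1 - r2) (c := 128 + 2 * η) (by
    intro ξ
    have := hform ξ ξ
    simp only [qd, sq2, Prod.fst_sub, Prod.snd_sub] at this ⊢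
    linarith)
  have hperp := hform (-e2, e1) (-e2, e1)
  have he' := hform (e1, e2) (-e1, -e2)
  have hform1 : qd 0 0 (p1 - p2) (q1 - q2) (r1 - r2) (e1, e2) ≤ -4 * L + 128 + 2 * η := by
    have k1 : qd 0 0 p1 q1 r1 (e1, e2) - qd 0 0 p2 q2 r2 (-e1, -e2) = qd 0 0 (p1 - p2) (q1 - q2) (r1 - r2) (e1, e2) := by
      unfold qd; ring
    have k2 : qd 0 0 (2 * L * (-e1 ^ 2 + e2 ^ 2 / t)) (2 * L * (-e1 * e2 - e1 * e2 / t)) (2 * L * (-e2 ^ 2 + e1 ^ 2 / t)) ((e1, e2) - (-e1, -e2))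
        = -4 * L * (e1 ^ 2 + e2 ^ 2) ^ 2 := by
      simp only [qd, Prod.fst_sub, Prod.snd_sub]; ring
    have k3 : sq2 (e1, e2) = 1 := hee
    have k4 : sq2 (-e1, -e2) = 1 := by simp only [sq2]; linarith
    rw [k1, k2, k3, k4, hee] at he'
    linarith
  have hform2 : qd 0 0 (p1 - p2) (q1 - q2) (r1 - r2) (-e2, e1) ≤ 128 + 2 * η := by
    have k1 : qd 0 0 p1 q1 r1 (-e2, e1) - qd 0 0 p2 q2 r2 (-e2, e1) = qd 0 0 (p1 - p2) (q1 - q2) (r1 - r2) (-e2, e1) := by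
      unfold qd; ring
    have k3 : sq2 (-e2, e1) = 1 := by simp only [sq2]; linarith
    have k5 : qd 0 0 (2 * L * (-e1 ^ 2 + e2 ^ 2 / t)) (2 * L * (-e1 * e2 - e1 * e2 / t)) (2 * L * (-e2 ^ 2 + e1 ^ 2 / t)) (0 : R2) = 0 := by
      simp [qd]
    rw [k1, sub_self, k5, k3] at hperp
    linarith
  have hsum : qd 0 0 (p1 - p2) (q1 - q2) (r1 - r2) (e1, e2) + qd 0 0 (p1 - p2) (q1 - q2) (r1 - r2) (-e2, e1)
      = ((p1 - p2) + (r1 - r2)) / 2 := by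
    have : qd 0 0 (p1 - p2) (q1 - q2) (r1 - r2) (e1, e2) + qd 0 0 (p1 - p2) (q1 - q2) (r1 - r2) (-e2, e1)
      = ((p1 - p2) + (r1 - r2)) / 2 * (e1 ^ 2 + e2 ^ 2) := by unfold qd; ring
    rw [this, hee, mul_one]
  have htr : 8 * L ≤ 4 * (128 + 2 * η) - ((p1 - p2) + (r1 - r2)) := by linarith
  have k1 := mul_le_mul_of_nonneg_left hft hκ0
  have hκ1 : 0 < 1 - κ := by
    by_contra hcon
    push Not at hcon
    have : L * (1 - κ) ≤ 0 := mul_nonpos_of_nonneg_of_nonpos (by linarith) hcon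
    linarith
  have k2 := mul_le_mul_of_nonneg_left htr hκ1.le
  linarith

/-- jets are determined up to the change of variables `x ↦ z0 + t x`, subtraction of a quadratic and scaling -/
lemma SolAt.trans {G : ℝ → ℝ → ℝ → ℝ} {v : R2 → ℝ} {z : R2} (z0 : R2) {t s : ℝ} (ht : 0 < t) (hs : 0 < s)
    (P : R2 → ℝ) (p11 p12 p22 : ℝ) (hP : ∃ g1 g2, ∀ h, P (z + h) = P z + qd g1 g2 p11 p12 p22 h)
    (hv : SolAt G v (z0 + t • z)) :
    SolAt (fun p q r => G ((s * p + p11) / t ^ 2) ((s * q + p12) / t ^ 2) ((s * r + p22) / t ^ 2))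
      (fun x => (v (z0 + t • x) - P x) / s) z := by
  obtain ⟨g1, g2, hP⟩ := hP
  have htend : Tendsto (fun h : R2 => t⁻¹ • h) (𝓝 0) (𝓝 0) := by
    have : Continuous (fun h : R2 => t⁻¹ • h) := by fun_prop
    simpa using this.tendsto 0
  have key : ∀ (b1 b2 p q r : ℝ) (h : R2), qd ((s * b1 + g1) / t) ((s * b2 + g2) / t) ((s * p + p11) / t ^ 2)
      ((s * q + p12) / t ^ 2) ((s * r + p22) / t ^ 2) h = s * qd b1 b2 p q r (t⁻¹ • h) + qd g1 g2 p11 p12 p22 (t⁻¹ • h) := by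
    intro b1 b2 p q r h
    simp only [qd, Prod.smul_fst, Prod.smul_snd, smul_eq_mul]
    field_simp; ring
  have harg : ∀ h : R2, z0 + t • (z + t⁻¹ • h) = z0 + t • z + h := by
    intro h
    rw [smul_add, smul_smul, mul_inv_cancel₀ ht.ne', one_smul, add_assoc]
  constructor
  · intro b1 b2 p q r hh
    apply hv.1 ((s * b1 + g1) / t) ((s * b2 + g2) / t)
    filter_upwards [htend.eventually hh] with h hh
    rw [key]
    rw [harg, hP, div_add' _ _ _ hs.ne', div_le_div_iff_of_pos_right hs] at hh
    linarith
  · intro b1 b2 p q r hh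
    apply hv.2 ((s * b1 + g1) / t) ((s * b2 + g2) / t)
    filter_upwards [htend.eventually hh] with h hh
    rw [key]
    rw [harg, hP, div_add' _ _ _ hs.ne', div_le_div_iff_of_pos_right hs] at hh
    linarith

lemma Op.trans {κ : ℝ} {G : ℝ → ℝ → ℝ → ℝ} (hG : Op κ G) {t s : ℝ} (ht : 0 < t) (hs : 0 < s) (p11 p12 p22 : ℝ) :
    Op κ (fun p q r => G ((s * p + p11) / t ^ 2) ((s * q + p12) / t ^ 2) ((s * r + p22) / t ^ 2)) := by
  constructor
  · have : Continuous (fun x : ℝ × ℝ × ℝ => (((s * x.1 + p11) / t ^ 2, (s * x.2.1 + p12) / t ^ 2, (s * x.2.2 + p22) / t ^ 2) : ℝ × ℝ × ℝ)) := by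
      fun_prop
    exact hG.cont.comp this
  · intro p q r p' q' r' h
    have h1 := hG.ell _ _ _ _ _ _ h
    have e1 : ∀ x y w : ℝ, (s * x + w) / t ^ 2 - (s * y + w) / t ^ 2 = s / t ^ 2 * (x - y) := by
      intro x y w; ring
    have hc : 0 < s / t ^ 2 := by positivity
    rw [e1, e1, e1, dev_smul _ _ _ _ hc.le] at h1
    have h2 : 0 ≤ (s / t ^ 2) * ((p - p') + (r - r') + κ * dev (p - p') (q - q') (r - r')) := by
      linarith
    exact nonneg_of_mul_nonneg_right h2 hc

/-- solving `G = 0` along a nonnegative diagonal direction -/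
lemma Op.root {κ : ℝ} (hκ0 : 0 ≤ κ) (hκ1 : κ < 1) {G : ℝ → ℝ → ℝ → ℝ} (hG : Op κ G) (p0 q0 r0 p q r d1 d2 : ℝ)
    (h0 : G p0 q0 r0 = 0)
    (hd1 : 0 ≤ d1) (hd2 : 0 ≤ d2) (hd : 0 < d1 + d2) :
    ∃ t, G (p0 + p + t * d1) (q0 + q) (r0 + r + t * d2) = 0 ∧ |t| * ((d1 + d2) * (1 - κ)) ≤ |p + r| + κ * dev p q r := by
  have hdd : 0 < (d1 + d2) * (1 - κ) := mul_pos hd (by linarith)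
  have hdev : ∀ t, dev (p + t * d1) q (r + t * d2) ≤ dev p q r + |t| * (d1 + d2) := by
    intro t
    have h1 := dev_tri p q r (t * d1) 0 (t * d2)
    rw [add_zero, dev_diag, ← mul_sub, abs_mul] at h1
    have h2 : |t| * |d1 - d2| ≤ |t| * (d1 + d2) :=
      mul_le_mul_of_nonneg_left (abs_le.mpr ⟨by linarith, by linarith⟩) (abs_nonneg t)
    linarith
  have hpos : ∀ t, |p + r| + κ * dev p q r < t * ((d1 + d2) * (1 - κ)) → 0 < G (p0 + p + t * d1) (q0 + q) (r0 + r + t * d2) := by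
    intro t ht
    by_contra hcon
    push Not at hcon
    have ht0 : 0 < t := by
      by_contra h
      push Not at h
      have := mul_nonpos_of_nonpos_of_nonneg h hdd.le
      have := mul_nonneg hκ0 (dev_nonneg p q r)
      have := abs_nonneg (p + r)
      linarith
    have h1 := hG.ell p0 q0 r0 (p0 + p + t * d1) (q0 + q) (r0 + r + t * d2) (by rw [h0]; exact hcon)
    rw [show p0 - (p0 + p + t * d1) = -(p + t * d1) by ring, show q0 - (q0 + q) = -q by ring,
      show r0 - (r0 + r + t * d2) = -(r + t * d2) by ring, dev_neg] at h1
    have h2 := mul_le_mul_of_nonneg_left (hdev t) hκ0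
    rw [abs_of_pos ht0] at h2
    have := neg_abs_le (p + r)
    linarith
  have hneg : ∀ t, t * ((d1 + d2) * (1 - κ)) < -(|p + r| + κ * dev p q r) → G (p0 + p + t * d1) (q0 + q) (r0 + r + t * d2) < 0 := by
    intro t ht
    by_contra hcon
    push Not at hcon
    have ht0 : t < 0 := by
      by_contra h
      push Not at h
      have := mul_nonneg h hdd.le
      have := mul_nonneg hκ0 (dev_nonneg p q r)
      have := abs_nonneg (p + r)
      linarith
    have h1 := hG.ell (p0 + p + t * d1) (q0 + q) (r0 + r + t * d2) p0 q0 r0 (by rw [h0]; exact hcon)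
    rw [show (p0 + p + t * d1) - p0 = (p + t * d1) by ring, show (q0 + q) - q0 = q by ring,
      show (r0 + r + t * d2) - r0 = (r + t * d2) by ring] at h1
    have h2 := mul_le_mul_of_nonneg_left (hdev t) hκ0
    rw [abs_of_neg ht0] at h2
    have := le_abs_self (p + r)
    linarith
  obtain ⟨B, hB⟩ : ∃ B, B = (|p + r| + κ * dev p q r) / ((d1 + d2) * (1 - κ)) := ⟨_, rfl⟩
  have hB' : B * ((d1 + d2) * (1 - κ)) = |p + r| + κ * dev p q r := by rw [hB]; exact div_mul_cancel₀ _ hdd.ne'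
  have hB0 : 0 ≤ B := by
    rw [hB]; have := dev_nonneg p q r; positivity
  have hc : Continuous (fun t => G (p0 + p + t * d1) (q0 + q) (r0 + r + t * d2)) :=
    hG.cont.comp (by fun_prop : Continuous (fun t : ℝ => ((p0 + p + t * d1, q0 + q, r0 + r + t * d2) : ℝ × ℝ × ℝ)))
  have hivt := intermediate_value_Icc (a := -(B + 1)) (b := B + 1) (by linarith) hc.continuousOn
  obtain ⟨t, -, ht⟩ := hivt (show (0:ℝ) ∈ _ from ⟨(hneg _ (by linarith)).le, (hpos _ (by linarith)).le⟩)
  simp only at ht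
  refine ⟨t, ht, ?_⟩
  by_contra hcon
  push Not at hcon
  rcases le_total 0 t with h | h
  · rw [abs_of_nonneg h] at hcon
    have := hpos t hcon
    linarith
  · rw [abs_of_nonpos h] at hcon
    have := hneg t (by linarith)
    linarith

/-- the barrier step of the flat lemma -/
lemma flat_barrier {κ : ℝ} (hκ1 : κ < 1) {R E : ℝ} (hR : 0 < R) (hE : 0 < E) {V : R2 → ℝ}
    (hc : ContinuousOn V (Rc R)) (hss : ∀ z ∈ Ro R, SupS κ (fun x => -V x) z)
    (hb : ∀ z ∈ Rc R, z.2 = 0 → V z ≤ E) (ht : ∀ z ∈ Rc R, z.2 = R → V z ≤ E)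
    (hl : ∀ z ∈ Rc R, V z ≤ V (0, z.2) + E) : ∀ z ∈ Rc R, V z ≤ (6 + 2 / (1 - κ)) * E := by
  have h1κ : 0 < 1 - κ := by linarith
  obtain ⟨A, hA⟩ : ∃ A, A = 8 / (1 - κ) := ⟨_, rfl⟩
  have hA0 : 0 < A := by rw [hA]; positivity
  have hA1 : A * (1 - κ) = 8 := by rw [hA]; field_simp
  have hRcomp : IsCompact (Rc R) := by
    have : Rc R = Icc (-R) R ×ˢ Icc 0 R := by
      ext x; simp only [Rc, mem_ofPred_eq, mem_prod, mem_Icc, abs_le]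
    rw [this]; exact isCompact_Icc.prod isCompact_Icc
  obtain ⟨ψ, hψ⟩ : ∃ ψ : R2 → ℝ, ψ = fun x => 2 * E + 4 * E / R ^ 2 * x.1 ^ 2 + A * E / R ^ 2 * (x.2 * (R - x.2)) := ⟨_, rfl⟩
  have hcoef : 0 < A * E / R ^ 2 := by positivity
  have hmain := max_princ hRcomp (f := fun x => -ψ x - -V x) (by
    have : Continuous ψ := by rw [hψ]; fun_prop
    exact this.continuousOn.neg.sub hc.neg) (by
    intro z hz hpos
    obtain ⟨z1, z2, z3⟩ := hz
    have hyy : 0 ≤ A * E / R ^ 2 * (z.2 * (R - z.2)) := mul_nonneg hcoef.le (mul_nonneg z2 (by linarith))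
    have hxx : 0 ≤ 4 * E / R ^ 2 * z.1 ^ 2 := by positivity
    by_cases c1 : |z.1| = R
    · left
      refine ⟨(0, z.2), ⟨by simpa using hR.le, z2, z3⟩, ?_⟩
      have := hl z ⟨z1, z2, z3⟩
      have hx2 : z.1 ^ 2 = R ^ 2 := by rw [← sq_abs, c1]
      have e4 : 4 * E / R ^ 2 * R ^ 2 = 4 * E := by field_simp
      simp only [hψ, hx2, e4]
      have : 4 * E / R ^ 2 * (0:ℝ) ^ 2 = 0 := by simp
      linarith
    · right
      have hψz : ψ z = 2 * E + 4 * E / R ^ 2 * z.1 ^ 2 + A * E / R ^ 2 * (z.2 * (R - z.2)) := by rw [hψ]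
      have c2 : z.2 ≠ 0 := by
        intro h; have := hb z ⟨z1, z2, z3⟩ h; linarith
      have c3 : z.2 ≠ R := by
        intro h; have := ht z ⟨z1, z2, z3⟩ h; linarith
      have hzo : z ∈ Ro R := ⟨lt_of_le_of_ne z1 c1, lt_of_le_of_ne z2 (Ne.symm c2), lt_of_le_of_ne z3 c3⟩
      refine ⟨interior_maximal (Ro_sub_Rc R) (isOpen_Ro R) hzo, ?_⟩
      have hbar := (hss z hzo).quad_barrier (fun x => -ψ x) (-(8 * E / R ^ 2 * z.1)) (-(A * E / R ^ 2 * (R - 2 * z.2)))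
        (-(8 * E / R ^ 2)) 0 (2 * (A * E / R ^ 2)) (by
          intro h
          simp only [hψ, qd, Prod.fst_add, Prod.snd_add]; ring) (by
          rw [dev_diag, abs_of_nonpos (by have : 0 < 8 * E / R ^ 2 := by positivity
                                          linarith)]
          have e1 : 8 * E / R ^ 2 = 8 * (E / R ^ 2) := by ring
          have e2 : A * E / R ^ 2 = A * (E / R ^ 2) := by ring
          rw [e1, e2]
          have hER : 0 < E / R ^ 2 := by positivity
          have : 0 < (E / R ^ 2) * (2 * (A * (1 - κ)) - 8 - 8 * κ) := mul_pos hER (by rw [hA1]; linarith)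
          linarith)
      exact hbar)
  intro z hz
  have h1 := hmain z hz
  simp only [hψ] at h1
  obtain ⟨z1, z2, z3⟩ := hz
  have hx2 : z.1 ^ 2 ≤ R ^ 2 := by rw [← sq_abs]; gcongr
  have k1 : 4 * E / R ^ 2 * z.1 ^ 2 ≤ 4 * E := by
    calc _ ≤ 4 * E / R ^ 2 * R ^ 2 := by gcongr
      _ = 4 * E := by field_simp
  have k2 : A * E / R ^ 2 * (z.2 * (R - z.2)) ≤ A * E / 4 := by
    calc _ ≤ A * E / R ^ 2 * (R ^ 2 / 4) := by
          gcongr; linarith [sq_nonneg (z.2 - R / 2)]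
      _ = A * E / 4 := by field_simp
  have k3 : 2 / (1 - κ) * E = A * E / 4 := by rw [hA]; ring
  linarith

lemma smul_Rc {t R : ℝ} (ht : 0 < t) {z : R2} (hz : z ∈ Rc R) : t • z ∈ Rc (t * R) := by
  obtain ⟨h1, h2, h3⟩ := hz
  refine ⟨?_, ?_, ?_⟩
  · rw [Prod.smul_fst, smul_eq_mul, abs_mul, abs_of_pos ht]; gcongr
  · rw [Prod.smul_snd, smul_eq_mul]; positivity
  · rw [Prod.smul_snd, smul_eq_mul]; gcongr

lemma smul_Ro {t R : ℝ} (ht : 0 < t) {z : R2} (hz : z ∈ Ro R) : t • z ∈ Ro (t * R) := by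
  obtain ⟨h1, h2, h3⟩ := hz
  refine ⟨?_, ?_, ?_⟩
  · rw [Prod.smul_fst, smul_eq_mul, abs_mul, abs_of_pos ht]; gcongr
  · rw [Prod.smul_snd, smul_eq_mul]; positivity
  · rw [Prod.smul_snd, smul_eq_mul]; gcongr

lemma Rc_mono {R R' : ℝ} (h : R ≤ R') : Rc R ⊆ Rc R' := fun _ hz => ⟨hz.1.trans h, hz.2.1, hz.2.2.trans h⟩
lemma Ro_mono {R R' : ℝ} (h : R ≤ R') : Ro R ⊆ Ro R' := fun _ hz => ⟨hz.1.trans_le h, hz.2.1, hz.2.2.trans_le h⟩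

/-- iterate Krylov -/
lemma krylov_iter {κ : ℝ} (hκ0 : 0 ≤ κ) (hκ1 : κ < 1) : ∃ θ : ℝ, 0 < θ ∧ θ < 1 ∧ ∀ (w : R2 → ℝ) (R m e : ℝ), 0 < R → 0 < m → 0 ≤ e →
    ContinuousOn w (Rc R) → (∀ z ∈ Ro R, SS κ w z) → (∀ z ∈ Rc R, |w z| ≤ m * z.2 + e) → ∀ k : ℕ,
    ∃ b, |b| ≤ k * m ∧ ∀ z ∈ Rc (R / 32 ^ k), |w z - b * z.2| ≤ (1 - θ) ^ k * m * z.2 + e := by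
  obtain ⟨θ, h0, h1, hk⟩ := krylov hκ0 hκ1
  refine ⟨θ, h0, h1, ?_⟩
  intro w R m e hR hm he hc hss hb k
  induction k with
  | zero => exact ⟨0, by simp, by simpa using hb⟩
  | succ k ih =>
    obtain ⟨b, hb1, hb2⟩ := ih
    have hle : R / 32 ^ k ≤ R := div_le_self hR.le (one_le_pow₀ (by norm_num))
    have h1θ : 0 < 1 - θ := by linarith
    obtain ⟨b', h3, h4⟩ := hk w (R / 32 ^ k) b ((1 - θ) ^ k * m) e (by positivity) (by positivity) he
      (hc.mono (Rc_mono hle)) (fun z hz => hss z (Ro_mono hle hz)) hb2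
    refine ⟨b', ?_, ?_⟩
    · have h5 : (1 - θ) ^ k * m ≤ 1 * m := by
        gcongr; exact pow_le_one₀ h1θ.le (by linarith)
      have h6 : |b'| ≤ |b' - b| + |b| := by
        have := abs_add_le (b' - b) b
        rwa [sub_add_cancel] at this
      push_cast
      linarith
    · intro z hz
      rw [pow_succ, ← div_div] at hz
      have := h4 z hz
      rw [pow_succ]
      linarith

/-- summing difference quotients -/
lemma diff_sum {v : R2 → ℝ} {R δ b μ e' : ℝ} (hδ : 0 < δ) {y : ℝ}
    (hw : ∀ x, |x| ≤ R → |v (x + δ, y) - v (x, y) - δ * (b * y)| ≤ δ * (μ * y + e')) (x : ℝ) (hx : -R ≤ x) :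
    ∀ n : ℕ, x + n * δ ≤ R → |v (x + n * δ, y) - v (x, y) - n * δ * (b * y)| ≤ n * δ * (μ * y + e') := by
  intro n
  induction n with
  | zero => intro _; simp
  | succ n ih =>
    intro h
    push_cast at h ⊢
    have hn : (0:ℝ) ≤ n * δ := by positivity
    have h1 := ih (by linarith)
    have h2 := hw (x + n * δ) (abs_le.mpr ⟨by linarith, by linarith⟩)
    rw [show x + n * δ + δ = x + (n + 1) * δ by ring] at h2
    rw [abs_le] at h1 h2 ⊢
    constructor <;> linarith

lemma diff_total {v : R2 → ℝ} {R δ b μ e' E0 : ℝ} (hδ : 0 < δ) {y : ℝ} (hy0 : 0 ≤ y) (hyR : y ≤ R)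
    (hμ : 0 ≤ μ) (he' : 0 ≤ e')
    (hw : ∀ x, |x| ≤ R → |v (x + δ, y) - v (x, y) - δ * (b * y)| ≤ δ * (μ * y + e'))
    (hs : ∀ x x', |x| ≤ R → |x'| ≤ R → |x' - x| ≤ δ → |v (x', y) - v (x, y)| ≤ E0)
    {x x' : ℝ} (hx : -R ≤ x) (hxx : x ≤ x') (hx' : x' ≤ R) (hd : x' - x ≤ R) :
    |v (x', y) - v (x, y) - b * (x' - x) * y| ≤ R * (μ * R + e') + E0 + δ * |b| * R := by
  obtain ⟨n, hn⟩ : ∃ n, n = ⌊(x' - x) / δ⌋₊ := ⟨_, rfl⟩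
  have hq : 0 ≤ (x' - x) / δ := div_nonneg (by linarith) hδ.le
  have hn1 : (n:ℝ) ≤ (x' - x) / δ := by rw [hn]; exact Nat.floor_le hq
  have hn2 : (x' - x) / δ < n + 1 := by rw [hn]; exact Nat.lt_floor_add_one _
  rw [le_div_iff₀ hδ] at hn1
  rw [div_lt_iff₀ hδ] at hn2
  have hn0 : (0:ℝ) ≤ n * δ := by positivity
  have h1 := diff_sum hδ hw x hx n (by linarith)
  have h2 := hs (x + n * δ) x' (abs_le.mpr ⟨by linarith, by linarith⟩) (abs_le.mpr ⟨by linarith, by linarith⟩)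
    (abs_le.mpr ⟨by linarith, by linarith⟩)
  have h3 : n * δ * (μ * y + e') ≤ R * (μ * R + e') := by
    apply mul_le_mul (by linarith) _ (by positivity) (by linarith)
    gcongr
  have h4 : |(x' - x - n * δ) * (b * y)| ≤ δ * |b| * R := by
    rw [abs_mul, abs_mul, mul_assoc]
    apply mul_le_mul _ _ (by positivity) hδ.le
    · rw [abs_le]; constructor <;> linarith
    · rw [abs_of_nonneg hy0]; gcongr
  rw [abs_le] at h1 h2 h4 ⊢
  constructor <;> linarith

lemma SolAt.shift {G : ℝ → ℝ → ℝ → ℝ} {v : R2 → ℝ} {z d : R2} (h : SolAt G v (z + d)) :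
    SolAt G (fun x => v (x + d)) z := by
  constructor
  · intro b1 b2 p q r hh
    apply h.1 b1 b2
    filter_upwards [hh] with x hx
    rwa [add_right_comm] at hx
  · intro b1 b2 p q r hh
    apply h.2 b1 b2
    filter_upwards [hh] with x hx
    rwa [add_right_comm] at hx

lemma flat_lip {κ : ℝ} (hκ0 : 0 ≤ κ) (hκ1 : κ < 1) {G : ℝ → ℝ → ℝ → ℝ} (hG : Op κ G) (h0 : G 0 0 0 = 0) {v : R2 → ℝ} {e : ℝ}
    (he : 0 ≤ e) (hc : ContinuousOn v (Rc 1)) (hsol : ∀ z ∈ Ro 1, SolAt G v z) (h1 : ∀ z ∈ Rc 1, |v z| ≤ 1)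
    (h2 : ∀ z ∈ Rc 1, z.2 = 0 → |v z| ≤ e) {X Z : R2} (hX : X ∈ Rc (1/4)) (hZ : Z ∈ Rc (1/4)) (hXZ : eu (X - Z) ≤ 1/8) :
    |v X - v Z| ≤ 100 / (1 - κ) * eu (X - Z) + 2 * e := by
  have h1κ : 0 < 1 - κ := by linarith
  have hA0 : 0 ≤ 9 / (1 - κ) + 1 := by positivity
  have hm : Rc (1/2) ⊆ Rc 1 := Rc_mono (by norm_num)
  have hb : ∀ z ∈ Rc (1/2), |v z| ≤ (9 / (1 - κ) + 1) * z.2 + e := by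
    intro z hz
    have := bdry_lip hκ1 (le_refl 0) one_pos he (v := v) (by rwa [Tc_zero])
      (by rw [To_zero]; exact fun z hz => (hsol z hz).ss hG h0) (by rwa [Tc_zero])
      (by rw [Tc_zero]; intro z hz h; exact h2 z hz (by linarith)) (z := z) (by rw [Tc_zero]; exact hm hz) hz.1
    linarith
  have h11 : 1 ≤ 1 / (1 - κ) := by rw [le_div_iff₀ h1κ]; linarith
  have hinv : 9 / (1 - κ) = 9 * (1 / (1 - κ)) := by ring
  have hinv' : 100 / (1 - κ) = 100 * (1 / (1 - κ)) := by ring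
  have hcan : 100 / (1 - κ) * (1 - κ) = 100 := by field_simp
  have hm' : Rc (1/4) ⊆ Rc (1/2) := Rc_mono (by norm_num)
  have hsym : eu (Z - X) = eu (X - Z) := by
    unfold eu sq2; congr 1; simp only [Prod.fst_sub, Prod.snd_sub]; ring
  have k1 := il hκ0 hG (L := 100 / (1 - κ)) (hc.mono hm) (fun z hz => hsol z (Ro_mono (by norm_num) hz)) (fun z hz => h1 z (hm hz)) he hb hA0
    (by linarith) (by linarith) (by linarith) hX (hm' hZ) hXZ
  have k2 := il hκ0 hG (L := 100 / (1 - κ)) (hc.mono hm) (fun z hz => hsol z (Ro_mono (by norm_num) hz)) (fun z hz => h1 z (hm hz)) he hb hA0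
    (by linarith) (by linarith) (by linarith) hZ (hm' hX) (by rw [hsym]; exact hXZ)
  rw [hsym] at k2
  rw [abs_le]; constructor <;> linarith

lemma eu_horiz (a b y : ℝ) : eu ((a, y) - (b, y)) = |a - b| := by
  unfold eu sq2
  simp only [Prod.fst_sub, Prod.snd_sub, sub_self]
  rw [zero_pow two_ne_zero, add_zero, Real.sqrt_sq_eq_abs]

lemma diff_ss {κ : ℝ} (hκ0 : 0 ≤ κ) (hκ1 : κ < 1) {G : ℝ → ℝ → ℝ → ℝ} (hG : Op κ G) {v : R2 → ℝ}
    (hc : ContinuousOn v (Rc 1)) (hsol : ∀ z ∈ Ro 1, SolAt G v z) {d z : R2} (hz : z ∈ Ro 1) (hzd : z + d ∈ Ro 1) :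
    SS κ (fun x => v (x + d) - v x) z := by
  have hcd : Continuous (fun x : R2 => x + d) := by fun_prop
  have n1 : ∀ᶠ x in 𝓝 z, x ∈ Ro 1 ∧ x + d ∈ Ro 1 :=
    ((isOpen_Ro 1).inter ((isOpen_Ro 1).preimage hcd)).mem_nhds ⟨hz, hzd⟩
  obtain ⟨s', hs', hb⟩ := Metric.eventually_nhds_iff.mp n1
  obtain ⟨s, hs⟩ : ∃ s, s = s' / 2 := ⟨_, rfl⟩
  have hs0 : 0 < s := by rw [hs]; positivity
  have hb' : ∀ x ∈ closedBall z s, x ∈ Ro 1 ∧ x + d ∈ Ro 1 := by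
    intro x hx
    rw [mem_closedBall] at hx
    exact hb (by linarith)
  have c1 : ContinuousOn v (closedBall z s) := hc.mono (fun x hx => Ro_sub_Rc _ (hb' x hx).1)
  have c2 : ContinuousOn (fun x => v (x + d)) (closedBall z s) :=
    hc.comp hcd.continuousOn (fun x hx => Ro_sub_Rc _ (hb' x hx).2)
  have s1 : ∀ y ∈ ball z s, SolAt G v y := fun y hy => hsol y (hb' y (ball_subset_closedBall hy)).1
  have s2 : ∀ y ∈ ball z s, SolAt G (fun x => v (x + d)) y := fun y hy =>
    (hsol _ (hb' y (ball_subset_closedBall hy)).2).shift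
  constructor
  · exact diff_supS hκ0 hκ1 hG hs0 c1 c2 (fun y hy => (s1 y hy).1) (fun y hy => (s2 y hy).2)
  · have := diff_supS hκ0 hκ1 hG hs0 c2 c1 (fun y hy => (s2 y hy).1) (fun y hy => (s1 y hy).2)
    simpa only [neg_sub] using this

lemma flat_diff {κ : ℝ} (hκ0 : 0 ≤ κ) (hκ1 : κ < 1) : ∃ θ : ℝ, 0 < θ ∧ θ < 1 ∧ ∀ (k : ℕ) (G : ℝ → ℝ → ℝ → ℝ) (v : R2 → ℝ) (e δ : ℝ),
    Op κ G → G 0 0 0 = 0 → 0 ≤ e → 0 < δ → δ ≤ 1/8 → 2 * e ≤ δ →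
    ContinuousOn v (Rc 1) → (∀ z ∈ Ro 1, SolAt G v z) → (∀ z ∈ Rc 1, |v z| ≤ 1) →
    (∀ z ∈ Rc 1, z.2 = 0 → |v z| ≤ e) →
    ∃ b, |b| ≤ k * (8 * ((100 / (1 - κ) + 1) * (9 / (1 - κ) + 1))) ∧ ∀ x y, |x| ≤ 1/16/32^k → 0 ≤ y → y ≤ 1/16/32^k →
      |v (x + δ, y) - v (x, y) - δ * (b * y)| ≤ δ * ((1 - θ) ^ k * (8 * ((100 / (1 - κ) + 1) * (9 / (1 - κ) + 1))) * y + 2 * e / δ) := by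
  obtain ⟨θ, hθ0, hθ1, hkry⟩ := krylov_iter hκ0 hκ1
  refine ⟨θ, hθ0, hθ1, ?_⟩
  intro k G v e δ hG h0 he hδ hδ8 heδ hc hsol h1 h2
  have h1κ : 0 < 1 - κ := by linarith
  obtain ⟨N, hN⟩ : ∃ N, N = 100 / (1 - κ) + 1 := ⟨_, rfl⟩
  obtain ⟨A, hA⟩ : ∃ A, A = 9 / (1 - κ) + 1 := ⟨_, rfl⟩
  have hN0 : 0 < N := by rw [hN]; positivity
  have hA0 : 0 < A := by rw [hA]; positivity
  obtain ⟨W, hW⟩ : ∃ W : R2 → ℝ, W = fun x => (v ((1/8:ℝ) • x + (δ, 0)) - v ((1/8:ℝ) • x)) / δ := ⟨_, rfl⟩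
  have hz1 : ∀ z ∈ Rc 1, (1/8:ℝ) • z ∈ Rc (1/8) := by
    intro z hz
    have := smul_Rc (t := 1/8) (by norm_num) hz
    rwa [mul_one] at this
  have hz2 : ∀ z ∈ Rc 1, (1/8:ℝ) • z + (δ, 0) ∈ Rc (1/4) := by
    intro z hz
    obtain ⟨k1, k2, k3⟩ := hz1 z hz
    rw [abs_le] at k1
    refine ⟨?_, ?_, ?_⟩
    · rw [Prod.fst_add, abs_le]; constructor <;> simp only <;> linarith
    · rw [Prod.snd_add]; simp only; linarith
    · rw [Prod.snd_add]; simp only; linarith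
  have hoz1 : ∀ z ∈ Ro 1, (1/8:ℝ) • z ∈ Ro 1 := by
    intro z hz
    have := smul_Ro (t := 1/8) (by norm_num) hz
    exact Ro_mono (by norm_num) this
  have hoz2 : ∀ z ∈ Ro 1, (1/8:ℝ) • z + (δ, 0) ∈ Ro 1 := by
    intro z hz
    obtain ⟨k1, k2, k3⟩ := smul_Ro (t := 1/8) (by norm_num) hz
    rw [abs_lt] at k1
    refine ⟨?_, ?_, ?_⟩
    · rw [Prod.fst_add, abs_lt]; constructor <;> simp only <;> linarith
    · rw [Prod.snd_add]; simp only; linarith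
    · rw [Prod.snd_add]; simp only; linarith
  have hm8 : Rc (1/8) ⊆ Rc 1 := Rc_mono (by norm_num)
  have hm4 : Rc (1/4) ⊆ Rc 1 := Rc_mono (by norm_num)
  have cW : ContinuousOn W (Rc 1) := by
    rw [hW]
    have k1 : Continuous (fun x : R2 => (1/8:ℝ) • x + (δ, 0)) := by fun_prop
    have k2 : Continuous (fun x : R2 => (1/8:ℝ) • x) := by fun_prop
    exact ((hc.comp k1.continuousOn (fun z hz => hm4 (hz2 z hz))).sub
      (hc.comp k2.continuousOn (fun z hz => hm8 (hz1 z hz)))).div_const _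
  have sW : ∀ z ∈ Ro 1, SS κ W z := by
    intro z hz
    have e1 : ∀ x : R2, cmap 0 (1/8) 0 x = (1/8:ℝ) • x := by
      intro x; ext <;> simp [cmap]
    have k1 := diff_ss hκ0 hκ1 hG hc hsol (hoz1 z hz) (hoz2 z hz)
    rw [← e1] at k1
    have k2 := (k1.comp 0 (1/8) 0 (by norm_num)).smul_add δ⁻¹ 0 0 0 (by positivity)
    simp only [e1] at k2
    convert k2 using 2
    rw [hW]; ring
  have bW : ∀ z ∈ Rc 1, |W z| ≤ N := by
    intro z hz
    have hs : (1/8:ℝ) • z + (δ, 0) - (1/8:ℝ) • z = ((δ, 0) : R2) - (0, 0) := by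
      rw [add_sub_cancel_left]; simp
    have heu : eu ((1/8:ℝ) • z + (δ, 0) - (1/8:ℝ) • z) = δ := by
      rw [hs, eu_horiz, sub_zero, abs_of_pos hδ]
    have := flat_lip hκ0 hκ1 hG h0 he hc hsol h1 h2 (hz2 z hz) (Rc_mono (by norm_num) (hz1 z hz)) (by rw [heu]; exact hδ8)
    rw [heu] at this
    rw [hW]; simp only
    rw [abs_div, abs_of_pos hδ, div_le_iff₀ hδ, hN]
    linarith
  have botW : ∀ z ∈ Rc 1, z.2 = 0 → |W z| ≤ 2 * e / δ := by
    intro z hz hz0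
    have k1 := h2 _ (hm4 (hz2 z hz)) (by simp [hz0])
    have k2 := h2 _ (hm8 (hz1 z hz)) (by simp [hz0])
    rw [hW]; simp only
    rw [abs_div, abs_of_pos hδ]
    gcongr
    rw [abs_le] at k1 k2 ⊢
    constructor <;> linarith
  have he' : 0 ≤ 2 * e / δ := by positivity
  have linW : ∀ z ∈ Rc (1/2), |W z| ≤ N * A * z.2 + 2 * e / δ := by
    intro z hz
    have := bdry_lip hκ1 (le_refl 0) hN0 he' (v := W) (by rwa [Tc_zero])
      (by rwa [To_zero]) (by rwa [Tc_zero])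
      (by rw [Tc_zero]; intro z hz h; exact botW z hz (by linarith)) (z := z) (by rw [Tc_zero]; exact Rc_mono (by norm_num) hz) hz.1
    rw [hA]; exact this
  obtain ⟨b, hb1, hb2⟩ := hkry W (1/2) (N * A) (2 * e / δ) (by norm_num) (by positivity) he' (cW.mono (Rc_mono (by norm_num)))
    (fun z hz => sW z (Ro_mono (by norm_num) hz)) linW k
  rw [← hN, ← hA]
  refine ⟨8 * b, ?_, ?_⟩
  · rw [abs_mul, abs_of_pos (by norm_num : (0:ℝ) < 8)]; linarith
  · intro x y hx hy0 hy
    have hR : (1:ℝ)/16/32^k = 1/8 * (1/2/32^k) := by ring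
    rw [hR] at hx hy
    have k1 := hb2 (8 * x, 8 * y) ⟨by rw [abs_mul, abs_of_pos (by norm_num : (0:ℝ) < 8)]; linarith, by simp only; linarith, by simp only; linarith⟩
    have e1 : W (8 * x, 8 * y) = (v (x + δ, y) - v (x, y)) / δ := by
      rw [hW]
      simp only [Prod.smul_mk, smul_eq_mul, Prod.mk_add_mk, add_zero]
      rw [show 1 / 8 * (8 * x) = x by ring, show 1 / 8 * (8 * y) = y by ring]
    rw [e1] at k1
    simp only at k1
    have e2 : v (x + δ, y) - v (x, y) - δ * (8 * b * y) = δ * ((v (x + δ, y) - v (x, y)) / δ - b * (8 * y)) := by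
      field_simp
    rw [e2, abs_mul, abs_of_pos hδ]
    apply mul_le_mul_of_nonneg_left _ hδ.le
    linarith

lemma flat_close {κ : ℝ} (hκ1 : κ < 1) {G : ℝ → ℝ → ℝ → ℝ} (hG : Op κ G) {v : R2 → ℝ} {R E b c : ℝ}
    (hR : 0 < R) (hR1 : R ≤ 1) (hE : 0 < E) (hc : ContinuousOn v (Rc 1)) (hsol : ∀ z ∈ Ro 1, SolAt G v z)
    (hbot : ∀ z ∈ Rc 1, z.2 = 0 → |v z| ≤ E) (hbc : G 0 b (2 * c) = 0)
    (hdiff : ∀ z ∈ Rc R, |v z - v (0, z.2) - b * z.1 * z.2| ≤ E) :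
    ∀ z ∈ Rc R, |v z - ((v (0, R) - c * R ^ 2) / R * z.2 + b * z.1 * z.2 + c * z.2 ^ 2)| ≤ (6 + 2 / (1 - κ)) * E := by
  obtain ⟨a, ha⟩ : ∃ a, a = (v (0, R) - c * R ^ 2) / R := ⟨_, rfl⟩
  have haR : a * R = v (0, R) - c * R ^ 2 := by rw [ha]; field_simp
  obtain ⟨V, hV⟩ : ∃ V : R2 → ℝ, V = fun x => v x - (a * x.2 + b * x.1 * x.2 + c * x.2 ^ 2) := ⟨_, rfl⟩
  have hm := Rc_mono hR1
  have cV : ContinuousOn V (Rc R) := by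
    rw [hV]
    have : Continuous (fun x : R2 => a * x.2 + b * x.1 * x.2 + c * x.2 ^ 2) := by fun_prop
    exact (hc.mono hm).sub this.continuousOn
  have sV : ∀ z ∈ Ro R, SS κ V z := by
    intro z hz
    have k1 := hsol z (Ro_mono hR1 hz)
    have k2 := SolAt.trans (G := G) (v := v) (z := z) 0 (t := 1) (s := 1) one_pos one_pos
      (fun x => a * x.2 + b * x.1 * x.2 + c * x.2 ^ 2) 0 b (2 * c)
      ⟨b * z.2, a + b * z.1 + 2 * c * z.2, fun h => by simp only [qd, Prod.fst_add, Prod.snd_add]; ring⟩ (by simpa using k1)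
    have k3 := k2.ss (hG.trans one_pos one_pos 0 b (2 * c)) (by simpa using hbc)
    rw [hV]
    simpa using k3
  have hV0 : ∀ z : R2, V z - V (0, z.2) = v z - v (0, z.2) - b * z.1 * z.2 := by
    intro z; rw [hV]; simp only; ring
  have hVb : ∀ z ∈ Rc R, z.2 = 0 → V z = v z := by
    intro z _ h; rw [hV]; simp only [h]; ring
  have hVt : ∀ z ∈ Rc R, z.2 = R → |V z| ≤ E := by
    intro z hz h
    have k1 := hdiff z hz
    rw [← hV0] at k1
    have : V (0, z.2) = 0 := by rw [hV, h]; simp only; linarith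
    rwa [this, sub_zero] at k1
  have hVbb : ∀ z ∈ Rc R, z.2 = 0 → |V z| ≤ E := by
    intro z hz h
    rw [hVb z hz h]; exact hbot z (hm hz) h
  have hVl : ∀ z ∈ Rc R, |V z - V (0, z.2)| ≤ E := by
    intro z hz; rw [hV0]; exact hdiff z hz
  have u1 := flat_barrier hκ1 hR hE cV (fun z hz => (sV z hz).2) (fun z hz h => (abs_le.mp (hVbb z hz h)).2)
    (fun z hz h => (abs_le.mp (hVt z hz h)).2) (fun z hz => by linarith [(abs_le.mp (hVl z hz)).2])
  have u2 := flat_barrier hκ1 hR hE (V := fun x => -V x) cV.neg (fun z hz => by simpa using (sV z hz).1)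
    (fun z hz h => by linarith [(abs_le.mp (hVbb z hz h)).1])
    (fun z hz h => by linarith [(abs_le.mp (hVt z hz h)).1]) (fun z hz => by linarith [(abs_le.mp (hVl z hz)).1])
  intro z hz
  rw [← ha]
  have k1 := u1 z hz
  have k2 := u2 z hz
  have k3 : V z = v z - (a * z.2 + b * z.1 * z.2 + c * z.2 ^ 2) := by rw [hV]
  rw [← k3, abs_le]
  constructor <;> linarith

theorem flat {κ : ℝ} (hκ0 : 0 ≤ κ) (hκ1 : κ < 1) : ∃ R C e : ℝ, 0 < R ∧ R ≤ 1/2 ∧ 0 < C ∧ 0 < e ∧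
    ∀ (G : ℝ → ℝ → ℝ → ℝ) (v : R2 → ℝ), Op κ G → G 0 0 0 = 0 →
    ContinuousOn v (Rc 1) → (∀ z ∈ Ro 1, SolAt G v z) → (∀ z ∈ Rc 1, |v z| ≤ 1) →
    (∀ z ∈ Rc 1, z.2 = 0 → |v z| ≤ e) →
    ∃ a b c, |a| ≤ C ∧ |b| ≤ C ∧ |c| ≤ C ∧ G 0 b (2 * c) = 0 ∧
      ∀ z ∈ Rc R, |v z - (a * z.2 + b * z.1 * z.2 + c * z.2 ^ 2)| ≤ R ^ 2 / 16 := by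
  obtain ⟨θ, hθ0, hθ1, hfd⟩ := flat_diff hκ0 hκ1
  have h1κ : 0 < 1 - κ := by linarith
  obtain ⟨L, hL⟩ : ∃ L, L = 100 / (1 - κ) := ⟨_, rfl⟩
  have hL0 : 0 < L := by rw [hL]; positivity
  obtain ⟨m, hm⟩ : ∃ m, m = 8 * ((100 / (1 - κ) + 1) * (9 / (1 - κ) + 1)) := ⟨_, rfl⟩
  have hm0 : 0 < m := by rw [hm]; positivity
  obtain ⟨B, hB⟩ : ∃ B, B = 6 + 2 / (1 - κ) := ⟨_, rfl⟩
  have hB6 : 6 ≤ B := by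
    rw [hB]; have : 0 < 2 / (1 - κ) := by positivity
    linarith
  have hB0 : 0 < B := by linarith
  obtain ⟨k, hk⟩ := exists_pow_lt_of_lt_one (show 0 < 1 / (64 * m * B) by positivity) (show 1 - θ < 1 by linarith)
  obtain ⟨R, hRd⟩ : ∃ R : ℝ, R = 1 / 16 / 32 ^ k := ⟨_, rfl⟩
  have hR0 : 0 < R := by rw [hRd]; positivity
  have hR16 : R ≤ 1 / 16 := by rw [hRd]; exact div_le_self (by norm_num) (one_le_pow₀ (by norm_num))
  obtain ⟨μ, hμ⟩ : ∃ μ, μ = (1 - θ) ^ k * m := ⟨_, rfl⟩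
  have h1θ : 0 < 1 - θ := by linarith
  have hμ0 : 0 < μ := by rw [hμ]; positivity
  have hμB : B * μ ≤ 1 / 64 := by
    rw [hμ]
    rw [lt_div_iff₀ (by positivity)] at hk
    linarith
  obtain ⟨D, hD⟩ : ∃ D : ℝ, D = L + k * m + 1 := ⟨_, rfl⟩
  have hD1 : 1 ≤ D := by rw [hD]; have : 0 ≤ k * m := by positivity
                         linarith
  obtain ⟨δ, hδ⟩ : ∃ δ, δ = R ^ 2 / (64 * B * D) := ⟨_, rfl⟩
  have hδ0 : 0 < δ := by rw [hδ]; positivity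
  have hδe : B * (D * δ) = R ^ 2 / 64 := by rw [hδ]; field_simp
  have hBD : 1 ≤ B * D := by
    have := mul_le_mul hB6 hD1 (by norm_num) hB0.le
    linarith
  have hRR : R ^ 2 ≤ R * (1/16) := by rw [sq]; gcongr
  have hδR : δ ≤ R ^ 2 / 64 := by
    have : 1 * δ ≤ (B * D) * δ := by gcongr
    linarith
  obtain ⟨e, he⟩ : ∃ e, e = δ * R / (256 * B) := ⟨_, rfl⟩
  have he0 : 0 < e := by rw [he]; positivity
  have heB : B * e = δ * R / 256 := by rw [he]; field_simp
  have heB2 : B * (R * (2 * e / δ)) = R ^ 2 / 128 := by rw [he]; field_simp; ring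
  have hδR2 : δ * R ≤ δ * 1 := by gcongr; linarith
  have hBe : 6 * e ≤ B * e := by gcongr
  have hR2 : 0 < R ^ 2 := by positivity
  obtain ⟨Cc, hCc⟩ : ∃ Cc, Cc = (k * m) / (1 - κ) := ⟨_, rfl⟩
  have hCc0 : 0 ≤ Cc := by rw [hCc]; positivity
  have hkm : 0 ≤ k * m := by positivity
  refine ⟨R, k * m + Cc + (1 + Cc) / R, e, hR0, by linarith, by positivity, he0, ?_⟩
  intro G v hG h0 hc hsol h1 h2
  obtain ⟨b, hb1, hb2⟩ := hfd k G v e δ hG h0 he0.le hδ0 (by linarith) (by linarith) hc hsol h1 h2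
  rw [← hm] at hb1 hb2
  rw [← hRd, ← hμ] at hb2
  obtain ⟨t, ht1, ht2⟩ := hG.root hκ0 hκ1 0 0 0 0 b 0 0 1 h0 le_rfl zero_le_one (by norm_num)
  have hdb : dev 0 b 0 ≤ 2 * |b| := by simpa using dev_le 0 b 0
  have ht3 : |t| * (1 - κ) ≤ 2 * |b| := by
    have : κ * dev 0 b 0 ≤ 1 * dev 0 b 0 := by
      gcongr; exact dev_nonneg _ _ _
    simp only [add_zero, abs_zero, zero_add, one_mul] at ht2
    linarith
  obtain ⟨c, hcd⟩ : ∃ c, c = t / 2 := ⟨_, rfl⟩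
  have hcC : |c| ≤ Cc := by
    rw [hcd, hCc, abs_div, abs_of_pos (by norm_num : (0:ℝ) < 2), le_div_iff₀ h1κ]
    linarith
  have hG0 : G 0 b (2 * c) = 0 := by
    have : 2 * c = t := by rw [hcd]; ring
    rw [this]; simpa using ht1
  obtain ⟨E, hE⟩ : ∃ E, E = R * (μ * R + 2 * e / δ) + (L * δ + 2 * e) + δ * |b| * R := ⟨_, rfl⟩
  have hE0 : 2 * e ≤ E := by
    rw [hE]
    have : 0 ≤ R * (μ * R + 2 * e / δ) := by positivity
    have : 0 ≤ L * δ := by positivity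
    have : 0 ≤ δ * |b| * R := by positivity
    linarith
  have hBE : B * E ≤ R ^ 2 / 16 := by
    have k1 : B * μ * R ^ 2 ≤ 1 / 64 * R ^ 2 := by gcongr
    have k2 : δ * |b| * R ≤ δ * (k * m) * 1 := by gcongr; linarith
    have k3 : L * δ + δ * (k * m) * 1 ≤ D * δ := by rw [hD]; linarith
    have k4 : B * (L * δ + δ * |b| * R) ≤ B * (D * δ) := by gcongr; linarith
    have k5 : B * E = B * μ * R ^ 2 + B * (R * (2 * e / δ)) + B * (L * δ + δ * |b| * R) + 2 * (B * e) := by rw [hE]; ring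
    rw [k5, heB2, heB]
    linarith
  have hs : ∀ y, 0 ≤ y → y ≤ R → ∀ x x', |x| ≤ R → |x'| ≤ R → |x' - x| ≤ δ → |v (x', y) - v (x, y)| ≤ L * δ + 2 * e := by
    intro y hy0 hy x x' hx hx' hxx
    have := flat_lip hκ0 hκ1 hG h0 he0.le hc hsol h1 h2 (X := (x', y)) (Z := (x, y)) ⟨by simp only; linarith, hy0, by simp only; linarith⟩
      ⟨by simp only; linarith, hy0, by simp only; linarith⟩ (by rw [eu_horiz]; linarith)
    rw [eu_horiz, ← hL] at this
    have : L * |x' - x| ≤ L * δ := by gcongr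
    linarith
  have hdiff : ∀ z ∈ Rc R, |v z - v (0, z.2) - b * z.1 * z.2| ≤ E := by
    rintro ⟨x, y⟩ ⟨hx, hy0, hy⟩
    simp only at hx hy0 hy ⊢
    have he' : 0 ≤ 2 * e / δ := by positivity
    rcases le_total 0 x with hx0 | hx0
    · have := diff_total hδ0 hy0 hy hμ0.le he' (fun x hx => hb2 x y hx hy0 hy) (hs y hy0 hy) (x := 0) (x' := x)
        (by linarith) hx0 (abs_le.mp hx).2 (by linarith [(abs_le.mp hx).2])
      rw [sub_zero] at this
      rw [hE]; exact this
    · have := diff_total hδ0 hy0 hy hμ0.le he' (fun x hx => hb2 x y hx hy0 hy) (hs y hy0 hy) (x := x) (x' := 0)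
        (abs_le.mp hx).1 hx0 hR0.le (by linarith [(abs_le.mp hx).1])
      rw [← abs_neg, hE]
      convert this using 2
      ring
  have hfin := flat_close hκ1 hG hR0 (by linarith) (by linarith : 0 < E) hc hsol (fun z hz h => (h2 z hz h).trans (by linarith)) hG0 hdiff
  rw [← hB] at hfin
  have hX : 0 ≤ (1 + Cc) / R := by positivity
  refine ⟨(v (0, R) - c * R ^ 2) / R, b, c, ?_, by linarith, by linarith, hG0, fun z hz => (hfin z hz).trans hBE⟩
  have k1 : |(v (0, R) - c * R ^ 2) / R| ≤ (1 + Cc) / R := by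
    rw [abs_div, abs_of_pos hR0]
    gcongr
    have k2 := h1 (0, R) ⟨by simp, hR0.le, by simp only; linarith⟩
    have k3 : |c * R ^ 2| ≤ Cc * 1 := by
      rw [abs_mul, abs_of_pos hR2]
      gcongr; linarith
    have := abs_sub (v (0, R)) (c * R ^ 2)
    linarith
  linarith

/-- the approximating polynomials adapted to the curved boundary -/
def qp (r a b c : ℝ) (z : R2) : ℝ := a * (z.2 - r / 2 * (z.1 ^ 2 + z.2 ^ 2)) + b * z.1 * z.2 + c * z.2 ^ 2

theorem onestep {κ : ℝ} (hκ0 : 0 ≤ κ) (hκ1 : κ < 1) : ∃ ρ C r1 e1 : ℝ, 0 < ρ ∧ ρ ≤ 1/4 ∧ 0 < C ∧ 0 < r1 ∧ r1 ≤ 1/4 ∧ 0 < e1 ∧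
    ∀ (G : ℝ → ℝ → ℝ → ℝ) (v : R2 → ℝ) (r : ℝ), Op κ G → G 0 0 0 = 0 → 0 ≤ r → r ≤ r1 →
    ContinuousOn v (Tc r) → (∀ z ∈ To r, SolAt G v z) → (∀ z ∈ Tc r, |v z| ≤ 1) →
    (∀ z ∈ Tc r, r * (z.1 ^ 2 + z.2 ^ 2) = 2 * z.2 → |v z| ≤ e1) →
    ∃ a b c, |a| ≤ C ∧ |b| ≤ C ∧ |c| ≤ C ∧ G (-(a * r)) b (2 * c - a * r) = 0 ∧
      ∀ z ∈ Tc r, |z.1| ≤ ρ → z.2 ≤ ρ → |v z - qp r a b c z| ≤ ρ ^ 2 / 2 := by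
  obtain ⟨R, C0, e0, hR0, hR1, hC0, he0, hfl⟩ := flat hκ0 hκ1
  have h1κ : 0 < 1 - κ := by linarith
  obtain ⟨K, hK⟩ : ∃ K, K = 1 / (1 - κ) := ⟨_, rfl⟩
  have hK1 : 1 ≤ K := by rw [hK, le_div_iff₀ h1κ]; linarith
  have hKκ : K * (1 - κ) = 1 := by rw [hK]; field_simp
  obtain ⟨A, hA⟩ : ∃ A, A = 9 / (1 - κ) + 1 := ⟨_, rfl⟩
  have hA0 : 0 < A := by rw [hA]; positivity
  obtain ⟨ρ, hρ⟩ : ∃ ρ, ρ = R / 2 := ⟨_, rfl⟩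
  have hρ0 : 0 < ρ := by rw [hρ]; positivity
  have hρ2 : 0 < ρ ^ 2 := by positivity
  have hCK : C0 ≤ C0 * K := le_mul_of_one_le_right hC0.le hK1
  have hK0 : 0 < K := by linarith
  obtain ⟨D, hD⟩ : ∃ D, D = 12 * C0 * K + A + 1 := ⟨_, rfl⟩
  have hD0 : 0 < D := by rw [hD]; positivity
  obtain ⟨ε, hε⟩ : ∃ ε, ε = min (min (ρ ^ 2 / 8) (e0 / 2)) (1/4) := ⟨_, rfl⟩
  have hε0 : 0 < ε := by rw [hε]; positivity
  have hε1 : ε ≤ ρ ^ 2 / 8 := by rw [hε]; exact (min_le_left _ _).trans (min_le_left _ _)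
  have hε2 : ε ≤ e0 / 2 := by rw [hε]; exact (min_le_left _ _).trans (min_le_right _ _)
  have hε3 : ε ≤ 1 / 4 := by rw [hε]; exact min_le_right _ _
  have hDr : D * (ε / D) = ε := by field_simp
  refine ⟨ρ, 6 * C0 * K, ε / D, ε, hρ0, by linarith, by positivity, by positivity, ?_, hε0, ?_⟩
  · have : ε / D ≤ ε := div_le_self hε0.le (by rw [hD]; have : 0 < 12 * C0 * K := by positivity
                                               linarith)
    linarith
  intro G v r hG h0 hr hr1 hc hsol h1 h2
  have hDr' : D * r ≤ ε := by rw [← hDr]; gcongr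
  have hCr : 0 ≤ C0 * K * r := by positivity
  have hAr : 0 ≤ A * r := by positivity
  rw [hD] at hDr'
  have hr4 : r ≤ 1 / 4 := by linarith
  -- Lipschitz estimate
  have hlip : ∀ z ∈ Tc r, |z.1| ≤ 1 / 2 → |v z| ≤ A * z.2 + ε := by
    intro z hz hz1
    have := bdry_lip hκ1 hr one_pos hε0.le hc (fun z hz => (hsol z hz).ss hG h0) h1 h2 hz hz1
    rw [hA]; linarith
  -- domain inclusion
  have hx2 : ∀ x : ℝ, |x| ≤ 1 → x ^ 2 ≤ 1 := by
    intro x hx; rw [← sq_abs]; exact pow_le_one₀ (abs_nonneg x) hx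
  have hsum : ∀ z : R2, |z.1| ≤ 1 → 0 ≤ z.2 → z.2 ≤ 1 → (1 / 2 * z.1) ^ 2 + (r + 1 / 2 * z.2) ^ 2 ≤ 5 / 4 := by
    intro z k1 k2 k3
    have m1 := hx2 z.1 k1
    have m2 : (r + 1 / 2 * z.2) ^ 2 ≤ 1 := pow_le_one₀ (by positivity) (by linarith)
    linarith
  have hin : ∀ z ∈ Rc 1, ((0, r) : R2) + (1/2 : ℝ) • z ∈ Tc r := by
    rintro z ⟨k1, k2, k3⟩
    refine ⟨?_, ?_, ?_⟩
    · simp only [Prod.fst_add, Prod.smul_fst, smul_eq_mul, zero_add]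
      rw [abs_mul, abs_of_pos (by norm_num)]; linarith
    · simp only [Prod.snd_add, Prod.smul_snd, smul_eq_mul]; linarith
    · simp only [Prod.fst_add, Prod.smul_fst, smul_eq_mul, zero_add, Prod.snd_add, Prod.smul_snd]
      have := mul_le_mul_of_nonneg_left (hsum z k1 k2 k3) hr
      linarith
  have hino : ∀ z ∈ Ro 1, ((0, r) : R2) + (1/2 : ℝ) • z ∈ To r := by
    rintro z ⟨k1, k2, k3⟩
    refine ⟨?_, ?_, ?_⟩
    · simp only [Prod.fst_add, Prod.smul_fst, smul_eq_mul, zero_add]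
      rw [abs_mul, abs_of_pos (by norm_num)]; linarith
    · simp only [Prod.snd_add, Prod.smul_snd, smul_eq_mul]; linarith
    · simp only [Prod.fst_add, Prod.smul_fst, smul_eq_mul, zero_add, Prod.snd_add, Prod.smul_snd]
      have := mul_le_mul_of_nonneg_left (hsum z k1.le k2.le k3.le) hr
      linarith
  obtain ⟨a0, b0, c0, ha0, hb0, hc0, hG0, happ⟩ := hfl
    (fun p q s => G ((1 * p + 0) / (1/2) ^ 2) ((1 * q + 0) / (1/2) ^ 2) ((1 * s + 0) / (1/2) ^ 2))
    (fun x => (v ((0, r) + (1/2 : ℝ) • x) - 0) / 1) (hG.trans (by norm_num) one_pos 0 0 0) (by simpa using h0)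
    (by
      have k1 : Continuous (fun x : R2 => ((0, r) : R2) + (1/2 : ℝ) • x) := by fun_prop
      exact ((hc.comp k1.continuousOn hin).sub continuousOn_const).div_const _)
    (fun z hz => SolAt.trans (0, r) (by norm_num) one_pos (fun _ => 0) 0 0 0 ⟨0, 0, fun h => by simp [qd]⟩ (hsol _ (hino z hz)))
    (fun z hz => by simpa using h1 _ (hin z hz))
    (by
      intro z hz hz0
      have := hlip _ (hin z hz) (by
        simp only [Prod.fst_add, Prod.smul_fst, smul_eq_mul, zero_add]
        rw [abs_mul, abs_of_pos (by norm_num)]; linarith [hz.1])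
      simp only [Prod.snd_add, Prod.smul_snd, smul_eq_mul, hz0, mul_zero, add_zero] at this
      simp only [sub_zero, div_one]
      linarith)
  simp only [sub_zero, div_one, add_zero, one_mul, zero_div] at hG0 happ
  have hG0' : G 0 (4 * b0) (8 * c0) = 0 := by
    rw [← hG0]; congr 1 <;> ring
  obtain ⟨a, ha⟩ : ∃ a, a = 2 * a0 := ⟨_, rfl⟩
  have haC : |a| ≤ 2 * C0 := by rw [ha, abs_mul, abs_of_pos (by norm_num : (0:ℝ) < 2)]; linarith
  obtain ⟨t, ht1, ht2⟩ := hG.root hκ0 hκ1 0 (4 * b0) (8 * c0) (-(a * r)) 0 (-(a * r)) 0 1 hG0' le_rfl zero_le_one (by norm_num)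
  have ht3 : |t| ≤ 4 * (C0 * K * r) := by
    rw [dev_diag, sub_self, abs_zero, mul_zero, add_zero, zero_add, one_mul, ← two_mul, abs_mul, abs_neg, abs_mul,
      abs_of_pos (by norm_num : (0:ℝ) < 2), abs_of_nonneg hr] at ht2
    have k1 : |t| = K * (|t| * (1 - κ)) := by linear_combination -|t| * hKκ
    rw [k1]
    have k2 : |a| * r ≤ 2 * C0 * r := by gcongr
    calc K * (|t| * (1 - κ)) ≤ K * (2 * (2 * C0 * r)) := mul_le_mul_of_nonneg_left (by linarith) hK0.le
      _ = _ := by ring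
  obtain ⟨b, hb⟩ : ∃ b, b = 4 * b0 := ⟨_, rfl⟩
  have hbC : |b| ≤ 4 * C0 := by rw [hb, abs_mul, abs_of_pos (by norm_num : (0:ℝ) < 4)]; linarith
  obtain ⟨c, hcd⟩ : ∃ c, c = 4 * c0 + t / 2 := ⟨_, rfl⟩
  have hCKr : C0 * K * r ≤ C0 * K := by
    have : C0 * K * r ≤ C0 * K * 1 := by gcongr; linarith
    linarith
  have hcC : |c| ≤ 6 * (C0 * K) := by
    rw [abs_le] at hc0 ht3 ⊢; rw [hcd]
    constructor <;> linarith
  refine ⟨a, b, c, by linarith, by linarith, by linarith, ?_, ?_⟩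
  · rw [← ht1, hb, hcd]; congr 1 <;> ring
  intro z hz hz1 hz2
  have hzy := Tc_nonneg hr hz
  have hsq : z.1 ^ 2 + z.2 ^ 2 ≤ 2 := by
    have m1 := hx2 z.1 (by linarith)
    have m2 := hx2 z.2 (by rw [abs_of_nonneg hzy]; linarith)
    linarith
  have hsq0 : 0 ≤ z.1 ^ 2 + z.2 ^ 2 := by positivity
  have hC0r : C0 * r ≤ C0 * K * r := by gcongr
  rcases le_total r z.2 with hyr | hyr
  · have k1 := happ (2 * z.1, 2 * (z.2 - r)) ⟨by
      rw [abs_mul, abs_of_pos (by norm_num : (0:ℝ) < 2)]; linarith, by simp only; linarith, by simp only; linarith⟩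
    have e1 : ((0, r) : R2) + (1/2 : ℝ) • ((2 * z.1, 2 * (z.2 - r)) : R2) = z := by
      ext
      · simp
      · simp
    rw [e1] at k1
    simp only at k1
    have k2 : |a * (r - r / 2 * (z.1 ^ 2 + z.2 ^ 2))| ≤ 2 * C0 * r := by
      rw [abs_mul]
      have m1 : r * (z.1 ^ 2 + z.2 ^ 2) ≤ r * 2 := by gcongr
      have m2 : 0 ≤ r * (z.1 ^ 2 + z.2 ^ 2) := by positivity
      gcongr
      rw [abs_le]; constructor <;> linarith
    have k3 : |b * z.1 * r| ≤ 4 * C0 * 1 * r := by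
      rw [abs_mul, abs_mul, abs_of_nonneg hr]; gcongr; linarith
    have k4 : |4 * c0 * (2 * z.2 * r - r ^ 2)| ≤ 4 * C0 * r := by
      rw [abs_mul, abs_mul, abs_of_pos (by norm_num : (0:ℝ) < 4)]
      have m1 : 2 * z.2 * r ≤ 1 * r := by gcongr; linarith
      have m2 : r * r ≤ 2 * z.2 * r := by gcongr; linarith
      gcongr
      rw [abs_le]; constructor <;> linarith [sq_nonneg r]
    have k5 : |t / 2 * z.2 ^ 2| ≤ 2 * (C0 * K * r) * 1 := by
      rw [abs_mul, abs_div, abs_of_pos (by norm_num : (0:ℝ) < 2), abs_of_nonneg (sq_nonneg z.2)]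
      gcongr
      · linarith
      · exact hx2 z.2 (by rw [abs_of_nonneg hzy]; linarith)
    have k6 : v z - qp r a b c z = (v z - (a0 * (2 * (z.2 - r)) + b0 * (2 * z.1) * (2 * (z.2 - r)) + c0 * (2 * (z.2 - r)) ^ 2))
        - a * (r - r / 2 * (z.1 ^ 2 + z.2 ^ 2)) - b * z.1 * r - 4 * c0 * (2 * z.2 * r - r ^ 2) - t / 2 * z.2 ^ 2 := by
      unfold qp; rw [ha, hb, hcd]; ring
    rw [k6]
    have hRρ : R ^ 2 / 16 = ρ ^ 2 / 4 := by rw [hρ]; ring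
    rw [hRρ] at k1
    rw [abs_le] at k1 k2 k3 k4 k5 ⊢
    constructor <;> linarith
  · have k1 := hlip z hz (by linarith)
    have k1' : A * z.2 ≤ A * r := by gcongr
    have k2 : |a * (z.2 - r / 2 * (z.1 ^ 2 + z.2 ^ 2))| ≤ 2 * C0 * r := by
      rw [abs_mul]
      have m1 := hz.2.2
      have m2 : 0 ≤ r * (z.1 ^ 2 + z.2 ^ 2) := by positivity
      gcongr
      rw [abs_le]; constructor <;> linarith
    have k3 : |b * z.1 * z.2| ≤ 4 * C0 * 1 * r := by
      rw [abs_mul, abs_mul, abs_of_nonneg hzy]; gcongr; linarith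
    have k4 : |c * z.2 ^ 2| ≤ 6 * (C0 * K) * r := by
      rw [abs_mul, abs_of_nonneg (sq_nonneg z.2)]
      have : z.2 ^ 2 ≤ 1 * r := by rw [sq]; gcongr; linarith
      gcongr
      linarith
    unfold qp
    rw [abs_le] at k1 k2 k3 k4 ⊢
    constructor <;> linarith

structure ItInv (G : ℝ → ℝ → ℝ → ℝ) (v : R2 → ℝ) (r ρ C : ℝ) (k : ℕ) (a b c : ℝ) : Prop where
  root : G (-(a * r)) b (2 * c - a * r) = 0
  hb : |b| ≤ 2 * C * (1 - (1/2) ^ k)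
  hc : |c| ≤ 2 * C * (1 - (1/2) ^ k)
  app : ∀ z ∈ Tc r, |z.1| ≤ ρ ^ k → z.2 ≤ ρ ^ k → |v z - qp r a b c z| ≤ (ρ ^ 2 / 2) ^ k

lemma qp_scale (r a b c t s a' b' c' : ℝ) (ht : 0 < t) (z : R2) :
    qp r a b c z + s * qp (r * t) a' b' c' (t⁻¹ • z) = qp r (a + s / t * a') (b + s / t ^ 2 * b') (c + s / t ^ 2 * c') z := by
  simp only [qp, Prod.smul_fst, Prod.smul_snd, smul_eq_mul]
  field_simp
  ring

lemma qp_bdry {r a b c B : ℝ} (hr : 0 ≤ r) (hb : |b| ≤ B) (hc : |c| ≤ B) {t : ℝ} (ht : 0 < t) {z : R2} (hz : z ∈ Tc (r * t))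
    (hzb : r * t * (z.1 ^ 2 + z.2 ^ 2) = 2 * z.2) : |qp r a b c (t • z)| ≤ 2 * B * r * t ^ 3 := by
  have hB : 0 ≤ B := (abs_nonneg b).trans hb
  have hy := Tc_nonneg (by positivity) hz
  obtain ⟨z1, z2, -⟩ := hz
  have m1 : z.1 ^ 2 ≤ 1 := by rw [← sq_abs]; exact pow_le_one₀ (abs_nonneg _) z1
  have m2 : z.2 ^ 2 ≤ 1 := pow_le_one₀ hy z2
  have hyr : z.2 ≤ r * t := by
    have : r * t * (z.1 ^ 2 + z.2 ^ 2) ≤ r * t * 2 := by gcongr; linarith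
    linarith
  have e1 : qp r a b c (t • z) = t ^ 2 * (b * z.1 * z.2) + t ^ 2 * (c * z.2 * z.2) := by
    simp only [qp, Prod.smul_fst, Prod.smul_snd, smul_eq_mul]
    linear_combination (-(a * t) / 2) * hzb
  have k1 : |b * z.1 * z.2| ≤ B * 1 * (r * t) := by
    rw [abs_mul, abs_mul, abs_of_nonneg hy]; gcongr
  have k2 : |c * z.2 * z.2| ≤ B * 1 * (r * t) := by
    rw [abs_mul, abs_mul, abs_of_nonneg hy]; gcongr
  rw [e1, ← mul_add, abs_mul, abs_of_pos (by positivity : 0 < t ^ 2)]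
  calc t ^ 2 * |b * z.1 * z.2 + c * z.2 * z.2| ≤ t ^ 2 * (B * 1 * (r * t) + B * 1 * (r * t)) := by
        gcongr; exact (abs_add_le _ _).trans (add_le_add k1 k2)
    _ = _ := by ring

lemma iter_step {κ ρ C r1 e1 : ℝ} (hρ0 : 0 < ρ) (hρ4 : ρ ≤ 1/4) (hC : 0 < C) (he1 : 0 < e1)
    (hos : ∀ (G : ℝ → ℝ → ℝ → ℝ) (v : R2 → ℝ) (r : ℝ), Op κ G → G 0 0 0 = 0 → 0 ≤ r → r ≤ r1 →
      ContinuousOn v (Tc r) → (∀ z ∈ To r, SolAt G v z) → (∀ z ∈ Tc r, |v z| ≤ 1) →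
      (∀ z ∈ Tc r, r * (z.1 ^ 2 + z.2 ^ 2) = 2 * z.2 → |v z| ≤ e1) →
      ∃ a b c, |a| ≤ C ∧ |b| ≤ C ∧ |c| ≤ C ∧ G (-(a * r)) b (2 * c - a * r) = 0 ∧
        ∀ z ∈ Tc r, |z.1| ≤ ρ → z.2 ≤ ρ → |v z - qp r a b c z| ≤ ρ ^ 2 / 2)
    {G : ℝ → ℝ → ℝ → ℝ} {v : R2 → ℝ} {r : ℝ} (hG : Op κ G) (hr : 0 ≤ r) (hr1 : r ≤ r1) (hrC : 4 * C * r ≤ e1 / 2)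
    (hc : ContinuousOn v (Tc r)) (hsol : ∀ z ∈ To r, SolAt G v z)
    (hbd : ∀ (k : ℕ), ∀ z ∈ Tc r, r * (z.1 ^ 2 + z.2 ^ 2) = 2 * z.2 → |z.1| ≤ ρ ^ k → z.2 ≤ ρ ^ k → |v z| ≤ e1 / 2 * (ρ ^ 2 / 2) ^ k)
    {k : ℕ} {a b c : ℝ} (hI : ItInv G v r ρ C k a b c) :
    ∃ a' b' c', ItInv G v r ρ C (k + 1) a' b' c' ∧ |a' - a| ≤ C * (ρ / 2) ^ k ∧ |b' - b| ≤ C * (1/2) ^ k ∧ |c' - c| ≤ C * (1/2) ^ k := by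
  obtain ⟨t, ht⟩ : ∃ t, t = ρ ^ k := ⟨_, rfl⟩
  obtain ⟨s, hs⟩ : ∃ s, s = (ρ ^ 2 / 2) ^ k := ⟨_, rfl⟩
  have ht0 : 0 < t := by rw [ht]; positivity
  have hs0 : 0 < s := by rw [hs]; positivity
  have ht1 : t ≤ 1 := by rw [ht]; exact pow_le_one₀ hρ0.le (by linarith)
  have hst : s / t = (ρ / 2) ^ k := by
    rw [hs, ht, ← div_pow]; congr 1; field_simp
  have hst2 : s / t ^ 2 = (1 / 2) ^ k := by
    rw [hs, ht, ← pow_mul, mul_comm k 2, pow_mul, ← div_pow]; congr 1; field_simp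
  have ht3 : t ^ 3 ≤ s := by
    rw [hs, ht, ← pow_mul, mul_comm k 3, pow_mul]
    apply pow_le_pow_left₀ (by positivity)
    have : ρ ^ 2 * ρ ≤ ρ ^ 2 * (1/4) := by gcongr
    have := sq_nonneg ρ
    linarith
  have hin : ∀ z ∈ Tc (r * t), t • z ∈ Tc r ∧ |(t • z).1| ≤ t ∧ (t • z).2 ≤ t := by
    rintro z ⟨z1, z2, z3⟩
    simp only [Prod.smul_fst, Prod.smul_snd, smul_eq_mul]
    have k1 : |t * z.1| ≤ t := by
      rw [abs_mul, abs_of_pos ht0]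
      calc t * |z.1| ≤ t * 1 := by gcongr
        _ = t := mul_one t
    have k2 : t * z.2 ≤ t := by
      calc t * z.2 ≤ t * 1 := by gcongr
        _ = t := mul_one t
    refine ⟨⟨?_, ?_, ?_⟩, k1, k2⟩
    · simp only [Prod.smul_fst, smul_eq_mul]; linarith
    · simp only [Prod.smul_snd, smul_eq_mul]; linarith
    · simp only [Prod.smul_fst, Prod.smul_snd, smul_eq_mul]
      have := mul_le_mul_of_nonneg_left z3 ht0.le
      linarith
  have hino : ∀ z ∈ To (r * t), t • z ∈ To r := by
    rintro z ⟨z1, z2, z3⟩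
    refine ⟨?_, ?_, ?_⟩
    · simp only [Prod.smul_fst, smul_eq_mul]
      rw [abs_mul, abs_of_pos ht0]
      have : t * |z.1| ≤ 1 * |z.1| := by gcongr
      linarith
    · simp only [Prod.smul_snd, smul_eq_mul]
      have : t * z.2 < t * 1 := by gcongr
      linarith
    · simp only [Prod.smul_fst, Prod.smul_snd, smul_eq_mul]
      have := mul_lt_mul_of_pos_left z3 ht0
      linarith
  have hbC : |b| ≤ 2 * C ∧ |c| ≤ 2 * C := by
    have h2 : (0:ℝ) < (1/2) ^ k := by positivity
    have h3 : 2 * C * (1 - (1/2) ^ k) ≤ 2 * C * 1 := by gcongr; linarith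
    have := hI.hb
    have := hI.hc
    constructor <;> linarith
  have hcan : ∀ x : ℝ, t ^ 2 * x / t ^ 2 = x := by intro x; field_simp
  obtain ⟨a', b', c', ha', hb', hc', hroot, happ⟩ := hos
    (fun p q w => G ((s * p + t ^ 2 * (-(a * r))) / t ^ 2) ((s * q + t ^ 2 * b) / t ^ 2) ((s * w + t ^ 2 * (2 * c - a * r)) / t ^ 2))
    (fun x => (v (0 + t • x) - qp r a b c (t • x)) / s) (r * t) (hG.trans ht0 hs0 _ _ _)
    (by simp only [mul_zero, zero_add, hcan]; exact hI.root) (by positivity)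
    (by
      have : r * t ≤ r * 1 := by gcongr
      linarith)
    (by
      have k1 : Continuous (fun x : R2 => 0 + t • x) := by fun_prop
      have k2 : Continuous (fun x : R2 => qp r a b c (t • x)) := by unfold qp; fun_prop
      exact ((hc.comp k1.continuousOn (fun z hz => by rw [zero_add]; exact (hin z hz).1)).sub k2.continuousOn).div_const _)
    (fun z hz => SolAt.trans 0 ht0 hs0 (fun x => qp r a b c (t • x)) _ _ _ ⟨-(a * r) * t ^ 2 * z.1 + b * t ^ 2 * z.2,
      a * t - a * r * t ^ 2 * z.2 + b * t ^ 2 * z.1 + 2 * c * t ^ 2 * z.2, fun h => by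
        simp only [qp, qd, Prod.smul_fst, Prod.smul_snd, smul_eq_mul, Prod.fst_add, Prod.snd_add]; ring⟩
      (by rw [zero_add]; exact hsol _ (hino z hz)))
    (by
      intro z hz
      obtain ⟨k1, k2, k3⟩ := hin z hz

      have := hI.app _ (hin z hz).1 (k2.trans ht.le) (k3.trans ht.le)
      rw [← hs] at this
      rw [zero_add, abs_div, abs_of_pos hs0, div_le_one hs0]
      exact this)
    (by
      intro z hz hzb
      obtain ⟨k1, k2, k3⟩ := hin z hz

      have m1 := hbd k _ (hin z hz).1 (by
        simp only [Prod.smul_fst, Prod.smul_snd, smul_eq_mul]; linear_combination t * hzb) (k2.trans ht.le) (k3.trans ht.le)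
      rw [← hs] at m1
      have m2 := qp_bdry (a := a) hr hbC.1 hbC.2 ht0 hz hzb
      have m3 : 4 * C * r * t ^ 3 ≤ e1 / 2 * s := by gcongr
      rw [zero_add, abs_div, abs_of_pos hs0, div_le_iff₀ hs0]
      have := abs_sub (v (t • z)) (qp r a b c (t • z))
      linarith)
  have hp : (0:ℝ) < (1/2) ^ k := by positivity
  refine ⟨a + s / t * a', b + s / t ^ 2 * b', c + s / t ^ 2 * c', ⟨?_, ?_, ?_, ?_⟩, ?_, ?_, ?_⟩
  · rw [← hroot]
    congr 1 <;> field_simp <;> ring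
  · rw [hst2, pow_succ]
    have k1 : |(1/2) ^ k * b'| ≤ (1/2) ^ k * C := by rw [abs_mul, abs_of_pos hp]; gcongr
    have k2 := abs_add_le b ((1/2) ^ k * b')
    have k3 := hI.hb
    linarith
  · rw [hst2, pow_succ]
    have k1 : |(1/2) ^ k * c'| ≤ (1/2) ^ k * C := by rw [abs_mul, abs_of_pos hp]; gcongr
    have k2 := abs_add_le c ((1/2) ^ k * c')
    have k3 := hI.hc
    linarith
  · intro z hz hz1 hz2
    rw [pow_succ, ← ht] at hz1 hz2
    have k1 : |(t⁻¹ • z).1| ≤ ρ := by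
      rw [Prod.smul_fst, smul_eq_mul, abs_mul, abs_of_pos (inv_pos.mpr ht0), inv_mul_le_iff₀ ht0]; exact hz1
    have k2 : (t⁻¹ • z).2 ≤ ρ := by
      rw [Prod.smul_snd, smul_eq_mul, inv_mul_le_iff₀ ht0]; exact hz2
    have k3 : t⁻¹ • z ∈ Tc (r * t) := by
      refine ⟨by linarith, by linarith, ?_⟩
      simp only [Prod.smul_fst, Prod.smul_snd, smul_eq_mul]
      have := mul_le_mul_of_nonneg_left hz.2.2 (inv_pos.mpr ht0).le
      calc r * t * ((t⁻¹ * z.1) ^ 2 + (t⁻¹ * z.2) ^ 2) = t⁻¹ * (r * (z.1 ^ 2 + z.2 ^ 2)) := by field_simp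
        _ ≤ t⁻¹ * (2 * z.2) := this
        _ = _ := by ring
    have k4 := happ _ k3 k1 k2
    rw [zero_add, smul_inv_smul₀ ht0.ne'] at k4
    rw [← qp_scale r a b c t s a' b' c' ht0, pow_succ, ← hs]
    have e1 : v z - (qp r a b c z + s * qp (r * t) a' b' c' (t⁻¹ • z)) =
        s * ((v z - qp r a b c z) / s - qp (r * t) a' b' c' (t⁻¹ • z)) := by field_simp; ring
    rw [e1, abs_mul, abs_of_pos hs0]
    gcongr
  · rw [add_sub_cancel_left, hst, abs_mul, abs_of_pos (by positivity), mul_comm]; gcongr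
  · rw [add_sub_cancel_left, hst2, abs_mul, abs_of_pos (by positivity), mul_comm]; gcongr
  · rw [add_sub_cancel_left, hst2, abs_mul, abs_of_pos (by positivity), mul_comm]; gcongr

lemma geo_lim {f : ℕ → ℝ} {q C : ℝ} (hq0 : 0 ≤ q) (hq : q ≤ 1/2) (hC : 0 ≤ C) (hf : ∀ n, |f (n + 1) - f n| ≤ C * q ^ n) :
    ∃ l, Tendsto f atTop (𝓝 l) ∧ ∀ n, |f n - l| ≤ 2 * C * q ^ n := by
  have h1 : ∀ n, dist (f n) (f (n + 1)) ≤ C * q ^ n := fun n => by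
    rw [dist_comm, Real.dist_eq]; exact hf n
  obtain ⟨l, hl⟩ := cauchySeq_tendsto_of_complete (cauchySeq_of_le_geometric q C (by linarith) h1)
  refine ⟨l, hl, fun n => ?_⟩
  have h2 := dist_le_of_le_geometric_of_tendsto q C (by linarith) h1 hl n
  rw [Real.dist_eq] at h2
  refine h2.trans ?_
  rw [div_le_iff₀ (by linarith)]
  have h3 : 0 ≤ C * q ^ n := by positivity
  have h4 : C * q ^ n * q ≤ C * q ^ n * (1/2) := mul_le_mul_of_nonneg_left hq h3
  linarith

lemma exists_alpha {ρ : ℝ} (h0 : 0 < ρ) (h4 : ρ ≤ 1/4) : ∃ α : ℝ, 0 < α ∧ α < 1 ∧ ρ ^ (2 + α) = ρ ^ 2 / 2 := by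
  have h1 : ρ ^ (Real.logb ρ (1/2)) = 1/2 := Real.rpow_logb h0 (by linarith) (by norm_num)
  refine ⟨Real.logb ρ (1/2), ?_, ?_, ?_⟩
  · by_contra h
    have := Real.rpow_le_rpow_of_exponent_ge h0 (by linarith) (not_lt.mp h)
    rw [h1, Real.rpow_zero] at this
    norm_num at this
  · by_contra h
    have := Real.rpow_le_rpow_of_exponent_ge h0 (by linarith) (not_lt.mp h)
    rw [h1, Real.rpow_one] at this
    linarith
  · rw [Real.rpow_add h0, h1, Real.rpow_two]; ring

theorem iter_lim {κ : ℝ} (hκ0 : 0 ≤ κ) (hκ1 : κ < 1) : ∃ α r1 e1 C : ℝ, 0 < α ∧ α < 1 ∧ 0 < r1 ∧ r1 ≤ 1/4 ∧ 0 < e1 ∧ 0 < C ∧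
    ∀ (G : ℝ → ℝ → ℝ → ℝ) (v : R2 → ℝ) (r : ℝ), Op κ G → G 0 0 0 = 0 → 0 ≤ r → r ≤ r1 →
    ContinuousOn v (Tc r) → (∀ z ∈ To r, SolAt G v z) → (∀ z ∈ Tc r, |v z| ≤ 1) →
    (∀ z ∈ Tc r, r * (z.1 ^ 2 + z.2 ^ 2) = 2 * z.2 → |v z| ≤ e1 * ‖z‖ ^ (2 + α)) →
    ∃ a b c, |a| ≤ C ∧ |b| ≤ C ∧ |c| ≤ C ∧ G (-(a * r)) b (2 * c - a * r) = 0 ∧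
      ∀ z ∈ Tc r, |v z - qp r a b c z| ≤ C * ‖z‖ ^ (2 + α) := by
  obtain ⟨ρ, C, r1, e1, hρ0, hρ4, hC, hr1, hr14, he1, hos⟩ := onestep hκ0 hκ1
  obtain ⟨α, hα0, hα1, hρα⟩ := exists_alpha hρ0 hρ4
  refine ⟨α, min r1 (e1 / (8 * C)), e1 / 2, (1 + 6 * C) * (2 / ρ ^ 2) + 2 * C, hα0, hα1, lt_min hr1 (by positivity),
    (min_le_left _ _).trans hr14, by positivity, by positivity, ?_⟩
  intro G v r hG hG0 hr hrr hc hsol hv1 hvb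
  have hr1' : r ≤ r1 := hrr.trans (min_le_left _ _)
  have hrC : 4 * C * r ≤ e1 / 2 := by
    have := hrr.trans (min_le_right _ _)
    rw [le_div_iff₀ (by positivity)] at this
    linarith
  have hnorm : ∀ k : ℕ, ∀ z ∈ Tc r, |z.1| ≤ ρ ^ k → z.2 ≤ ρ ^ k → ‖z‖ ≤ ρ ^ k := by
    intro k z hz h1 h2
    have := Tc_nonneg hr hz
    rw [Prod.norm_def]
    exact max_le h1 (by rw [Real.norm_eq_abs, abs_of_nonneg this]; exact h2)
  have hpow : ∀ k : ℕ, (ρ ^ k) ^ (2 + α) = (ρ ^ 2 / 2) ^ k := by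
    intro k
    rw [← hρα, ← Real.rpow_natCast, ← Real.rpow_natCast, ← Real.rpow_mul hρ0.le, ← Real.rpow_mul hρ0.le, mul_comm]
  have hbd : ∀ (k : ℕ), ∀ z ∈ Tc r, r * (z.1 ^ 2 + z.2 ^ 2) = 2 * z.2 → |z.1| ≤ ρ ^ k → z.2 ≤ ρ ^ k →
      |v z| ≤ e1 / 2 * (ρ ^ 2 / 2) ^ k := by
    intro k z hz hzb h1 h2
    refine (hvb z hz hzb).trans ?_
    rw [← hpow]
    exact mul_le_mul_of_nonneg_left (Real.rpow_le_rpow (norm_nonneg _) (hnorm k z hz h1 h2) (by linarith)) (by positivity)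
  have hstep : ∀ (k : ℕ) (p : {p : ℝ × ℝ × ℝ // ItInv G v r ρ C k p.1 p.2.1 p.2.2}),
      ∃ p' : {p : ℝ × ℝ × ℝ // ItInv G v r ρ C (k + 1) p.1 p.2.1 p.2.2},
      |p'.1.1 - p.1.1| ≤ C * (ρ / 2) ^ k ∧ |p'.1.2.1 - p.1.2.1| ≤ C * (1/2) ^ k ∧ |p'.1.2.2 - p.1.2.2| ≤ C * (1/2) ^ k := by
    rintro k ⟨⟨a, b, c⟩, hI⟩
    obtain ⟨a', b', c', hI', h⟩ := iter_step hρ0 hρ4 hC he1 hos hG hr hr1' hrC hc hsol hbd hI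
    exact ⟨⟨⟨a', b', c'⟩, hI'⟩, h⟩
  choose f hf using hstep
  have hI0 : ItInv G v r ρ C 0 0 0 0 := by
    refine ⟨by simpa using hG0, by simp, by simp, fun z hz _ _ => ?_⟩
    have := hv1 z hz
    simpa [qp] using this
  obtain ⟨s, hs0, hs⟩ : ∃ s : (∀ k : ℕ, {p : ℝ × ℝ × ℝ // ItInv G v r ρ C k p.1 p.2.1 p.2.2}),
      s 0 = ⟨(0, 0, 0), hI0⟩ ∧ ∀ k, s (k + 1) = f k (s k) :=
    ⟨fun k => Nat.rec ⟨(0, 0, 0), hI0⟩ f k, rfl, fun k => rfl⟩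
  obtain ⟨a, ha, hak⟩ := geo_lim (f := fun k => (s k).1.1) (q := ρ / 2) (by positivity) (by linarith) hC.le
    (fun k => by simp only [hs]; exact (hf k (s k)).1)
  obtain ⟨b, hb, hbk⟩ := geo_lim (f := fun k => (s k).1.2.1) (q := 1 / 2) (by positivity) (by linarith) hC.le
    (fun k => by simp only [hs]; exact (hf k (s k)).2.1)
  obtain ⟨c, hcc, hck⟩ := geo_lim (f := fun k => (s k).1.2.2) (q := 1 / 2) (by positivity) (by linarith) hC.le
    (fun k => by simp only [hs]; exact (hf k (s k)).2.2)
  have hCp : 0 ≤ (1 + 6 * C) * (2 / ρ ^ 2) := by positivity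
  refine ⟨a, b, c, ?_, ?_, ?_, ?_, ?_⟩
  · have := hak 0
    simp only [hs0, pow_zero, zero_sub, abs_neg] at this
    linarith
  · have := hbk 0
    simp only [hs0, pow_zero, zero_sub, abs_neg] at this
    linarith
  · have := hck 0
    simp only [hs0, pow_zero, zero_sub, abs_neg] at this
    linarith
  · have k1 : Tendsto (fun k => ((-((s k).1.1 * r), (s k).1.2.1, 2 * (s k).1.2.2 - (s k).1.1 * r) : ℝ × ℝ × ℝ)) atTop
        (𝓝 (-(a * r), b, 2 * c - a * r)) :=
      ((ha.mul_const r).neg).prodMk_nhds (hb.prodMk_nhds ((hcc.const_mul 2).sub (ha.mul_const r)))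
    have k2 := (hG.cont.tendsto (-(a * r), b, 2 * c - a * r)).comp k1
    refine tendsto_nhds_unique k2 ?_
    refine tendsto_const_nhds.congr (fun k => ?_)
    exact ((s k).2.root).symm
  · intro z hz
    have hz2 := Tc_nonneg hr hz
    rcases eq_or_ne z 0 with rfl | hz0
    · have := hvb 0 hz (by simp)
      rw [norm_zero, Real.zero_rpow (by linarith)] at this ⊢
      simp only [mul_zero] at this ⊢
      simpa [qp] using this
    have hm : 0 < ‖z‖ := norm_pos_iff.mpr hz0
    have hm1 : ‖z‖ ≤ 1 := by
      rw [Prod.norm_def]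
      exact max_le hz.1 (by rw [Real.norm_eq_abs, abs_of_nonneg hz2]; exact hz.2.1)
    obtain ⟨k, hk1, hk2⟩ := exists_nat_pow_near_of_lt_one hm hm1 hρ0 (by linarith)
    have z1 : |z.1| ≤ ρ ^ k := (norm_fst_le z).trans hk2
    have z2 : z.2 ≤ ρ ^ k := (le_abs_self _).trans ((norm_snd_le z).trans hk2)
    have hP : 0 < ρ ^ k := by positivity
    have h0 := (s k).2.app z hz z1 z2
    have ha' := hak k
    have hb' := hbk k
    have hc' := hck k
    obtain ⟨ak, hake⟩ : ∃ x, x = (s k).1.1 := ⟨_, rfl⟩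
    obtain ⟨bk, hbke⟩ : ∃ x, x = (s k).1.2.1 := ⟨_, rfl⟩
    obtain ⟨ck, hcke⟩ : ∃ x, x = (s k).1.2.2 := ⟨_, rfl⟩
    rw [← hake] at ha' h0
    rw [← hbke] at hb' h0
    rw [← hcke] at hc' h0
    have e0 : v z - qp r a b c z = (v z - qp r ak bk ck z) + (ak - a) * (z.2 - r / 2 * (z.1 ^ 2 + z.2 ^ 2)) +
        (bk - b) * (z.1 * z.2) + (ck - c) * (z.2 * z.2) := by unfold qp; ring
    have hpk : (ρ / 2) ^ k * ρ ^ k = (ρ ^ 2 / 2) ^ k := by rw [← mul_pow]; congr 1; ring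
    have hpk2 : (1 / 2) ^ k * (ρ ^ k * ρ ^ k) = (ρ ^ 2 / 2) ^ k := by rw [← mul_pow, ← mul_pow]; congr 1; ring
    have t1 : |(ak - a) * (z.2 - r / 2 * (z.1 ^ 2 + z.2 ^ 2))| ≤ 2 * C * (ρ ^ 2 / 2) ^ k := by
      have q1 : |z.2 - r / 2 * (z.1 ^ 2 + z.2 ^ 2)| ≤ ρ ^ k := by
        have q2 := hz.2.2
        have q3 : 0 ≤ r * (z.1 ^ 2 + z.2 ^ 2) := by positivity
        rw [abs_of_nonneg (by linarith)]; linarith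
      rw [abs_mul, ← hpk, ← mul_assoc]
      exact mul_le_mul ha' q1 (abs_nonneg _) (by positivity)
    have t2 : |(bk - b) * (z.1 * z.2)| ≤ 2 * C * (ρ ^ 2 / 2) ^ k := by
      have q1 : |z.1 * z.2| ≤ ρ ^ k * ρ ^ k := by
        rw [abs_mul, abs_of_nonneg hz2]; exact mul_le_mul z1 z2 hz2 hP.le
      rw [abs_mul, ← hpk2, ← mul_assoc]
      exact mul_le_mul hb' q1 (abs_nonneg _) (by positivity)
    have t3 : |(ck - c) * (z.2 * z.2)| ≤ 2 * C * (ρ ^ 2 / 2) ^ k := by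
      have q1 : |z.2 * z.2| ≤ ρ ^ k * ρ ^ k := by
        rw [abs_mul, abs_of_nonneg hz2]; exact mul_le_mul z2 z2 hz2 hP.le
      rw [abs_mul, ← hpk2, ← mul_assoc]
      exact mul_le_mul hc' q1 (abs_nonneg _) (by positivity)
    have hpp : ρ ^ 2 / 2 * (ρ ^ 2 / 2) ^ k ≤ ‖z‖ ^ (2 + α) := by
      rw [mul_comm, ← pow_succ, ← hpow]
      exact Real.rpow_le_rpow (by positivity) hk1.le (by linarith)
    have hN : 0 ≤ ‖z‖ ^ (2 + α) := by positivity
    have hfin : (ρ ^ 2 / 2) ^ k ≤ (2 / ρ ^ 2) * ‖z‖ ^ (2 + α) := by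
      calc (ρ ^ 2 / 2) ^ k = (2 / ρ ^ 2) * (ρ ^ 2 / 2 * (ρ ^ 2 / 2) ^ k) := by field_simp
        _ ≤ _ := mul_le_mul_of_nonneg_left hpp (by positivity)
    have hfin2 : (1 + 6 * C) * (ρ ^ 2 / 2) ^ k ≤ (1 + 6 * C) * ((2 / ρ ^ 2) * ‖z‖ ^ (2 + α)) :=
      mul_le_mul_of_nonneg_left hfin (by positivity)
    have hlast : 0 ≤ 2 * C * ‖z‖ ^ (2 + α) := by positivity
    rw [e0]
    have s1 := abs_add_le ((v z - qp r ak bk ck z) + (ak - a) * (z.2 - r / 2 * (z.1 ^ 2 + z.2 ^ 2)) +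
        (bk - b) * (z.1 * z.2)) ((ck - c) * (z.2 * z.2))
    have s2 := abs_add_le ((v z - qp r ak bk ck z) + (ak - a) * (z.2 - r / 2 * (z.1 ^ 2 + z.2 ^ 2)))
        ((bk - b) * (z.1 * z.2))
    have s3 := abs_add_le (v z - qp r ak bk ck z) ((ak - a) * (z.2 - r / 2 * (z.1 ^ 2 + z.2 ^ 2)))
    linarith

/-- closed unit disk tangent to the axis at the origin -/
def Dk : Set R2 := {z | z.1 ^ 2 + z.2 ^ 2 ≤ 2 * z.2}

lemma Dk_bd {z : R2} (hz : z ∈ Dk) : |z.1| ≤ 1 ∧ 0 ≤ z.2 ∧ z.2 ≤ 2 ∧ z.1 ^ 2 + z.2 ^ 2 ≤ 4 ∧ z.1 ^ 2 ≤ 1 ∧ z.2 ^ 2 ≤ 4 ∧ |z.1 * z.2| ≤ 2 := by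
  have h : z.1 ^ 2 + z.2 ^ 2 ≤ 2 * z.2 := hz
  have h1 : z.1 ^ 2 ≤ 1 := by nlinarith [sq_nonneg (z.2 - 1)]
  have h2 : 0 ≤ z.2 := by nlinarith [sq_nonneg z.1, sq_nonneg z.2]
  have h3 : z.2 ≤ 2 := by nlinarith [sq_nonneg z.1, sq_nonneg (z.2 - 1)]
  have h4 : |z.1| ≤ 1 := by rw [← sq_abs] at h1; exact (sq_le_one_iff₀ (abs_nonneg _)).mp h1
  refine ⟨h4, h2, h3, by linarith, h1, by nlinarith, ?_⟩
  rw [abs_mul, abs_of_nonneg h2]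
  calc |z.1| * z.2 ≤ 1 * 2 := mul_le_mul h4 h3 h2 (by norm_num)
    _ = 2 := by norm_num

theorem disk_model {κ : ℝ} (hκ0 : 0 ≤ κ) (hκ1 : κ < 1) : ∃ α C : ℝ, 0 < α ∧ α < 1 ∧ 0 < C ∧
    ∀ (G : ℝ → ℝ → ℝ → ℝ) (v : R2 → ℝ) (N : ℝ), Op κ G → G 0 0 0 = 0 → 0 < N →
    ContinuousOn v Dk → (∀ z : R2, z.1 ^ 2 + z.2 ^ 2 < 2 * z.2 → SolAt G v z) → (∀ z ∈ Dk, |v z| ≤ N) →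
    (∀ z : R2, z.1 ^ 2 + z.2 ^ 2 = 2 * z.2 → |v z| ≤ N * ‖z‖ ^ (2 + α)) →
    ∃ a b c, |a| ≤ C * N ∧ |b| ≤ C * N ∧ |c| ≤ C * N ∧ G (-a) b (2 * c - a) = 0 ∧
      ∀ z ∈ Dk, |v z - qp 1 a b c z| ≤ C * N * ‖z‖ ^ (2 + α) := by
  obtain ⟨α, t, e1, C, hα0, hα1, ht0, ht4, he1, hC, H⟩ := iter_lim hκ0 hκ1
  obtain ⟨m, hm⟩ : ∃ m, m = 1 + 1 / e1 := ⟨_, rfl⟩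
  have hm1 : 1 ≤ m := by rw [hm]; have : 0 < 1 / e1 := by positivity
                         linarith
  have hme : 1 ≤ e1 * m := by
    rw [hm, mul_add, mul_one_div_cancel he1.ne']; linarith
  obtain ⟨T, hT⟩ : ∃ T : ℝ, T = t ^ (2 + α) := ⟨_, rfl⟩
  have hT0 : 0 < T := by rw [hT]; positivity
  have hT1 : T ≤ 1 := by rw [hT]; exact Real.rpow_le_one ht0.le (by linarith) (by linarith)
  obtain ⟨L, hL⟩ : ∃ L, L = m / t ^ 2 * C := ⟨_, rfl⟩
  have hL0 : 0 < L := by rw [hL]; positivity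
  have hx : m / t * C ≤ L := by
    rw [hL]
    have : m / t ≤ m / t ^ 2 := by
      apply div_le_div_of_nonneg_left (by positivity) (by positivity)
      rw [sq]; have : t * t ≤ t * 1 := by gcongr; linarith
      linarith
    gcongr
  have hLm : 0 < (m * C + 1 + 8 * L) / T := by positivity
  refine ⟨α, L + (m * C + 1 + 8 * L) / T, hα0, hα1, by positivity, ?_⟩
  intro G v N hG hG0 hN hc hsol hv hvb
  obtain ⟨s, hs⟩ : ∃ s, s = N * m := ⟨_, rfl⟩
  have hs0 : 0 < s := by rw [hs]; positivity
  have hin : ∀ z ∈ Tc t, t • z ∈ Dk := by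
    intro z hz
    have h3 := mul_le_mul_of_nonneg_left hz.2.2 ht0.le
    change (t * z.1) ^ 2 + (t * z.2) ^ 2 ≤ 2 * (t * z.2)
    linarith
  have hns : ∀ z : R2, ‖t • z‖ ^ (2 + α) = T * ‖z‖ ^ (2 + α) := by
    intro z
    rw [norm_smul, Real.norm_eq_abs, abs_of_pos ht0, Real.mul_rpow ht0.le (norm_nonneg _), hT]
  obtain ⟨a, b, c, ha, hb, hc', hroot, happ⟩ := H
    (fun p q w => G ((s * p + 0) / t ^ 2) ((s * q + 0) / t ^ 2) ((s * w + 0) / t ^ 2))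
    (fun x => (v (0 + t • x) - 0) / s) t (hG.trans ht0 hs0 _ _ _)
    (by simpa using hG0) ht0.le le_rfl
    (by
      have k1 : Continuous (fun x : R2 => 0 + t • x) := by fun_prop
      exact ((hc.comp k1.continuousOn (fun z hz => by rw [zero_add]; exact hin z hz)).sub continuousOn_const).div_const _)
    (fun z hz => SolAt.trans 0 ht0 hs0 (fun _ => (0:ℝ)) 0 0 0 ⟨0, 0, fun h => by simp [qd]⟩ (hsol _ (by
      rw [zero_add]
      have h3 := mul_lt_mul_of_pos_left hz.2.2 ht0
      change (t * z.1) ^ 2 + (t * z.2) ^ 2 < 2 * (t * z.2)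
      linarith)))
    (by
      intro z hz
      have k1 := hv _ (hin z hz)
      rw [zero_add, sub_zero, abs_div, abs_of_pos hs0, div_le_one hs0, hs]
      have : N * 1 ≤ N * m := mul_le_mul_of_nonneg_left hm1 hN.le
      linarith)
    (by
      intro z hz hzb
      have k1 := hvb (t • z) (by
        change (t * z.1) ^ 2 + (t * z.2) ^ 2 = 2 * (t * z.2)
        linear_combination t * hzb)
      rw [zero_add, sub_zero, abs_div, abs_of_pos hs0, div_le_iff₀ hs0, hs]
      refine k1.trans ?_
      rw [hns]
      have q0 : 0 ≤ ‖z‖ ^ (2 + α) := by positivity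
      have q1 : N * (T * ‖z‖ ^ (2 + α)) ≤ N * (1 * ‖z‖ ^ (2 + α)) := by gcongr
      have q2 : (N * ‖z‖ ^ (2 + α)) * 1 ≤ (N * ‖z‖ ^ (2 + α)) * (e1 * m) := mul_le_mul_of_nonneg_left hme (by positivity)
      linarith)
  have hLN : L * N ≤ (L + (m * C + 1 + 8 * L) / T) * N := by gcongr; linarith
  have ha2 : |s / t * a| ≤ L * N := by
    rw [abs_mul, abs_of_pos (by positivity)]
    calc s / t * |a| ≤ s / t * C := by gcongr
      _ = (m / t * C) * N := by rw [hs]; ring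
      _ ≤ _ := by gcongr
  have hb2 : |s / t ^ 2 * b| ≤ L * N := by
    rw [abs_mul, abs_of_pos (by positivity)]
    calc s / t ^ 2 * |b| ≤ s / t ^ 2 * C := by gcongr
      _ = _ := by rw [hs, hL]; ring
  have hc2 : |s / t ^ 2 * c| ≤ L * N := by
    rw [abs_mul, abs_of_pos (by positivity)]
    calc s / t ^ 2 * |c| ≤ s / t ^ 2 * C := by gcongr
      _ = _ := by rw [hs, hL]; ring
  refine ⟨s / t * a, s / t ^ 2 * b, s / t ^ 2 * c, ha2.trans hLN, hb2.trans hLN, hc2.trans hLN, ?_, ?_⟩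
  · rw [← hroot]
    congr 1 <;> field_simp <;> ring
  intro z hz
  obtain ⟨d1, d2, d3, d4, d5, d6, d7⟩ := Dk_bd hz
  have hzN : 0 ≤ ‖z‖ ^ (2 + α) := by positivity
  have hgo : ∀ x, 0 ≤ x → x ≤ m * C + 1 + 8 * L → N * x * (‖z‖ ^ (2 + α) / T) ≤ (L + (m * C + 1 + 8 * L) / T) * N * ‖z‖ ^ (2 + α) := by
    intro x hx0 hx
    calc N * x * (‖z‖ ^ (2 + α) / T) = (x / T) * N * ‖z‖ ^ (2 + α) := by ring
      _ ≤ ((m * C + 1 + 8 * L) / T) * N * ‖z‖ ^ (2 + α) := by gcongr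
      _ ≤ _ := by gcongr; linarith
  rcases le_or_gt ‖z‖ t with hzt | hzt
  · have e0 : qp 1 (s / t * a) (s / t ^ 2 * b) (s / t ^ 2 * c) z = s * qp t a b c (t⁻¹ • z) := by
      have := qp_scale 1 0 0 0 t s a b c ht0 z
      rw [one_mul, zero_add, zero_add, zero_add] at this
      rw [← this]; simp [qp]
    have k1 : |z.1| ≤ t := (norm_fst_le z).trans hzt
    have k2 : z.2 ≤ t := (le_abs_self _).trans ((norm_snd_le z).trans hzt)
    have k3 : t⁻¹ • z ∈ Tc t := by
      refine ⟨?_, ?_, ?_⟩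
      · rw [Prod.smul_fst, smul_eq_mul, abs_mul, abs_of_pos (inv_pos.mpr ht0), inv_mul_le_iff₀ ht0]; linarith
      · rw [Prod.smul_snd, smul_eq_mul, inv_mul_le_iff₀ ht0]; linarith
      · simp only [Prod.smul_fst, Prod.smul_snd, smul_eq_mul]
        have h : z.1 ^ 2 + z.2 ^ 2 ≤ 2 * z.2 := hz
        have := mul_le_mul_of_nonneg_left h (inv_pos.mpr ht0).le
        calc t * ((t⁻¹ * z.1) ^ 2 + (t⁻¹ * z.2) ^ 2) = t⁻¹ * (z.1 ^ 2 + z.2 ^ 2) := by field_simp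
          _ ≤ t⁻¹ * (2 * z.2) := this
          _ = _ := by ring
    have k4 := happ _ k3
    have k5 := hns (t⁻¹ • z)
    rw [smul_inv_smul₀ ht0.ne'] at k5
    have k6 : ‖t⁻¹ • z‖ ^ (2 + α) = ‖z‖ ^ (2 + α) / T := by rw [k5]; field_simp
    rw [zero_add, smul_inv_smul₀ ht0.ne', k6, sub_zero] at k4
    have e1 : v z - s * qp t a b c (t⁻¹ • z) = s * (v z / s - qp t a b c (t⁻¹ • z)) := by field_simp
    rw [e0, e1, abs_mul, abs_of_pos hs0]
    refine le_trans ?_ (hgo (m * C) (by positivity) (by linarith))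
    calc _ ≤ s * (C * (‖z‖ ^ (2 + α) / T)) := by gcongr
      _ = _ := by rw [hs]; ring
  · have k0 : 1 ≤ ‖z‖ ^ (2 + α) / T := by
      rw [le_div_iff₀ hT0, one_mul, hT]
      exact Real.rpow_le_rpow ht0.le hzt.le (by linarith)
    have k1 := hv z hz
    obtain ⟨a', ha'⟩ : ∃ a', a' = s / t * a := ⟨_, rfl⟩
    obtain ⟨b', hb'⟩ : ∃ a', a' = s / t ^ 2 * b := ⟨_, rfl⟩
    obtain ⟨c', hcc'⟩ : ∃ a', a' = s / t ^ 2 * c := ⟨_, rfl⟩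
    rw [← ha'] at ha2 ⊢
    rw [← hb'] at hb2 ⊢
    rw [← hcc'] at hc2 ⊢
    have hLN0 : 0 ≤ L * N := by positivity
    have k2 : |qp 1 a' b' c' z| ≤ 8 * (L * N) := by
      have e0 : qp 1 a' b' c' z = a' * (z.2 - 1/2 * (z.1 ^ 2 + z.2 ^ 2)) + b' * (z.1 * z.2) + c' * z.2 ^ 2 := by unfold qp; ring
      have h : z.1 ^ 2 + z.2 ^ 2 ≤ 2 * z.2 := hz
      have p1 : |a' * (z.2 - 1/2 * (z.1 ^ 2 + z.2 ^ 2))| ≤ L * N * 2 := by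
        rw [abs_mul, abs_of_nonneg (a := z.2 - _) (by linarith)]
        exact mul_le_mul ha2 (by linarith [sq_nonneg z.1, sq_nonneg z.2]) (by linarith) hLN0
      have p2 : |b' * (z.1 * z.2)| ≤ L * N * 2 := by
        rw [abs_mul]
        exact mul_le_mul hb2 d7 (abs_nonneg _) hLN0
      have p3 : |c' * z.2 ^ 2| ≤ L * N * 4 := by
        rw [abs_mul, abs_of_nonneg (sq_nonneg z.2)]
        exact mul_le_mul hc2 d6 (sq_nonneg _) hLN0
      rw [e0]
      have s1 := abs_add_le (a' * (z.2 - 1/2 * (z.1 ^ 2 + z.2 ^ 2)) + b' * (z.1 * z.2)) (c' * z.2 ^ 2)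
      have s2 := abs_add_le (a' * (z.2 - 1/2 * (z.1 ^ 2 + z.2 ^ 2))) (b' * (z.1 * z.2))
      linarith
    have hmC : 0 < m * C := by positivity
    refine le_trans ?_ (hgo (1 + 8 * L) (by positivity) (by linarith))
    have s1 := abs_sub (v z) (qp 1 a' b' c' z)
    have s2 : N * (1 + 8 * L) * 1 ≤ N * (1 + 8 * L) * (‖z‖ ^ (2 + α) / T) := mul_le_mul_of_nonneg_left k0 (by positivity)
    linarith

theorem disk_thm {κ : ℝ} (hκ0 : 0 ≤ κ) (hκ1 : κ < 1) : ∃ α C : ℝ, 0 < α ∧ α < 1 ∧ 0 < C ∧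
    ∀ (G : ℝ → ℝ → ℝ → ℝ) (v : R2 → ℝ) (N A B1 B2 p q r : ℝ), Op κ G → G 0 0 0 = 0 → 0 < N →
    |A| ≤ N → |B1| ≤ N → |B2| ≤ N → |p| ≤ N → |q| ≤ N → |r| ≤ N →
    ContinuousOn v Dk → (∀ z : R2, z.1 ^ 2 + z.2 ^ 2 < 2 * z.2 → SolAt G v z) → (∀ z ∈ Dk, |v z| ≤ N) →
    (∀ z : R2, z.1 ^ 2 + z.2 ^ 2 = 2 * z.2 → |v z - (A + qd B1 B2 p q r z)| ≤ N * ‖z‖ ^ (2 + α)) →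
    ∃ A' B1' B2' p' q' r', |B1'| ≤ C * N ∧ |B2'| ≤ C * N ∧ |p'| ≤ C * N ∧ |q'| ≤ C * N ∧ |r'| ≤ C * N ∧
      G p' q' r' = 0 ∧
      ∀ z ∈ Dk, |v z - (A' + qd B1' B2' p' q' r' z)| ≤ C * N * ‖z‖ ^ (2 + α) := by
  obtain ⟨α, C, hα0, hα1, hC, H⟩ := disk_model hκ0 hκ1
  obtain ⟨k, hk⟩ : ∃ k, k = 3 / (1 - κ) := ⟨_, rfl⟩
  have hk0 : 0 < k := by rw [hk]; apply div_pos; norm_num; linarith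
  obtain ⟨D, hD⟩ : ∃ D, D = C * (10 + 2 * k) := ⟨_, rfl⟩
  have hD0 : 0 < D := by rw [hD]; positivity
  refine ⟨α, 1 + k + 3 * D, hα0, hα1, by positivity, ?_⟩
  intro G v N A B1 B2 p q r hG hG0 hN hA hB1 hB2 hp hq hr hc hsol hv hvb
  obtain ⟨T, hT0, hT⟩ := hG.root hκ0 hκ1 0 0 0 p q r 1 1 hG0 zero_le_one zero_le_one (by norm_num)
  simp only [zero_add, mul_one] at hT0
  have hTk : |T| ≤ k * N := by
    have h1 := dev_le p q r
    have h2 : κ * dev p q r ≤ 1 * dev p q r := mul_le_mul_of_nonneg_right hκ1.le (dev_nonneg _ _ _)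
    have h3 := abs_add_le p r
    rw [hk, div_mul_eq_mul_div, le_div_iff₀ (by linarith)]
    linarith
  obtain ⟨M, hM⟩ : ∃ M, M = (10 + 2 * k) * N := ⟨_, rfl⟩
  have hMN : N ≤ M := by
    rw [hM]; have : 0 < k * N := by positivity
    linarith
  have hDM : C * M = D * N := by rw [hM, hD]; ring
  obtain ⟨a, b, c, ha, hb, hcc, hroot, happ⟩ := H
    (fun p' q' r' => G ((1 * p' + (p + T)) / 1 ^ 2) ((1 * q' + q) / 1 ^ 2) ((1 * r' + (r + T)) / 1 ^ 2))
    (fun x => (v (0 + (1:ℝ) • x) - (A + qd B1 (B2 - T) (p + T) q (r + T) x)) / 1) M (hG.trans one_pos one_pos _ _ _)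
    (by simpa using hT0) (by linarith)
    (by
      have k1 : Continuous (fun x : R2 => 0 + (1:ℝ) • x) := by fun_prop
      have k2 : Continuous (fun x : R2 => A + qd B1 (B2 - T) (p + T) q (r + T) x) := by unfold qd; fun_prop
      exact ((hc.comp k1.continuousOn (fun z hz => by rw [zero_add, one_smul]; exact hz)).sub k2.continuousOn).div_const _)
    (fun z hz => SolAt.trans 0 one_pos one_pos (fun x => A + qd B1 (B2 - T) (p + T) q (r + T) x) _ _ _
      ⟨B1 + (p + T) * z.1 + q * z.2, B2 - T + q * z.1 + (r + T) * z.2, fun h => by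
        simp only [qd, Prod.fst_add, Prod.snd_add]; ring⟩
      (by rw [zero_add, one_smul]; exact hsol z hz))
    (by
      intro z hz
      rw [zero_add, one_smul, div_one]
      obtain ⟨d1, d2, d3, d4, d5, d6, d7⟩ := Dk_bd hz
      have h : z.1 ^ 2 + z.2 ^ 2 ≤ 2 * z.2 := hz
      have e0 : v z - (A + qd B1 (B2 - T) (p + T) q (r + T) z) =
          v z - A - B1 * z.1 - B2 * z.2 - p * (z.1 ^ 2 / 2) - q * (z.1 * z.2) - r * (z.2 ^ 2 / 2) + T * ((2 * z.2 - (z.1 ^ 2 + z.2 ^ 2)) / 2) := by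
        unfold qd; ring
      have s0 := hv z hz
      have s1 : |B1 * z.1| ≤ N * 1 := by rw [abs_mul]; exact mul_le_mul hB1 d1 (abs_nonneg _) hN.le
      have s2 : |B2 * z.2| ≤ N * 2 := by rw [abs_mul, abs_of_nonneg d2]; exact mul_le_mul hB2 d3 d2 hN.le
      have s3 : |p * (z.1 ^ 2 / 2)| ≤ N * 1 := by
        rw [abs_mul, abs_of_nonneg (a := z.1 ^ 2 / 2) (by positivity)]; exact mul_le_mul hp (by linarith) (by positivity) hN.le
      have s4 : |q * (z.1 * z.2)| ≤ N * 2 := by rw [abs_mul]; exact mul_le_mul hq d7 (abs_nonneg _) hN.le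
      have s5 : |r * (z.2 ^ 2 / 2)| ≤ N * 2 := by
        rw [abs_mul, abs_of_nonneg (a := z.2 ^ 2 / 2) (by positivity)]; exact mul_le_mul hr (by linarith) (by positivity) hN.le
      have s6 : |T * ((2 * z.2 - (z.1 ^ 2 + z.2 ^ 2)) / 2)| ≤ k * N * 2 := by
        rw [abs_mul, abs_of_nonneg (a := (2 * z.2 - (z.1 ^ 2 + z.2 ^ 2)) / 2) (by linarith)]
        exact mul_le_mul hTk (by linarith [sq_nonneg z.1, sq_nonneg z.2]) (by linarith) (by positivity)
      rw [e0, hM]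
      clear hT hT0 H hsol hvb
      rw [abs_le] at s0 s1 s2 s3 s4 s5 s6 hA ⊢
      constructor <;> linarith [s0.1, s0.2, s1.1, s1.2])
    (by
      intro z hz
      rw [zero_add, one_smul, div_one]
      have e0 : qd B1 (B2 - T) (p + T) q (r + T) z = qd B1 B2 p q r z := by
        unfold qd; linear_combination (T / 2) * hz
      rw [e0]
      refine (hvb z hz).trans ?_
      gcongr)
  rw [hDM] at ha hb hcc
  have hkN : 0 < k * N := by positivity
  have hDN : 0 < D * N := by positivity
  simp only [one_mul, one_pow, div_one] at hroot
  refine ⟨A, B1, B2 - T + a, -a + (p + T), b + q, 2 * c - a + (r + T), ?_, ?_, ?_, ?_, ?_, hroot, ?_⟩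
  · linarith
  · rw [abs_le] at *; constructor <;> linarith
  · rw [abs_le] at *; constructor <;> linarith
  · rw [abs_le] at *; constructor <;> linarith
  · rw [abs_le] at *; constructor <;> linarith
  · intro z hz
    have h1 := happ z hz
    rw [zero_add, one_smul, div_one, hDM] at h1
    have e0 : v z - (A + qd B1 (B2 - T + a) (-a + (p + T)) (b + q) (2 * c - a + (r + T)) z) =
        v z - (A + qd B1 (B2 - T) (p + T) q (r + T) z) - qp 1 a b c z := by unfold qd qp; ring
    rw [e0]
    refine h1.trans ?_
    have : D * N ≤ (1 + k + 3 * D) * N := by linarith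
    gcongr

/-- the matrix `p ττᵀ + q (τνᵀ + ντᵀ) + r ννᵀ` with `τ = (-s,c)`, `ν = (-c,-s)`. -/
def rotM (c s p q r : ℝ) : Mat2 :=
  !![p * s ^ 2 + 2 * q * (s * c) + r * c ^ 2, (r - p) * (s * c) + q * (s ^ 2 - c ^ 2);
     (r - p) * (s * c) + q * (s ^ 2 - c ^ 2), p * c ^ 2 - 2 * q * (s * c) + r * s ^ 2]

lemma rotM_herm (c s p q r : ℝ) : (rotM c s p q r).IsHermitian := by
  ext i j; fin_cases i <;> fin_cases j <;> simp [rotM]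

lemma rotM_sub (c s p q r p' q' r' : ℝ) :
    rotM c s p q r - rotM c s p' q' r' = rotM c s (p - p') (q - q') (r - r') := by
  ext i j; fin_cases i <;> fin_cases j <;> simp [rotM] <;> ring

lemma rotM_eigs {c s : ℝ} (hcs : c ^ 2 + s ^ 2 = 1) (p q r : ℝ) : ∃ e f, e + f = p + r ∧ |e - f| = dev p q r ∧
    posNorm (rotM c s p q r) = max e 0 + max f 0 ∧ negNorm (rotM c s p q r) = max (-e) 0 + max (-f) 0 := by
  have h := rotM_herm c s p q r
  have h1 := h.trace_eq_sum_eigenvalues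
  have h2 := h.det_eq_prod_eigenvalues
  simp only [Fin.sum_univ_two, Fin.prod_univ_two, Matrix.trace_fin_two, Matrix.det_fin_two, RCLike.ofReal_real_eq_id, id] at h1 h2
  obtain ⟨e, he⟩ : ∃ e, e = h.eigenvalues 0 := ⟨_, rfl⟩
  obtain ⟨f, hf⟩ : ∃ f, f = h.eigenvalues 1 := ⟨_, rfl⟩
  rw [← he, ← hf] at h1 h2
  have h1' : e + f = p + r := by
    rw [← h1]; simp [rotM]; linear_combination (p + r) * hcs
  refine ⟨e, f, h1', ?_, ?_, ?_⟩
  · have h3 : (e - f) ^ 2 = (p - r) ^ 2 + 4 * q ^ 2 := by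
      have h4 : e * f = p * r - q ^ 2 := by
        rw [← h2]; simp [rotM]
        linear_combination (p * r - q ^ 2) * (c ^ 2 + s ^ 2 + 1) * hcs
      linear_combination (e + f + p + r) * h1' - 4 * h4
    rw [dev, ← h3, Real.sqrt_sq_eq_abs]
  · rw [posNorm, dif_pos h, Fin.sum_univ_two, he, hf]
  · rw [negNorm, dif_pos h, Fin.sum_univ_two, he, hf]

lemma Op_rot {lam Lam : ℝ} (hlam : 0 < lam) (hLam : lam ≤ Lam) {F : Mat2 → ℝ} (hF : UniformlyElliptic lam Lam F)
    {c s : ℝ} (hcs : c ^ 2 + s ^ 2 = 1) : Op ((Lam - lam) / (Lam + lam)) (fun p q r => F (rotM c s p q r)) := by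
  constructor
  · have hL : ∀ x y : ℝ × ℝ × ℝ, F (rotM c s x.1 x.2.1 x.2.2) - F (rotM c s y.1 y.2.1 y.2.2) ≤ 6 * Lam * dist x y := by
      intro x y
      have h1 := hF _ _ (rotM_herm c s x.1 x.2.1 x.2.2) (rotM_herm c s y.1 y.2.1 y.2.2)
      rw [rotM_sub] at h1
      obtain ⟨e, f, k1, k2, k3, k4⟩ := rotM_eigs hcs (x.1 - y.1) (x.2.1 - y.2.1) (x.2.2 - y.2.2)
      have k5 := dev_le (x.1 - y.1) (x.2.1 - y.2.1) (x.2.2 - y.2.2)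
      have d1 : |x.1 - y.1| ≤ dist x y := norm_fst_le (x - y) |>.trans (dist_eq_norm x y).ge
      have d0 : ‖(x - y).2‖ ≤ dist x y := norm_snd_le (x - y) |>.trans (dist_eq_norm x y).ge
      have d2 : |x.2.1 - y.2.1| ≤ dist x y := (norm_fst_le (x - y).2).trans d0
      have d3 : |x.2.2 - y.2.2| ≤ dist x y := (norm_snd_le (x - y).2).trans d0
      have m1 : 0 ≤ max (-e) 0 := le_max_right _ _
      have m2 : 0 ≤ max (-f) 0 := le_max_right _ _
      have m3 : max e 0 + max f 0 ≤ 6 * dist x y := by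
        have a1 := abs_le.mp d1
        have a3 := abs_le.mp d3
        have a4 := abs_le.mp (le_of_eq k2)
        have d := dist_nonneg (x := x) (y := y)
        rcases max_cases e 0 with ⟨q1, -⟩ | ⟨q1, -⟩ <;> rcases max_cases f 0 with ⟨q2, -⟩ | ⟨q2, -⟩ <;>
          rw [q1, q2] <;> linarith [a1.1, a1.2, a3.1, a3.2, a4.1, a4.2]
      rw [k3, k4] at h1
      have m4 : Lam * (max e 0 + max f 0) ≤ Lam * (6 * dist x y) := mul_le_mul_of_nonneg_left m3 (by linarith)
      have m5 : 0 ≤ lam * (max (-e) 0 + max (-f) 0) := by positivity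
      linarith
    apply LipschitzWith.continuous (K := ⟨6 * Lam, by linarith⟩)
    apply LipschitzWith.of_dist_le_mul
    intro x y
    rw [Real.dist_eq, abs_le]
    have h1 := hL x y
    have h2 := hL y x
    rw [dist_comm] at h2
    change -(6 * Lam * dist x y) ≤ _ ∧ _ ≤ 6 * Lam * dist x y
    constructor <;> linarith
  · intro p q r p' q' r' h
    have h1 := hF _ _ (rotM_herm c s p q r) (rotM_herm c s p' q' r')
    rw [rotM_sub] at h1
    obtain ⟨e, f, k1, k2, k3, k4⟩ := rotM_eigs hcs (p - p') (q - q') (r - r')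
    rw [k3, k4] at h1
    have h2 : 0 ≤ Lam * (max e 0 + max f 0) - lam * (max (-e) 0 + max (-f) 0) := by linarith
    rw [← k1, ← k2]
    have hS : 0 < Lam + lam := by linarith
    have h3 : 0 ≤ (Lam + lam) * (e + f) + (Lam - lam) * |e - f| := by
      have hd : 0 ≤ Lam - lam := by linarith
      have g1 : (Lam - lam) * (e - f) ≤ (Lam - lam) * |e - f| := mul_le_mul_of_nonneg_left (le_abs_self _) hd
      have g2 : (Lam - lam) * (-(e - f)) ≤ (Lam - lam) * |e - f| := mul_le_mul_of_nonneg_left (neg_le_abs _) hd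
      have hL : 0 < Lam := by linarith
      rcases le_total 0 e with q1 | q1 <;> rcases le_total 0 f with q2 | q2
      · have : 0 ≤ (Lam - lam) * |e - f| := by positivity
        have : 0 ≤ (Lam + lam) * (e + f) := by positivity
        linarith
      · rw [max_eq_left q1, max_eq_right q2, max_eq_right (neg_nonpos.mpr q1), max_eq_left (neg_nonneg.mpr q2)] at h2
        linarith
      · rw [max_eq_right q1, max_eq_left q2, max_eq_left (neg_nonneg.mpr q1), max_eq_right (neg_nonpos.mpr q2)] at h2
        linarith
      · rw [max_eq_right q1, max_eq_right q2, max_eq_left (neg_nonneg.mpr q1), max_eq_left (neg_nonneg.mpr q2)] at h2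
        have h5 : 0 ≤ e + f := by
          have : 0 ≤ lam * (e + f) := by linarith
          exact nonneg_of_mul_nonneg_right this hlam
        have : 0 ≤ (Lam - lam) * |e - f| := by positivity
        have : 0 ≤ (Lam + lam) * (e + f) := mul_nonneg hS.le h5
        linarith
    have h4 : (Lam + lam) * (e + f + (Lam - lam) / (Lam + lam) * |e - f|) = (Lam + lam) * (e + f) + (Lam - lam) * |e - f| := by
      field_simp
    rw [← h4] at h3
    have := nonneg_of_mul_nonneg_right h3 hS
    linarith

/-- quadratic polynomial centred at `X0` -/
def cq (X0 : E2) (β0 β1 m00 m01 m11 : ℝ) (X : E2) : ℝ :=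
  β0 * (X 0 - X0 0) + β1 * (X 1 - X0 1) +
    (m00 * (X 0 - X0 0) ^ 2 + 2 * m01 * ((X 0 - X0 0) * (X 1 - X0 1)) + m11 * (X 1 - X0 1) ^ 2) / 2

lemma cq_contDiff (X0 : E2) (β0 β1 m00 m01 m11 : ℝ) : ContDiff ℝ 2 (cq X0 β0 β1 m00 m01 m11) := by
  unfold cq; fun_prop

lemma hasFDeriv_coord (i : Fin 2) (k : ℝ) (y : E2) : HasFDerivAt (fun X : E2 => X i - k) (EuclideanSpace.proj i : E2 →L[ℝ] ℝ) y :=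
  (EuclideanSpace.proj i : E2 →L[ℝ] ℝ).hasFDerivAt.sub_const k

lemma cq_fderiv (X0 : E2) (β0 β1 m00 m01 m11 : ℝ) (y w : E2) :
    fderiv ℝ (cq X0 β0 β1 m00 m01 m11) y w =
      (β0 + m00 * (y 0 - X0 0) + m01 * (y 1 - X0 1)) * w 0 + (β1 + m01 * (y 0 - X0 0) + m11 * (y 1 - X0 1)) * w 1 := by
  have h0 := hasFDeriv_coord 0 (X0 0) y
  have h1 := hasFDeriv_coord 1 (X0 1) y
  have h := (((h0.const_mul β0).add (h1.const_mul β1)).add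
    (((((h0.pow 2).const_mul m00).add ((h0.mul h1).const_mul (2 * m01))).add ((h1.pow 2).const_mul m11)).mul_const (1/2)))
  have e : cq X0 β0 β1 m00 m01 m11 = fun X : E2 => β0 * (X 0 - X0 0) + β1 * (X 1 - X0 1) +
    (m00 * (X 0 - X0 0) ^ 2 + 2 * m01 * ((X 0 - X0 0) * (X 1 - X0 1)) + m11 * (X 1 - X0 1) ^ 2) * (1/2) := by
    funext X; unfold cq; ring
  rw [e]
  erw [h.fderiv]
  simp
  ring

lemma cq_hess (X0 : E2) (β0 β1 m00 m01 m11 : ℝ) (x : E2) :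
    hess (cq X0 β0 β1 m00 m01 m11) x = !![m00, m01; m01, m11] := by
  have key : ∀ (k a b : ℝ) (w : E2), fderiv ℝ (fun y : E2 => k + a * (y 0 - X0 0) + b * (y 1 - X0 1)) x w = a * w 0 + b * w 1 := by
    intro k a b w
    have h0 := hasFDeriv_coord 0 (X0 0) x
    have h1 := hasFDeriv_coord 1 (X0 1) x
    have h := ((h0.const_mul a).const_add k).add (h1.const_mul b)
    erw [h.fderiv]
    simp
  ext i j
  simp only [hess, Matrix.of_apply, cq_fderiv]
  fin_cases j
  · simp only [Fin.zero_eta, EuclideanSpace.single_apply, ite_true, mul_one, one_ne_zero, ite_false, mul_zero, add_zero]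
    rw [key]
    fin_cases i <;> simp
  · simp only [Fin.mk_one, EuclideanSpace.single_apply, ite_true, mul_one, zero_ne_one, ite_false, mul_zero, zero_add]
    rw [key]
    fin_cases i <;> simp

/-- the rigid motion -/
def Phi (c s : ℝ) (z : R2) : E2 := !₂[(1 - z.2) * c - z.1 * s, (1 - z.2) * s + z.1 * c]

lemma Phi_0 (c s : ℝ) (z : R2) : Phi c s z 0 = (1 - z.2) * c - z.1 * s := rfl
lemma Phi_1 (c s : ℝ) (z : R2) : Phi c s z 1 = (1 - z.2) * s + z.1 * c := rfl

lemma Phi_inv {c s : ℝ} (hcs : c ^ 2 + s ^ 2 = 1) (z : R2) (X : E2) :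
    Phi c s (z + (-s * (X 0 - Phi c s z 0) + c * (X 1 - Phi c s z 1), -c * (X 0 - Phi c s z 0) - s * (X 1 - Phi c s z 1))) = X := by
  ext i
  fin_cases i
  · change Phi c s _ 0 = X 0
    simp only [Phi_0, Phi_1, Prod.fst_add, Prod.snd_add]
    linear_combination (X 0 - (1 - z.2) * c + z.1 * s) * hcs
  · change Phi c s _ 1 = X 1
    simp only [Phi_0, Phi_1, Prod.fst_add, Prod.snd_add]
    linear_combination (X 1 - (1 - z.2) * s - z.1 * c) * hcs

lemma Phi_norm_sq {c s : ℝ} (hcs : c ^ 2 + s ^ 2 = 1) (z : R2) : ‖Phi c s z‖ ^ 2 = z.1 ^ 2 + z.2 ^ 2 - 2 * z.2 + 1 := by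
  rw [EuclideanSpace.real_norm_sq_eq, Fin.sum_univ_two, Phi_0, Phi_1]
  linear_combination (z.1 ^ 2 + (1 - z.2) ^ 2) * hcs

lemma Phi_cont (c s : ℝ) : Continuous (Phi c s) := by
  unfold Phi
  apply (PiLp.continuous_toLp 2 (fun _ : Fin 2 => ℝ)).comp
  apply continuous_pi
  intro i
  fin_cases i
  · change Continuous (fun z : R2 => (1 - z.2) * c - z.1 * s); fun_prop
  · change Continuous (fun z : R2 => (1 - z.2) * s + z.1 * c); fun_prop

lemma Phi_sol {F : Mat2 → ℝ} {u : E2 → ℝ} (hu : IsViscositySol F u (ball (0 : E2) 1)) {c s : ℝ} (hcs : c ^ 2 + s ^ 2 = 1)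
    {z : R2} (hz : z.1 ^ 2 + z.2 ^ 2 < 2 * z.2) :
    SolAt (fun p q r => F (rotM c s p q r)) (fun x => u (Phi c s x)) z := by
  have hzb : Phi c s z ∈ ball (0 : E2) 1 := by
    rw [mem_ball_zero_iff]
    have := Phi_norm_sq hcs z
    exact lt_of_pow_lt_pow_left₀ 2 zero_le_one (by rw [this]; linarith)
  obtain ⟨Z, hZ⟩ : ∃ Z, Z = Phi c s z := ⟨_, rfl⟩
  have ht : Tendsto (fun X : E2 => ((-s * (X 0 - Z 0) + c * (X 1 - Z 1), -c * (X 0 - Z 0) - s * (X 1 - Z 1)) : R2)) (𝓝 Z) (𝓝 0) := by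
    have : Continuous (fun X : E2 => ((-s * (X 0 - Z 0) + c * (X 1 - Z 1), -c * (X 0 - Z 0) - s * (X 1 - Z 1)) : R2)) := by fun_prop
    have h2 := this.tendsto Z
    rw [show (0 : R2) = (0, 0) from rfl]
    simpa using h2
  have hq : ∀ b1 b2 p q r (X : E2), cq Z (-(s * b1) - c * b2) (c * b1 - s * b2) (rotM c s p q r 0 0) (rotM c s p q r 0 1) (rotM c s p q r 1 1) X
      = qd b1 b2 p q r (-s * (X 0 - Z 0) + c * (X 1 - Z 1), -c * (X 0 - Z 0) - s * (X 1 - Z 1)) := by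
    intro b1 b2 p q r X
    simp [cq, qd, rotM]
    ring
  have hh : ∀ b1 b2 p q r, hess (cq Z (-(s * b1) - c * b2) (c * b1 - s * b2) (rotM c s p q r 0 0) (rotM c s p q r 0 1) (rotM c s p q r 1 1)) Z = rotM c s p q r := by
    intro b1 b2 p q r
    rw [cq_hess]
    ext i j; fin_cases i <;> fin_cases j <;> simp [rotM]
  have hq0 : ∀ b1 b2 p q r, cq Z (-(s * b1) - c * b2) (c * b1 - s * b2) (rotM c s p q r 0 0) (rotM c s p q r 0 1) (rotM c s p q r 1 1) Z = 0 := by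
    intro b1 b2 p q r; simp [cq]
  constructor
  · intro b1 b2 p q r h
    have h1 := (hu _ (cq_contDiff Z (-(s * b1) - c * b2) (c * b1 - s * b2) (rotM c s p q r 0 0) (rotM c s p q r 0 1) (rotM c s p q r 1 1)) _ hzb).1 (by
      rw [← hZ]
      filter_upwards [ht.eventually h] with X hX
      rw [hZ, Phi_inv hcs, ← hZ] at hX
      rw [hq0, hq]
      linarith)
    rw [← hZ, hh] at h1
    exact h1
  · intro b1 b2 p q r h
    have h1 := (hu _ (cq_contDiff Z (-(s * b1) - c * b2) (c * b1 - s * b2) (rotM c s p q r 0 0) (rotM c s p q r 0 1) (rotM c s p q r 1 1)) _ hzb).2 (by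
      rw [← hZ]
      filter_upwards [ht.eventually h] with X hX
      rw [hZ, Phi_inv hcs, ← hZ] at hX
      rw [hq0, hq]
      linarith)
    rw [← hZ, hh] at h1
    exact h1

lemma supAbs_nonneg (u : E2 → ℝ) (S : Set E2) : 0 ≤ supAbs u S :=
  Real.iSup_nonneg fun _ => Real.iSup_nonneg fun _ => abs_nonneg _

lemma le_supAbs {u : E2 → ℝ} (hu : ContinuousOn u (closedBall (0 : E2) 1)) {x : E2} (hx : x ∈ closedBall (0 : E2) 1) :
    |u x| ≤ supAbs u (ball 0 1) := by
  obtain ⟨M, hM⟩ := (isCompact_closedBall (0 : E2) 1).exists_bound_of_continuousOn hu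
  have hM0 : 0 ≤ M := (norm_nonneg _).trans (hM 0 (by simp))
  have h1 : ∀ y ∈ ball (0 : E2) 1, |u y| ≤ supAbs u (ball 0 1) := by
    intro y hy
    have hb : BddAbove (Set.range fun x : E2 => ⨆ (_ : x ∈ ball (0 : E2) 1), |u x|) := by
      refine ⟨M, ?_⟩
      rintro _ ⟨w, rfl⟩
      exact Real.iSup_le (fun hw => hM w (ball_subset_closedBall hw)) hM0
    refine le_trans ?_ (le_ciSup hb y)
    rw [ciSup_pos hy]
  have hcl : closure (ball (0 : E2) 1) = closedBall 0 1 := closure_ball _ one_ne_zero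
  exact le_on_closure h1 (by rw [hcl]; exact hu.abs) continuousOn_const (by rw [hcl]; exact hx)

lemma vecNorm_nonneg (v : Fin 2 → ℝ) : 0 ≤ vecNorm v := Real.sqrt_nonneg _

lemma abs_le_vecNorm (v : Fin 2 → ℝ) : |v 0| ≤ vecNorm v ∧ |v 1| ≤ vecNorm v := by
  unfold vecNorm
  rw [Fin.sum_univ_two]
  exact ⟨Real.abs_le_sqrt (by linarith [sq_nonneg (v 1)]), Real.abs_le_sqrt (by linarith [sq_nonneg (v 0)])⟩

lemma vecNorm_le (v : Fin 2 → ℝ) : vecNorm v ≤ |v 0| + |v 1| := by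
  unfold vecNorm
  rw [Fin.sum_univ_two]
  apply Real.sqrt_le_iff.mpr
  refine ⟨by positivity, ?_⟩
  rw [← sq_abs (v 0), ← sq_abs (v 1)]
  have : 0 ≤ |v 0| * |v 1| := by positivity
  linarith

lemma matNorm_nonneg (A : Mat2) : 0 ≤ matNorm A := by unfold matNorm; positivity

lemma matNorm_eq (A : Mat2) : matNorm A = |A 0 0| + |A 0 1| + (|A 1 0| + |A 1 1|) := by
  simp [matNorm, Fin.sum_univ_two]

lemma cs_bd {c s : ℝ} (hcs : c ^ 2 + s ^ 2 = 1) : |c| ≤ 1 ∧ |s| ≤ 1 := by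
  constructor
  · rw [← sq_le_one_iff_abs_le_one]; linarith [sq_nonneg s]
  · rw [← sq_le_one_iff_abs_le_one]; linarith [sq_nonneg c]

lemma abs_mul_le_of {x y B : ℝ} (hx : |x| ≤ 1) (hy : |y| ≤ B) : |x * y| ≤ B := by
  rw [abs_mul]
  calc |x| * |y| ≤ 1 * B := mul_le_mul hx hy (abs_nonneg _) zero_le_one
    _ = B := one_mul B

lemma abs_mul_one {x y : ℝ} (hx : |x| ≤ 1) (hy : |y| ≤ 1) : |x * y| ≤ 1 := abs_mul_le_of hx hy

lemma rotM_entry {c s : ℝ} (hcs : c ^ 2 + s ^ 2 = 1) {p q r B : ℝ} (hp : |p| ≤ B) (hq : |q| ≤ B) (hr : |r| ≤ B) :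
    matNorm (rotM c s p q r) ≤ 16 * B := by
  obtain ⟨hc, hs⟩ := cs_bd hcs
  have a1 : |s ^ 2| ≤ 1 := by rw [sq]; exact abs_mul_one hs hs
  have a2 : |c ^ 2| ≤ 1 := by rw [sq]; exact abs_mul_one hc hc
  have a3 : |s * c| ≤ 1 := abs_mul_one hs hc
  have t1 := abs_le.mp (abs_mul_le_of a1 hp)
  have t2 := abs_le.mp (abs_mul_le_of a1 hq)
  have t3 := abs_le.mp (abs_mul_le_of a1 hr)
  have t4 := abs_le.mp (abs_mul_le_of a2 hp)
  have t5 := abs_le.mp (abs_mul_le_of a2 hq)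
  have t6 := abs_le.mp (abs_mul_le_of a2 hr)
  have t7 := abs_le.mp (abs_mul_le_of a3 hp)
  have t8 := abs_le.mp (abs_mul_le_of a3 hq)
  have t9 := abs_le.mp (abs_mul_le_of a3 hr)
  have r1 : |p * s ^ 2 + 2 * q * (s * c) + r * c ^ 2| ≤ 4 * B := by
    rw [abs_le]; constructor <;> linarith
  have r2 : |(r - p) * (s * c) + q * (s ^ 2 - c ^ 2)| ≤ 4 * B := by
    rw [abs_le]; constructor <;> linarith
  have r3 : |p * c ^ 2 - 2 * q * (s * c) + r * s ^ 2| ≤ 4 * B := by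
    rw [abs_le]; constructor <;> linarith
  rw [matNorm_eq]
  simp only [rotM, Matrix.of_apply, Matrix.cons_val_zero, Matrix.cons_val_one, Matrix.cons_val']
  linarith

/-- a quadratic polynomial in the rotated frame -/
lemma quad_to (Q : QuadPoly) {c s : ℝ} (hcs : c ^ 2 + s ^ 2 = 1) : ∃ A B1 B2 p q r : ℝ,
    A = Q.eval !₂[c, s] ∧
    |B1| ≤ 2 * vecNorm (Q.grad !₂[c, s]) ∧ |B2| ≤ 2 * vecNorm (Q.grad !₂[c, s]) ∧
    |p| ≤ matNorm Q.Q ∧ |q| ≤ matNorm Q.Q ∧ |r| ≤ matNorm Q.Q ∧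
    ∀ z : R2, Q.eval (Phi c s z) = A + qd B1 B2 p q r z := by
  obtain ⟨hc, hs⟩ := cs_bd hcs
  have hsym : Q.Q 1 0 = Q.Q 0 1 := by
    have := congrFun (congrFun Q.symm 0) 1
    simpa using this
  obtain ⟨γ, hγ⟩ : ∃ γ, γ = Q.grad !₂[c, s] := ⟨_, rfl⟩
  obtain ⟨g0, g1⟩ := abs_le_vecNorm γ
  have a1 : |s * s| ≤ 1 := abs_mul_one hs hs
  have a2 : |c * c| ≤ 1 := abs_mul_one hc hc
  have a3 : |s * c| ≤ 1 := abs_mul_one hs hc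
  have hm := matNorm_eq Q.Q
  have u1 := fun x : ℝ => abs_le.mp (abs_mul_le_of a1 (le_refl |x|))
  have u2 := fun x : ℝ => abs_le.mp (abs_mul_le_of a2 (le_refl |x|))
  have u3 := fun x : ℝ => abs_le.mp (abs_mul_le_of a3 (le_refl |x|))
  refine ⟨Q.eval !₂[c, s], -s * γ 0 + c * γ 1, -c * γ 0 - s * γ 1,
    s * s * Q.Q 0 0 - s * c * Q.Q 0 1 - s * c * Q.Q 1 0 + c * c * Q.Q 1 1,
    s * c * Q.Q 0 0 + s * s * Q.Q 0 1 - c * c * Q.Q 1 0 - s * c * Q.Q 1 1,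
    c * c * Q.Q 0 0 + s * c * Q.Q 0 1 + s * c * Q.Q 1 0 + s * s * Q.Q 1 1, rfl, ?_, ?_, ?_, ?_, ?_, ?_⟩
  · have k1 := abs_le.mp (abs_mul_le_of hs g0)
    have k2 := abs_le.mp (abs_mul_le_of hc g1)
    rw [← hγ, abs_le]; constructor <;> linarith
  · have k1 := abs_le.mp (abs_mul_le_of hc g0)
    have k2 := abs_le.mp (abs_mul_le_of hs g1)
    rw [← hγ, abs_le]; constructor <;> linarith
  · have k1 := u1 (Q.Q 0 0)
    have k2 := u3 (Q.Q 0 1)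
    have k3 := u3 (Q.Q 1 0)
    have k4 := u2 (Q.Q 1 1)
    rw [abs_le]; constructor <;> linarith
  · have k1 := u3 (Q.Q 0 0)
    have k2 := u1 (Q.Q 0 1)
    have k3 := u2 (Q.Q 1 0)
    have k4 := u3 (Q.Q 1 1)
    rw [abs_le]; constructor <;> linarith
  · have k1 := u2 (Q.Q 0 0)
    have k2 := u3 (Q.Q 0 1)
    have k3 := u3 (Q.Q 1 0)
    have k4 := u1 (Q.Q 1 1)
    rw [abs_le]; constructor <;> linarith
  · intro z
    simp only [hγ, QuadPoly.eval, QuadPoly.grad, Fin.sum_univ_two, Phi_0, Phi_1, qd, hsym]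
    simp
    ring

lemma quad_from {c s : ℝ} (hcs : c ^ 2 + s ^ 2 = 1) (A B1 B2 p q r B : ℝ) (h1 : |B1| ≤ B) (h2 : |B2| ≤ B)
    (hp : |p| ≤ B) (hq : |q| ≤ B) (hr : |r| ≤ B) :
    ∃ P : QuadPoly, P.Q = rotM c s p q r ∧ vecNorm (P.grad !₂[c, s]) + matNorm P.Q ≤ 20 * B ∧
      ∀ z : R2, P.eval (Phi c s z) = A + qd B1 B2 p q r z := by
  obtain ⟨hc, hs⟩ := cs_bd hcs
  obtain ⟨b, hb⟩ : ∃ b : Fin 2 → ℝ, b = ![-s * B1 - c * B2 - c * r - s * q, c * B1 - s * B2 - s * r + c * q] := ⟨_, rfl⟩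
  refine ⟨⟨A + B2 + r / 2, b, rotM c s p q r, rotM_herm c s p q r⟩, rfl, ?_, ?_⟩
  · have hg0 : QuadPoly.grad ⟨A + B2 + r / 2, b, rotM c s p q r, rotM_herm c s p q r⟩ !₂[c, s] 0 = -s * B1 - c * B2 := by
      simp [QuadPoly.grad, hb, rotM]
      linear_combination (c * r + s * q) * hcs
    have hg1 : QuadPoly.grad ⟨A + B2 + r / 2, b, rotM c s p q r, rotM_herm c s p q r⟩ !₂[c, s] 1 = c * B1 - s * B2 := by
      simp [QuadPoly.grad, hb, rotM]
      linear_combination (s * r - c * q) * hcs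
    have k1 := abs_le.mp (abs_mul_le_of hs h1)
    have k2 := abs_le.mp (abs_mul_le_of hc h2)
    have k3 := abs_le.mp (abs_mul_le_of hc h1)
    have k4 := abs_le.mp (abs_mul_le_of hs h2)
    have r1 : |-s * B1 - c * B2| ≤ 2 * B := by rw [abs_le]; constructor <;> linarith
    have r2 : |c * B1 - s * B2| ≤ 2 * B := by rw [abs_le]; constructor <;> linarith
    have r3 := vecNorm_le (QuadPoly.grad ⟨A + B2 + r / 2, b, rotM c s p q r, rotM_herm c s p q r⟩ !₂[c, s])
    rw [hg0, hg1] at r3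
    have r4 := rotM_entry hcs hp hq hr
    dsimp only
    linarith
  · intro z
    simp [QuadPoly.eval, hb, rotM, Fin.sum_univ_two, Phi_0, Phi_1, qd]
    linear_combination ((B1 + q) * z.1 + (B2 + r) * (z.2 - 1) +
      (c ^ 2 + s ^ 2 + 1) / 2 * (p * z.1 ^ 2 + 2 * q * z.1 * (z.2 - 1) + r * (z.2 - 1) ^ 2)) * hcs

/-- Boundary pointwise `C^{2,ᾱ}` regularity: there are universal constants `ᾱ ∈ (0,1)` and
`C > 0` depending only on `lam, Lam` such that for any uniformly elliptic `F` with `F(0)=0`,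
any continuous viscosity solution `u` of `F(D²u)=0` in `B₁` with `u = g` on `∂B₁`, any
`x₀ ∈ ∂B₁`, and `g ∈ C^{2,ᾱ}(x₀)`, there is a quadratic polynomial `P_{x₀}` with
`|u − P_{x₀}| ≤ C|x−x₀|^{2+ᾱ}(‖u‖_∞ + ‖g‖_{C^{2,ᾱ}(x₀)})` in `B₁`, `F(D²P_{x₀}) = 0` and
`|DP_{x₀}(x₀)| + |D²P_{x₀}| ≤ C(‖u‖_∞ + ‖g‖_{C^{2,ᾱ}(x₀)})`. -/
theorem boundary_pointwise_C2alpha (lam Lam : ℝ) (hlam : 0 < lam) (hLam : lam ≤ Lam) :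
    ∃ α C : ℝ, α ∈ Set.Ioo (0 : ℝ) 1 ∧ 0 < C ∧
      ∀ (F : Mat2 → ℝ) (u g : E2 → ℝ) (x₀ : E2),
        UniformlyElliptic lam Lam F → F 0 = 0 →
        ContinuousOn u (closedBall (0 : E2) 1) →
        IsViscositySol F u (ball (0 : E2) 1) →
        (∀ x ∈ sphere (0 : E2) 1, u x = g x) →
        x₀ ∈ sphere (0 : E2) 1 →
        (∃ Q K, PtHolderData α g x₀ Q K) →
        ∃ P : QuadPoly,
          (∀ x ∈ ball (0 : E2) 1,
            |u x - P.eval x| ≤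
              C * ‖x - x₀‖ ^ (2 + α) * (supAbs u (ball 0 1) + ptHolderNorm α g x₀)) ∧
          F P.Q = 0 ∧
          vecNorm (P.grad x₀) + matNorm P.Q ≤
            C * (supAbs u (ball 0 1) + ptHolderNorm α g x₀) := by
  obtain ⟨α, C, hα0, hα1, hC, H⟩ := disk_thm (κ := (Lam - lam) / (Lam + lam))
    (div_nonneg (by linarith) (by linarith)) (by rw [div_lt_one (by linarith)]; linarith)
  refine ⟨α, 320 * C, ⟨hα0, hα1⟩, by positivity, ?_⟩
  intro F u g x₀ hF hF0 hu hsol hug hx₀ hex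
  obtain ⟨S, hS⟩ : ∃ S, S = supAbs u (ball 0 1) + ptHolderNorm α g x₀ := ⟨_, rfl⟩
  have hbdd : ∀ v ∈ {v | ∃ Q K, PtHolderData α g x₀ Q K ∧
      v = K + |Q.eval x₀| + vecNorm (Q.grad x₀) + matNorm Q.Q}, 0 ≤ v := by
    rintro v ⟨Q, K, hQK, rfl⟩
    have h1 := hQK.1
    have h2 := vecNorm_nonneg (Q.grad x₀)
    have h3 := matNorm_nonneg Q.Q
    positivity
  have hpt : 0 ≤ ptHolderNorm α g x₀ := Real.sInf_nonneg hbdd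
  have hsup := supAbs_nonneg u (ball 0 1)
  rw [← hS]
  rcases eq_or_lt_of_le (add_nonneg hsup hpt) with h0 | hpos
  · refine ⟨⟨0, 0, 0, by simp⟩, ?_, hF0, ?_⟩
    · intro x hx
      have h1 := le_supAbs hu (ball_subset_closedBall hx)
      have h2 : u x = 0 := abs_eq_zero.mp (le_antisymm (by linarith) (abs_nonneg _))
      rw [hS, ← h0, h2]
      simp [QuadPoly.eval]
    · rw [hS, ← h0]
      simp [QuadPoly.grad, vecNorm, matNorm]
  rw [← hS] at hpos
  obtain ⟨w, ⟨Q, K, hQK, rfl⟩, hw⟩ := exists_lt_of_csInf_lt (s := {v | ∃ Q K, PtHolderData α g x₀ Q K ∧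
      v = K + |Q.eval x₀| + vecNorm (Q.grad x₀) + matNorm Q.Q})
    (by obtain ⟨Q, K, h⟩ := hex; exact ⟨_, Q, K, h, rfl⟩)
    (show ptHolderNorm α g x₀ < ptHolderNorm α g x₀ + S by linarith)
  obtain ⟨c, hc⟩ : ∃ c, c = x₀ 0 := ⟨_, rfl⟩
  obtain ⟨s, hs⟩ : ∃ s, s = x₀ 1 := ⟨_, rfl⟩
  have hx0 : x₀ = !₂[c, s] := by
    ext i; fin_cases i
    · simp [hc]
    · simp [hs]
  have hcs : c ^ 2 + s ^ 2 = 1 := by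
    have h1 : ‖x₀‖ = 1 := by simpa using hx₀
    have h2 := EuclideanSpace.real_norm_sq_eq x₀
    rw [h1, Fin.sum_univ_two, ← hc, ← hs] at h2
    linarith
  obtain ⟨A, B1, B2, p, q, r, hA, hB1, hB2, hp, hq, hr, hev⟩ := quad_to Q hcs
  rw [← hx0] at hA hB1 hB2
  have hK0 := hQK.1
  have hn1 := vecNorm_nonneg (Q.grad x₀)
  have hn2 := matNorm_nonneg Q.Q
  have hn3 := abs_nonneg (Q.eval x₀)
  have hnorm2 : ∀ z : R2, ‖Phi c s z - x₀‖ ^ 2 = z.1 ^ 2 + z.2 ^ 2 := by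
    intro z
    rw [EuclideanSpace.real_norm_sq_eq, Fin.sum_univ_two, PiLp.sub_apply, PiLp.sub_apply, Phi_0, Phi_1, ← hc, ← hs]
    linear_combination (z.1 ^ 2 + z.2 ^ 2) * hcs
  have hlow : ∀ z : R2, ‖z‖ ≤ ‖Phi c s z - x₀‖ := by
    intro z
    rw [Prod.norm_def]
    apply max_le
    · apply abs_le_of_sq_le_sq _ (norm_nonneg _)
      rw [hnorm2]; linarith [sq_nonneg z.2]
    · apply abs_le_of_sq_le_sq _ (norm_nonneg _)
      rw [hnorm2]; linarith [sq_nonneg z.1]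
  have hup : ∀ z : R2, ‖Phi c s z - x₀‖ ≤ 2 * ‖z‖ := by
    intro z
    apply le_of_sq_le_sq _ (by positivity)
    rw [hnorm2]
    have h1 : z.1 ^ 2 ≤ ‖z‖ ^ 2 := by
      rw [← sq_abs]; exact pow_le_pow_left₀ (abs_nonneg _) (norm_fst_le z) 2
    have h2 : z.2 ^ 2 ≤ ‖z‖ ^ 2 := by
      rw [← sq_abs]; exact pow_le_pow_left₀ (abs_nonneg _) (norm_snd_le z) 2
    linarith [sq_nonneg ‖z‖]
  have hin : ∀ z ∈ Dk, Phi c s z ∈ closedBall (0 : E2) 1 := by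
    intro z hz
    have h : z.1 ^ 2 + z.2 ^ 2 ≤ 2 * z.2 := hz
    rw [mem_closedBall_zero_iff]
    apply le_of_sq_le_sq _ zero_le_one
    rw [Phi_norm_sq hcs]; linarith
  obtain ⟨A', B1', B2', p', q', r', k1, k2, k3, k4, k5, kroot, kapp⟩ := H
    (fun p q r => F (rotM c s p q r)) (fun x => u (Phi c s x)) (16 * S) A B1 B2 p q r
    (Op_rot hlam hLam hF hcs)
    (by
      have : rotM c s 0 0 0 = 0 := by ext i j; fin_cases i <;> fin_cases j <;> simp [rotM]
      rw [this]; exact hF0)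
    (by linarith) (by rw [hA]; linarith) (by linarith) (by linarith) (by linarith) (by linarith) (by linarith)
    (hu.comp (Phi_cont c s).continuousOn hin)
    (fun z hz => Phi_sol hsol hcs hz)
    (fun z hz => by
      have := le_supAbs hu (hin z hz)
      linarith)
    (fun z hz => by
      have m0 : Phi c s z ∈ sphere (0 : E2) 1 := by
        rw [mem_sphere_zero_iff_norm]
        have := Phi_norm_sq hcs z
        rw [hz, sub_self, zero_add] at this
        exact (pow_eq_one_iff_of_nonneg (norm_nonneg _) two_ne_zero).mp this
      have m1 := hQK.2 _ m0
      rw [← hug _ m0, hev] at m1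
      refine m1.trans ?_
      have m2 : ‖Phi c s z - x₀‖ ^ (2 + α) ≤ 8 * ‖z‖ ^ (2 + α) := by
        calc ‖Phi c s z - x₀‖ ^ (2 + α) ≤ (2 * ‖z‖) ^ (2 + α) := Real.rpow_le_rpow (norm_nonneg _) (hup z) (by linarith)
          _ = 2 ^ (2 + α) * ‖z‖ ^ (2 + α) := Real.mul_rpow (by norm_num) (norm_nonneg _)
          _ ≤ 2 ^ (3 : ℝ) * ‖z‖ ^ (2 + α) := by
              apply mul_le_mul_of_nonneg_right _ (by positivity)
              exact Real.rpow_le_rpow_of_exponent_le (by norm_num) (by linarith)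
          _ = 8 * ‖z‖ ^ (2 + α) := by norm_num
      have m3 : 0 ≤ ‖Phi c s z - x₀‖ ^ (2 + α) := by positivity
      calc K * ‖Phi c s z - x₀‖ ^ (2 + α) ≤ (2 * S) * (8 * ‖z‖ ^ (2 + α)) :=
            mul_le_mul (by linarith) m2 m3 (by linarith)
        _ = 16 * S * ‖z‖ ^ (2 + α) := by ring)
  obtain ⟨P, hP1, hP2, hP3⟩ := quad_from hcs A' B1' B2' p' q' r' (C * (16 * S)) k1 k2 k3 k4 k5
  refine ⟨P, ?_, ?_, ?_⟩
  · intro x hx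
    have hx' := Phi_inv hcs 0 x
    rw [zero_add] at hx'
    obtain ⟨z, hz⟩ : ∃ z : R2, Phi c s z = x := ⟨_, hx'⟩
    have hzD : z ∈ Dk := by
      have h1 : ‖x‖ < 1 := by simpa using hx
      have h2 := Phi_norm_sq hcs z
      rw [hz] at h2
      have h3 : ‖x‖ ^ 2 ≤ 1 := pow_le_one₀ (norm_nonneg _) h1.le
      change z.1 ^ 2 + z.2 ^ 2 ≤ 2 * z.2
      linarith
    have m1 := kapp z hzD
    rw [← hP3, hz] at m1
    refine m1.trans ?_
    have m2 : ‖z‖ ^ (2 + α) ≤ ‖x - x₀‖ ^ (2 + α) := by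
      rw [← hz]; exact Real.rpow_le_rpow (norm_nonneg _) (hlow z) (by linarith)
    have m3 : 0 ≤ ‖x - x₀‖ ^ (2 + α) := by positivity
    have m4 : C * (16 * S) * ‖z‖ ^ (2 + α) ≤ C * (16 * S) * ‖x - x₀‖ ^ (2 + α) :=
      mul_le_mul_of_nonneg_left m2 (by positivity)
    have m5 : 0 ≤ C * S * ‖x - x₀‖ ^ (2 + α) := by positivity
    linarith
  · rw [hP1]; exact kroot
  · rw [hx0]
    linarith
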